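/- arXiv:2012.13709 — 2 statements merged into one kernel-verified Lean document; each statement's English description precedes it below -/
import Mathlib

section
/- Let Ω ⊆ ℝⁿ be an open set with n = 2m + s, s ≥ 0, and let 𝒥 be a smooth skew-symmetric matrix field on Ω (components 𝒥^{ij}, with 𝒥^{ij} = −𝒥^{ji}) such that the matrix 𝒥(x) has rank 2m at every x ∈ Ω and the Jacobi identity Σ_μ (𝒥^{iμ} ∂_μ𝒥^{jk} + 𝒥^{jμ} ∂_μ𝒥^{ki} + 𝒥^{kμ} ∂_μ𝒥^{ij}) = 0 holds on Ω for all i,j,k. Then for every point x₀ ∈ Ω there exist an open neighborhood U ⊆ Ω of x₀ and a smooth map φ = (p¹,…,p^m, q¹,…,q^m, C¹,…,C^s) : U → ℝⁿ that is a diffeomorphism onto an open subset of ℝⁿ such that, for all x ∈ U and all a,b ∈ {1,…,n}, Σ_{c,d} ∂_cφ^a(x) ∂_dφ^b(x) 𝒥^{cd}(x) = J₀^{ab}, where J₀ is the constant skew-symmetric matrix with J₀^{(m+i) i} = 1 and J₀^{i (m+i)} = −1 for i = 1,…,m and all other entries zero; i.e., in the new coordinates 𝒥 takes the canonical form Σ_{i=1}^m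 ∂_{q^i} ∧ ∂_{p^i}. -/
/-- Partial derivative in the `i`-th coordinate direction. -/
noncomputable def pd {n : ℕ} (i : Fin n) (f : (Fin n → ℝ) → ℝ) (x : Fin n → ℝ) : ℝ :=
  fderiv ℝ f x (Pi.single i 1)

/-- The constant canonical Poisson matrix `J₀` on `ℝ^(2m+s)`:
`J₀^{(m+i) i} = 1`, `J₀^{i (m+i)} = -1` for `i = 1,…,m`, all other entries zero. -/
noncomputable def J₀ (m s : ℕ) (a b : Fin (2 * m + s)) : ℝ :=
  if b.val < m ∧ a.val = b.val + m then 1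
  else if a.val < m ∧ b.val = a.val + m then -1
  else 0

section LieDarboux

open Set Filter Topology
open scoped ContDiff

section Nemytskii

variable {K E F : Type} [TopologicalSpace K] [CompactSpace K]
  [NormedAddCommGroup E] [NormedSpace ℝ E] [NormedAddCommGroup F] [NormedSpace ℝ F]

/-- Pointwise application of a continuous family of operators to a continuous function. -/
noncomputable def pointwiseApply (K E F : Type) [TopologicalSpace K] [CompactSpace K]
    [NormedAddCommGroup E] [NormedSpace ℝ E] [NormedAddCommGroup F] [NormedSpace ℝ F] :
    C(K, E →L[ℝ] F) →L[ℝ] C(K, E) →L[ℝ] C(K, F) :=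
  LinearMap.mkContinuous₂
    (LinearMap.mk₂ ℝ
      (fun (M : C(K, E →L[ℝ] F)) (u : C(K, E)) =>
        (⟨fun k => M k (u k), M.continuous.clm_apply u.continuous⟩ : C(K, F)))
      (fun _ _ _ => by ext; simp) (fun _ _ _ => by ext; simp)
      (fun _ _ _ => by ext; simp) (fun _ _ _ => by ext; simp))
    1 (fun M u => by
      rw [ContinuousMap.norm_le _ (by positivity)]
      intro k
      simp only [LinearMap.mk₂_apply, ContinuousMap.coe_mk, one_mul]
      exact (M k).le_of_opNorm_le_of_le (M.norm_coe_le_norm k) (u.norm_coe_le_norm k))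

@[simp]
lemma pointwiseApply_apply (M : C(K, E →L[ℝ] F)) (u : C(K, E)) (k : K) :
    pointwiseApply K E F M u k = M k (u k) := rfl

/-- The superposition operator `u ↦ f ∘ u` between spaces of continuous functions is
differentiable when `f` is continuously differentiable. -/
lemma hasFDerivAt_continuousMap_comp (f : C(E, F)) (f' : C(E, E →L[ℝ] F))
    (hf : ∀ x, HasFDerivAt f (f' x) x) (u : C(K, E)) :
    HasFDerivAt (fun w : C(K, E) => f.comp w) (pointwiseApply K E F (f'.comp u)) u := by
  rw [hasFDerivAt_iff_isLittleO, Asymptotics.isLittleO_iff]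
  intro ε hε
  obtain ⟨δ, hδ, hclose⟩ := (Metric.continuousAt_iff (f := fun w : C(K, E) => f'.comp w)
    (a := u)).1 (by exact (ContinuousMap.continuous_postcomp f').continuousAt) ε hε
  filter_upwards [Metric.ball_mem_nhds u hδ] with w hw
  rw [ContinuousMap.norm_le _ (by positivity)]
  intro k
  have hwk : w k ∈ Metric.ball (u k) δ :=
    (ContinuousMap.dist_apply_le_dist k).trans_lt hw
  have hbound : ∀ z ∈ Metric.ball (u k) δ, ‖f' z - f' (u k)‖ ≤ ε := by
    intro z hz
    have h1 : dist (u + ContinuousMap.const K (z - u k)) u < δ := by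
      rw [dist_eq_norm, add_sub_cancel_left]
      refine lt_of_le_of_lt ?_ (mem_ball_iff_norm.1 hz)
      rw [ContinuousMap.norm_le _ (norm_nonneg _)]
      intro; simp
    have h2 := (ContinuousMap.dist_apply_le_dist k).trans (hclose h1).le
    simpa [dist_eq_norm] using h2
  have := (convex_ball (u k) δ).norm_image_sub_le_of_norm_hasFDerivWithin_le'
    (fun z _ => (hf z).hasFDerivWithinAt) hbound (Metric.mem_ball_self hδ) hwk
  calc _ = ‖f (w k) - f (u k) - f' (u k) (w k - u k)‖ := by simp
    _ ≤ ε * ‖w k - u k‖ := this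
    _ ≤ ε * ‖w - u‖ := by
      gcongr
      exact (w - u).norm_coe_le_norm k

lemma contDiff_nat_continuousMap_comp (n : ℕ) :
    ∀ {F : Type} [NormedAddCommGroup F] [NormedSpace ℝ F] (f : C(E, F)), ContDiff ℝ ∞ f →
      ContDiff ℝ n (fun w : C(K, E) => f.comp w) := by
  induction n with
  | zero =>
    intro F _ _ f hf
    exact contDiff_zero.2 (ContinuousMap.continuous_postcomp f)
  | succ n ih =>
    intro F _ _ f hf
    have hf' : ContDiff ℝ ∞ (fderiv ℝ f) := hf.fderiv_right (by simp)
    refine contDiff_succ_iff_hasFDerivAt.2 ⟨_, ?_, fun u => hasFDerivAt_continuousMap_comp f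
      ⟨fderiv ℝ f, hf'.continuous⟩
      (fun x => (hf.differentiable (by simp) x).hasFDerivAt) u⟩
    exact (pointwiseApply K E F).contDiff.comp (ih ⟨fderiv ℝ f, hf'.continuous⟩ hf')

/-- The superposition operator of a smooth map is smooth. -/
lemma contDiff_continuousMap_comp (f : C(E, F)) (hf : ContDiff ℝ ∞ f) :
    ContDiff ℝ ∞ (fun w : C(K, E) => f.comp w) :=
  contDiff_infty.2 fun n => contDiff_nat_continuousMap_comp n f hf

end Nemytskii

section InverseFunction

variable {E F : Type} [NormedAddCommGroup E] [NormedSpace ℝ E] [CompleteSpace E]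
  [NormedAddCommGroup F] [NormedSpace ℝ F]

/-- Inverse function theorem for maps that are smooth near a point: both the map and its local
inverse are smooth on the whole domain. -/
lemma exists_smooth_openPartialHomeomorph {f : E → F} {x₀ : E} {f' : E ≃L[ℝ] F}
    (hf : ∀ᶠ x in 𝓝 x₀, ContDiffAt ℝ ∞ f x) (hf' : HasFDerivAt f (f' : E →L[ℝ] F) x₀) :
    ∃ e : OpenPartialHomeomorph E F, (∀ x, e x = f x) ∧ x₀ ∈ e.source ∧
      (∀ x ∈ e.source, ContDiffAt ℝ ∞ f x) ∧ ∀ y ∈ e.target, ContDiffAt ℝ ∞ e.symm y := by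
  have h0 := hf.self_of_nhds
  have hcont : ContinuousAt (fderiv ℝ f) x₀ :=
    (h0.fderiv_right (m := 0) (by simp)).continuousAt
  have hinv : ∀ᶠ x in 𝓝 x₀, fderiv ℝ f x ∈ range ((↑) : (E ≃L[ℝ] F) → E →L[ℝ] F) := by
    apply hcont.eventually_mem
    rw [hf'.fderiv]
    exact ContinuousLinearEquiv.nhds f'
  obtain ⟨S, hS, hSo, hxS⟩ := eventually_nhds_iff.1 (hf.and hinv)
  let e₀ := h0.toOpenPartialHomeomorph f hf' (by simp)
  let e := e₀.restrOpen S hSo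
  have hsrc : ∀ x ∈ e.source, x ∈ S := fun x hx => hx.2
  refine ⟨e, fun x => rfl, ⟨h0.mem_toOpenPartialHomeomorph_source hf' (by simp), hxS⟩,
    fun x hx => (hS x (hsrc x hx)).1, fun y hy => ?_⟩
  obtain ⟨hsm, g, hg⟩ := hS _ (hsrc _ (e.map_target hy))
  refine e.contDiffAt_symm (f₀' := g) hy ?_ hsm
  rw [hg]
  exact (hsm.differentiableAt (by simp)).hasFDerivAt

end InverseFunction

section Flow

variable {E : Type} [NormedAddCommGroup E] [NormedSpace ℝ E]

/-- The Volterra operator `u ↦ (s ↦ ∫₀ˢ u)` on continuous functions on the unit interval. -/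
noncomputable def volterra (E : Type) [NormedAddCommGroup E] [NormedSpace ℝ E] :
    C(Icc (0 : ℝ) 1, E) →L[ℝ] C(Icc (0 : ℝ) 1, E) :=
  LinearMap.mkContinuous
    { toFun := fun u => ⟨fun s => ∫ r in (0 : ℝ)..s, IccExtend zero_le_one u r,
        (intervalIntegral.continuous_primitive
          (fun a b => (u.continuous.Icc_extend' (h := zero_le_one)).intervalIntegrable a b)
          0).comp continuous_subtype_val⟩
      map_add' := fun u v => by
        ext s
        exact intervalIntegral.integral_add
          ((u.continuous.Icc_extend' (h := zero_le_one)).intervalIntegrable _ _)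
          ((v.continuous.Icc_extend' (h := zero_le_one)).intervalIntegrable _ _)
      map_smul' := fun c u => by
        ext s
        exact intervalIntegral.integral_smul c _ }
    1 (fun u => by
      rw [ContinuousMap.norm_le _ (by positivity)]
      intro s
      have h := intervalIntegral.norm_integral_le_of_norm_le_const (a := 0) (b := (s : ℝ))
        (f := IccExtend zero_le_one u) (C := ‖u‖) (fun r _ => u.norm_coe_le_norm _)
      refine h.trans ?_
      rw [sub_zero, abs_of_nonneg s.2.1, one_mul]
      exact mul_le_of_le_one_right (norm_nonneg _) s.2.2)

/-- Multiplication by `c ∈ [0, 1]` on the unit interval. -/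
def unitScale (c : Icc (0 : ℝ) 1) : C(Icc (0 : ℝ) 1, Icc (0 : ℝ) 1) :=
  ⟨fun s => c * s, by fun_prop⟩

lemma volterra_comp_unitScale (c : Icc (0 : ℝ) 1) (u : C(Icc (0 : ℝ) 1, E)) :
    (c : ℝ) • volterra E (u.comp (unitScale c)) = (volterra E u).comp (unitScale c) := by
  ext s
  have h : (c : ℝ) • ∫ r in (0 : ℝ)..s, IccExtend zero_le_one u (c * r)
      = ∫ r in (c : ℝ) * 0..c * s, IccExtend zero_le_one u r :=
    intervalIntegral.smul_integral_comp_mul_left _ _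
  rw [mul_zero] at h
  change (c : ℝ) • ∫ r in (0 : ℝ)..s, IccExtend zero_le_one (u.comp (unitScale c)) r =
    ∫ r in (0 : ℝ)..((c * s : Icc (0 : ℝ) 1) : ℝ), IccExtend zero_le_one u r
  rw [Icc.coe_mul, ← h]
  congr 1
  apply intervalIntegral.integral_congr
  intro r hr
  rw [uIcc_of_le s.2.1] at hr
  have hr' : r ∈ Icc (0 : ℝ) 1 := ⟨hr.1, hr.2.trans s.2.2⟩
  have hcr : (c : ℝ) * r ∈ Icc (0 : ℝ) 1 :=
    ⟨mul_nonneg c.2.1 hr'.1, mul_le_one₀ c.2.2 hr'.1 hr'.2⟩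
  simp only [IccExtend_of_mem _ _ hr', IccExtend_of_mem _ _ hcr]
  rfl

/-- The embedding of a normed space as the constant functions. -/
noncomputable def constCurve (E : Type) [NormedAddCommGroup E] [NormedSpace ℝ E] :
    E →L[ℝ] C(Icc (0 : ℝ) 1, E) :=
  LinearMap.mkContinuous
    { toFun := ContinuousMap.const _
      map_add' := fun _ _ => rfl
      map_smul' := fun _ _ => rfl }
    1 (fun x => by
      rw [ContinuousMap.norm_le _ (by positivity)]
      exact fun s => (one_mul ‖x‖).ge)

@[simp]
lemma constCurve_apply (x : E) (s : Icc (0 : ℝ) 1) : constCurve E x s = x := rfl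

/-- `picardOp X (x, u)` is the curve `s ↦ ∫₀ˢ X (x + u)`. -/
noncomputable def picardOp (X : C(E, E)) (w : E × C(Icc (0 : ℝ) 1, E)) :
    C(Icc (0 : ℝ) 1, E) :=
  volterra E (X.comp (constCurve E w.1 + w.2))

lemma contDiff_picardOp {X : C(E, E)} (hX : ContDiff ℝ ∞ X) : ContDiff ℝ ∞ (picardOp X) :=
  (volterra E).contDiff.comp ((contDiff_continuousMap_comp X hX).comp
    (((constCurve E).contDiff.comp contDiff_fst).add contDiff_snd))

lemma smul_picardOp_comp_unitScale (X : C(E, E)) (c : Icc (0 : ℝ) 1) (x : E)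
    (u : C(Icc (0 : ℝ) 1, E)) :
    (c : ℝ) • picardOp X (x, u.comp (unitScale c)) = (picardOp X (x, u)).comp (unitScale c) :=
  volterra_comp_unitScale c (X.comp (constCurve E x + u))

/-- The map whose local inverse solves the rescaled initial value problem `u' = ε X(x + u)`,
`u(0) = 0` on the unit interval. -/
noncomputable def shootingMap (X : C(E, E)) (z : ℝ × E × C(Icc (0 : ℝ) 1, E)) :
    ℝ × E × C(Icc (0 : ℝ) 1, E) :=
  (z.1, z.2.1, z.2.2 - z.1 • picardOp X z.2)

lemma contDiff_shootingMap {X : C(E, E)} (hX : ContDiff ℝ ∞ X) :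
    ContDiff ℝ ∞ (shootingMap X) :=
  contDiff_fst.prodMk ((contDiff_fst.comp contDiff_snd).prodMk
    ((contDiff_snd.comp contDiff_snd).sub
      (contDiff_fst.smul ((contDiff_picardOp hX).comp contDiff_snd))))

/-- The shear `(ε, x, u) ↦ (ε, x, u - ε • w)`. -/
noncomputable def shear {H : Type} [NormedAddCommGroup H] [NormedSpace ℝ H] (w : H) :
    (ℝ × E × H) ≃L[ℝ] (ℝ × E × H) :=
  ContinuousLinearEquiv.equivOfInverse
    ((ContinuousLinearMap.fst ℝ ℝ (E × H)).prod
      (((ContinuousLinearMap.fst ℝ E H).comp (ContinuousLinearMap.snd ℝ ℝ (E × H))).prod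
        ((ContinuousLinearMap.snd ℝ E H).comp (ContinuousLinearMap.snd ℝ ℝ (E × H))
          - (ContinuousLinearMap.fst ℝ ℝ (E × H)).smulRight w)))
    ((ContinuousLinearMap.fst ℝ ℝ (E × H)).prod
      (((ContinuousLinearMap.fst ℝ E H).comp (ContinuousLinearMap.snd ℝ ℝ (E × H))).prod
        ((ContinuousLinearMap.snd ℝ E H).comp (ContinuousLinearMap.snd ℝ ℝ (E × H))
          + (ContinuousLinearMap.fst ℝ ℝ (E × H)).smulRight w)))
    (fun z => by simp) (fun z => by simp)

lemma hasFDerivAt_shootingMap {X : C(E, E)} (hX : ContDiff ℝ ∞ X) (x₀ : E) :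
    HasFDerivAt (shootingMap X)
      (shear (E := E) (picardOp X (x₀, 0)) :
        (ℝ × E × C(Icc (0 : ℝ) 1, E)) →L[ℝ] (ℝ × E × C(Icc (0 : ℝ) 1, E)))
      (0, x₀, 0) := by
  have h1 : HasFDerivAt (fun z : ℝ × E × C(Icc (0 : ℝ) 1, E) => z.1)
    (ContinuousLinearMap.fst ℝ _ _) (0, x₀, 0) := hasFDerivAt_fst
  have h2 : HasFDerivAt (fun z : ℝ × E × C(Icc (0 : ℝ) 1, E) => z.2)
    (ContinuousLinearMap.snd ℝ _ _) (0, x₀, 0) := hasFDerivAt_snd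
  have h3 : HasFDerivAt (picardOp X) (fderiv ℝ (picardOp X) (x₀, 0)) (x₀, 0) :=
    ((contDiff_picardOp hX).differentiable (by simp) _).hasFDerivAt
  have h4 := h1.prodMk (h2.fst.prodMk (h2.snd.sub (h1.smul (h3.comp (0, x₀, 0) h2))))
  refine h4.congr_fderiv ?_
  ext <;> simp [shear]

/-- Local smooth flow of a smooth vector field on a Banach space. -/
theorem exists_smooth_flow [CompleteSpace E] {X : E → E} (hX : ContDiff ℝ ∞ X) (x₀ : E) :
    ∃ Φ : ℝ × E → E, (∀ᶠ z in 𝓝 (0, x₀), ContDiffAt ℝ ∞ Φ z) ∧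
      (∀ᶠ z in 𝓝 (0, x₀), fderiv ℝ Φ z (1, 0) = X (Φ z)) ∧
      ∀ᶠ x in 𝓝 x₀, Φ (0, x) = x := by
  let Xc : C(E, E) := ⟨X, hX.continuous⟩
  obtain ⟨e, he, hsrc, -, hsymm⟩ := exists_smooth_openPartialHomeomorph
    (Eventually.of_forall fun z => (contDiff_shootingMap (X := Xc) hX).contDiffAt)
    (hasFDerivAt_shootingMap (X := Xc) hX x₀)
  have he0 : e (0, x₀, 0) = (0, x₀, 0) := by rw [he]; simp [shootingMap]
  let ι : ℝ × E → ℝ × E × C(Icc (0 : ℝ) 1, E) := fun z => (z.1, z.2, 0)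
  have hι : ContDiff ℝ ∞ ι := contDiff_fst.prodMk (contDiff_snd.prodMk contDiff_const)
  let u : ℝ × E → C(Icc (0 : ℝ) 1, E) := fun z => (e.symm (ι z)).2.2
  let one : Icc (0 : ℝ) 1 := ⟨1, by simp⟩
  let Φ : ℝ × E → E := fun z => z.2 + u z one
  have htgt : ∀ᶠ z in 𝓝 ((0 : ℝ), x₀), ι z ∈ e.target := by
    apply hι.continuous.continuousAt.eventually_mem
    apply e.open_target.mem_nhds
    have := e.map_source hsrc
    rwa [he0] at this
  have husmooth : ∀ᶠ z in 𝓝 ((0 : ℝ), x₀), ContDiffAt ℝ ∞ u z := by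
    filter_upwards [htgt] with z hz
    exact contDiffAt_snd.comp _ (contDiffAt_snd.comp _ ((hsymm _ hz).comp z hι.contDiffAt))
  have hΦsmooth : ∀ᶠ z in 𝓝 ((0 : ℝ), x₀), ContDiffAt ℝ ∞ Φ z := by
    filter_upwards [husmooth] with z hz
    have h := (ContinuousMap.evalCLM ℝ one :
      C(Icc (0 : ℝ) 1, E) →L[ℝ] E).contDiff.contDiffAt.comp z hz
    exact contDiffAt_snd.add h
  have hu0 : u (0, x₀) = 0 := by
    change (e.symm (0, x₀, 0)).2.2 = 0
    rw [← he0, e.left_inv hsrc]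
  have hsol : ∀ᶠ z in 𝓝 ((0 : ℝ), x₀),
      e.symm (ι z) = (z.1, z.2, u z) ∧ u z = z.1 • picardOp Xc (z.2, u z) := by
    filter_upwards [htgt] with z hz
    have h := e.right_inv hz
    rw [he] at h
    have h1 : (e.symm (ι z)).1 = z.1 := congrArg Prod.fst h
    have h2 : (e.symm (ι z)).2.1 = z.2 := congrArg (fun t => t.2.1) h
    have h3 : (e.symm (ι z)).2.2 - (e.symm (ι z)).1 • picardOp Xc (e.symm (ι z)).2 = 0 :=
      congrArg (fun t => t.2.2) h
    have h4 : e.symm (ι z) = (z.1, z.2, u z) := Prod.ext h1 (Prod.ext h2 rfl)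
    refine ⟨h4, ?_⟩
    rw [h4] at h3
    exact sub_eq_zero.1 h3
  obtain ⟨δ, hδ, hball⟩ := Metric.isOpen_iff.1 e.open_source _ hsrc
  have hsmall : ∀ᶠ z in 𝓝 ((0 : ℝ), x₀),
      ‖z.1‖ < δ ∧ dist z.2 x₀ < δ ∧ ‖u z‖ < δ := by
    refine Eventually.and ?_ (Eventually.and ?_ ?_)
    · exact continuous_fst.norm.continuousAt.eventually_lt continuousAt_const (by simpa)
    · exact (continuous_snd.dist continuous_const).continuousAt.eventually_lt
        continuousAt_const (by simpa)
    · exact husmooth.self_of_nhds.continuousAt.norm.eventually_lt continuousAt_const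
        (by simpa [hu0])
  have hscale : ∀ᶠ z in 𝓝 ((0 : ℝ), x₀), ∀ c : Icc (0 : ℝ) 1,
      Φ ((c : ℝ) * z.1, z.2) = z.2 + u z c := by
    filter_upwards [hsol, hsmall] with z hz hzs c
    have hmem : ((c : ℝ) * z.1, z.2, (u z).comp (unitScale c)) ∈ e.source := by
      apply hball
      rw [Metric.mem_ball, Prod.dist_eq, Prod.dist_eq]
      refine max_lt ?_ (max_lt hzs.2.1 ?_)
      · rw [dist_zero_right, norm_mul, Real.norm_of_nonneg c.2.1]
        exact (mul_le_of_le_one_left (norm_nonneg _) c.2.2).trans_lt hzs.1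
      · rw [dist_zero_right]
        refine lt_of_le_of_lt ?_ hzs.2.2
        rw [ContinuousMap.norm_le _ (norm_nonneg _)]
        exact fun s => (u z).norm_coe_le_norm _
    have hval : e ((c : ℝ) * z.1, z.2, (u z).comp (unitScale c)) = ι ((c : ℝ) * z.1, z.2) := by
      rw [he]
      refine Prod.ext rfl (Prod.ext rfl ?_)
      change (u z).comp (unitScale c) -
        ((c : ℝ) * z.1) • picardOp Xc (z.2, (u z).comp (unitScale c)) = 0
      rw [mul_comm, mul_smul, smul_picardOp_comp_unitScale, sub_eq_zero]
      ext s
      exact congrArg (fun v : C(Icc (0 : ℝ) 1, E) => v (c * s)) hz.2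
    have h := e.left_inv hmem
    rw [hval] at h
    change z.2 + (e.symm (ι ((c : ℝ) * z.1, z.2))).2.2 one = _
    rw [h]
    change z.2 + u z (c * one) = _
    rw [show c * one = c from Subtype.ext (mul_one _)]
  have hne : ∀ᶠ z in 𝓝 ((0 : ℝ), x₀), z.1 ≠ 0 → fderiv ℝ Φ z (1, 0) = X (Φ z) := by
    have hdouble : Tendsto (fun z : ℝ × E => (2 * z.1, z.2)) (𝓝 (0, x₀)) (𝓝 (0, x₀)) := by
      have : ContinuousAt (fun z : ℝ × E => (2 * z.1, z.2)) (0, x₀) := by fun_prop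
      simpa [ContinuousAt] using this
    filter_upwards [hdouble.eventually hscale, hdouble.eventually hsol, hΦsmooth] with z hz hs hd h0
    let v := u (2 * z.1, z.2)
    let half : Icc (0 : ℝ) 1 := ⟨2⁻¹, by norm_num, by norm_num⟩
    have hw : Continuous (IccExtend zero_le_one (Xc.comp (constCurve E z.2 + v))) :=
      (Xc.comp (constCurve E z.2 + v)).continuous.Icc_extend'
    have hv : ∀ c : Icc (0 : ℝ) 1, z.2 + v c = z.2 + (2 * z.1) •
        ∫ r in (0 : ℝ)..c, IccExtend zero_le_one (Xc.comp (constCurve E z.2 + v)) r := fun c =>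
      congrArg (fun w : C(Icc (0 : ℝ) 1, E) => z.2 + w c) hs.2
    have hΦz : Φ z = z.2 + v half := by
      have := hz half
      rw [← this]
      congr 1
      refine Prod.ext ?_ rfl
      change z.1 = 2⁻¹ * (2 * z.1)
      ring
    have hder1 : HasDerivAt (fun c : ℝ => Φ (c * (2 * z.1), z.2))
        ((2 * z.1) • X (Φ z)) 2⁻¹ := by
      have h1 := ((intervalIntegral.integral_hasDerivAt_right (a := 0) (b := 2⁻¹)
        (hw.intervalIntegrable _ _) hw.stronglyMeasurable.stronglyMeasurableAtFilter
        hw.continuousAt).const_smul (2 * z.1)).const_add z.2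
      have h2 : IccExtend zero_le_one (Xc.comp (constCurve E z.2 + v)) 2⁻¹ = X (Φ z) := by
        rw [IccExtend_of_mem _ _ half.2, hΦz]
        rfl
      rw [h2] at h1
      refine h1.congr_of_eventuallyEq ?_
      filter_upwards [Icc_mem_nhds (show (0 : ℝ) < 2⁻¹ by norm_num)
        (show (2⁻¹ : ℝ) < 1 by norm_num)] with c hc
      exact (hz ⟨c, hc⟩).trans (hv ⟨c, hc⟩)
    have hder2 : HasDerivAt (fun c : ℝ => Φ (c * (2 * z.1), z.2))
        (fderiv ℝ Φ z (2 * z.1, 0)) 2⁻¹ := by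
      have h1 : HasDerivAt (fun c : ℝ => (c * (2 * z.1), z.2)) (2 * z.1, (0 : E)) 2⁻¹ :=
        (hasDerivAt_mul_const _).prodMk (hasDerivAt_const _ _)
      have h2 : ((2⁻¹ : ℝ) * (2 * z.1), z.2) = z := Prod.ext (by simp) rfl
      have h3 : HasFDerivAt Φ (fderiv ℝ Φ z) ((2⁻¹ : ℝ) * (2 * z.1), z.2) := by
        rw [h2]
        exact (hd.differentiableAt (by simp)).hasFDerivAt
      exact h3.comp_hasDerivAt _ h1
    have h := hder2.unique hder1
    rw [show ((2 * z.1, 0) : ℝ × E) = (2 * z.1) • (1, 0) by simp, map_smul] at h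
    exact smul_right_injective E (mul_ne_zero two_ne_zero h0) h
  refine ⟨Φ, hΦsmooth, ?_, ?_⟩
  · filter_upwards [hne.eventually_nhds, hΦsmooth] with z hz hd
    by_cases h0 : z.1 = 0
    · let γ : ℝ → ℝ × E := fun t => (t, z.2)
      have hγ0 : γ 0 = z := Prod.ext h0.symm rfl
      have hγ : Tendsto γ (𝓝[≠] 0) (𝓝 z) := by
        have : ContinuousAt γ 0 := by fun_prop
        rw [ContinuousAt, hγ0] at this
        exact this.mono_left nhdsWithin_le_nhds
      have hl : Tendsto (fun t => fderiv ℝ Φ (γ t) (1, 0)) (𝓝[≠] 0)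
          (𝓝 (fderiv ℝ Φ z (1, 0))) :=
        (((hd.fderiv_right (m := 0) (by simp)).continuousAt.clm_apply
          continuousAt_const).tendsto).comp hγ
      have hr : Tendsto (fun t => X (Φ (γ t))) (𝓝[≠] 0) (𝓝 (X (Φ z))) :=
        ((hX.continuous.continuousAt.comp hd.continuousAt).tendsto).comp hγ
      refine tendsto_nhds_unique (hl.congr' ?_) hr
      filter_upwards [hγ.eventually hz, self_mem_nhdsWithin] with t ht ht0
      exact ht ht0
    · exact hz.self_of_nhds h0
  · have : Tendsto (fun x : E => ((0 : ℝ), x)) (𝓝 x₀) (𝓝 (0, x₀)) :=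
      (Continuous.prodMk_right (0 : ℝ)).tendsto x₀
    filter_upwards [this.eventually hsol] with x hx
    change x + u (0, x) one = x
    rw [hx.2]
    simp

end Flow

section LocalStructure

variable {E F G A H : Type} [NormedAddCommGroup E] [NormedSpace ℝ E]
  [NormedAddCommGroup F] [NormedSpace ℝ F] [NormedAddCommGroup G] [NormedSpace ℝ G]
  [NormedAddCommGroup A] [NormedSpace ℝ A] [NormedAddCommGroup H] [NormedSpace ℝ H]

lemma fderiv_leftInverse_apply {f : E → F} {g : F → E} {x : E} (h : ∀ᶠ y in 𝓝 x, g (f y) = y)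
    (hf : DifferentiableAt ℝ f x) (hg : DifferentiableAt ℝ g (f x)) (v : E) :
    fderiv ℝ g (f x) (fderiv ℝ f x v) = v := by
  have h1 : HasFDerivAt (fun y => g (f y)) ((fderiv ℝ g (f x)).comp (fderiv ℝ f x)) x :=
    hg.hasFDerivAt.comp x hf.hasFDerivAt
  have h2 : HasFDerivAt (fun y => g (f y)) (ContinuousLinearMap.id ℝ E) x :=
    (hasFDerivAt_id x).congr_of_eventuallyEq h
  exact congrArg (fun L : E →L[ℝ] E => L v) (h1.unique h2)

lemma exists_continuousLinearEquiv_eq [FiniteDimensional ℝ E] [FiniteDimensional ℝ F]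
    (L : E →L[ℝ] F) (hL : ∀ v, L v = 0 → v = 0)
    (hdim : Module.finrank ℝ E = Module.finrank ℝ F) :
    ∃ e : E ≃L[ℝ] F, (e : E →L[ℝ] F) = L := by
  have hinj : Function.Injective (L : E →ₗ[ℝ] F) := (injective_iff_map_eq_zero _).2 hL
  refine ⟨(LinearEquiv.ofInjectiveOfFinrankEq (L : E →ₗ[ℝ] F) hinj
    hdim).toContinuousLinearEquiv, ?_⟩
  ext v
  rfl

/-- A function which is smooth near a point agrees near that point with a globally smooth one. -/
lemma exists_contDiff_eventuallyEq [FiniteDimensional ℝ E] {f : E → F} {x₀ : E}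
    (hf : ∀ᶠ x in 𝓝 x₀, ContDiffAt ℝ ∞ f x) :
    ∃ g : E → F, ContDiff ℝ ∞ g ∧ ∀ᶠ x in 𝓝 x₀, g x = f x := by
  obtain ⟨r, hr, hball⟩ := Metric.eventually_nhds_iff_ball.1 hf
  let χ : ContDiffBump x₀ := ⟨r / 4, r / 2, by positivity, by linarith⟩
  refine ⟨fun x => χ x • f x, contDiff_iff_contDiffAt.2 fun x => ?_, ?_⟩
  · by_cases hx : x ∈ Metric.closedBall x₀ (r / 2)
    · exact χ.contDiffAt.smul (hball x (Metric.closedBall_subset_ball (by linarith) hx))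
    · refine (contDiffAt_const (c := (0 : F))).congr_of_eventuallyEq ?_
      filter_upwards [Metric.isClosed_closedBall.isOpen_compl.mem_nhds hx] with y hy
      rw [χ.zero_of_le_dist (not_le.1 fun h => hy (Metric.mem_closedBall.2 h)).le, zero_smul]
  · filter_upwards [χ.eventuallyEq_one] with x hx
    simp [hx]

/-- Flow box: near a point where it does not vanish, a smooth vector field admits a function
with derivative one along it and a complete set of first integrals. -/
theorem exists_flowBox [FiniteDimensional ℝ E] {X : E → E} {x₀ : E}
    (hX : ∀ᶠ x in 𝓝 x₀, ContDiffAt ℝ ∞ X x) (h0 : X x₀ ≠ 0) :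
    ∃ (F : Type) (_ : NormedAddCommGroup F) (_ : NormedSpace ℝ F) (_ : FiniteDimensional ℝ F)
      (τ : E → ℝ) (ρ : E → F), Module.finrank ℝ F + 1 = Module.finrank ℝ E ∧
      (∀ᶠ x in 𝓝 x₀, ContDiffAt ℝ ∞ τ x) ∧ (∀ᶠ x in 𝓝 x₀, ContDiffAt ℝ ∞ ρ x) ∧
      (∀ᶠ x in 𝓝 x₀, fderiv ℝ τ x (X x) = 1) ∧ (∀ᶠ x in 𝓝 x₀, fderiv ℝ ρ x (X x) = 0) ∧
      ∀ v, fderiv ℝ τ x₀ v = 0 → fderiv ℝ ρ x₀ v = 0 → v = 0 := by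
  have : CompleteSpace E := FiniteDimensional.complete ℝ E
  obtain ⟨α, hα⟩ := SeparatingDual.exists_eq_one (R := ℝ) h0
  obtain ⟨Y, hY, hYX⟩ := exists_contDiff_eventuallyEq hX
  obtain ⟨Φ, hΦ, hΦd, hΦ0⟩ := exists_smooth_flow hY x₀
  let F : Submodule ℝ E := LinearMap.ker (α : E →ₗ[ℝ] ℝ)
  have hdim : Module.finrank ℝ F + 1 = Module.finrank ℝ E := by
    have hα0 : (α : E →ₗ[ℝ] ℝ) ≠ 0 := by
      intro h
      have := LinearMap.congr_fun h (X x₀)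
      simp [hα] at this
    exact Module.Dual.finrank_ker_add_one_of_ne_zero hα0
  let j : ℝ × F → ℝ × E := fun z => (z.1, x₀ + F.subtypeL z.2)
  have hj : ContDiff ℝ ∞ j :=
    contDiff_fst.prodMk (contDiff_const.add (F.subtypeL.contDiff.comp contDiff_snd))
  have hjd : ∀ z, HasFDerivAt j ((ContinuousLinearMap.fst ℝ ℝ F).prod
      (F.subtypeL.comp (ContinuousLinearMap.snd ℝ ℝ F))) z := fun z =>
    hasFDerivAt_fst.prodMk ((F.subtypeL.hasFDerivAt.comp z hasFDerivAt_snd).const_add x₀)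
  have hj0 : j 0 = (0, x₀) := by simp [j]
  have hjt : Tendsto j (𝓝 0) (𝓝 (0, x₀)) := by
    rw [← hj0]; exact hj.continuous.tendsto 0
  let Ψ : ℝ × F → E := fun z => Φ (j z)
  have hΨ0 : Ψ 0 = x₀ := by
    change Φ (j 0) = x₀
    rw [hj0, hΦ0.self_of_nhds]
  have hΨ : ∀ᶠ z in 𝓝 0, ContDiffAt ℝ ∞ Ψ z := by
    filter_upwards [hjt.eventually hΦ] with z hz
    exact hz.comp z hj.contDiffAt
  have hΨc : Tendsto Ψ (𝓝 0) (𝓝 x₀) := by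
    have := hΨ.self_of_nhds.continuousAt.tendsto
    rwa [hΨ0] at this
  have hchain : ∀ᶠ z in 𝓝 0, ∀ w, fderiv ℝ Ψ z w = fderiv ℝ Φ (j z) (w.1, (w.2 : E)) := by
    filter_upwards [hjt.eventually hΦ] with z hz w
    have h1 : HasFDerivAt Φ (fderiv ℝ Φ (j z)) (j z) :=
      (hz.differentiableAt (by simp)).hasFDerivAt
    have h2 : HasFDerivAt Ψ _ z := h1.comp z (hjd z)
    rw [h2.fderiv]
    rfl
  have hΨd : ∀ᶠ z in 𝓝 0, fderiv ℝ Ψ z (1, 0) = X (Ψ z) := by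
    filter_upwards [hchain, hjt.eventually hΦd, hΨc.eventually hYX] with z h1 h2 h3
    rw [h1, ← h3]
    exact h2
  have hslice : ∀ y : E, fderiv ℝ Φ (0, x₀) (0, y) = y := by
    intro y
    have h1 : HasFDerivAt Φ (fderiv ℝ Φ (0, x₀)) (0, x₀) :=
      (hΦ.self_of_nhds.differentiableAt (by simp)).hasFDerivAt
    have h2 : HasFDerivAt (fun x : E => ((0 : ℝ), x))
        ((0 : E →L[ℝ] ℝ).prod (ContinuousLinearMap.id ℝ E)) x₀ :=
      (hasFDerivAt_const _ _).prodMk (hasFDerivAt_id _)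
    have h3 := (h1.comp x₀ h2).unique ((hasFDerivAt_id x₀).congr_of_eventuallyEq hΦ0)
    exact congrArg (fun L : E →L[ℝ] E => L y) h3
  have hderiv : ∀ w : ℝ × F, fderiv ℝ Ψ 0 w = w.1 • X x₀ + w.2 := by
    intro w
    have hw : w = w.1 • ((1, 0) : ℝ × F) + (0, w.2) := by ext <;> simp
    conv_lhs => rw [hw, map_add, map_smul, hΨd.self_of_nhds, hchain.self_of_nhds, hΨ0, hj0,
      hslice]
  have hinj : ∀ w : ℝ × F, fderiv ℝ Ψ 0 w = 0 → w = 0 := by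
    intro w hw
    rw [hderiv] at hw
    have h1 := congrArg α hw
    have h2 : α (w.2 : E) = 0 := w.2.2
    simp only [map_add, map_smul, hα, h2, smul_eq_mul, mul_one, add_zero, map_zero] at h1
    rw [h1, zero_smul, zero_add] at hw
    exact Prod.ext h1 (Subtype.ext hw)
  obtain ⟨L, hL⟩ := exists_continuousLinearEquiv_eq (fderiv ℝ Ψ 0) hinj (by
    rw [Module.finrank_prod, Module.finrank_self, ← hdim, add_comm])
  have hΨL : HasFDerivAt Ψ (L : (ℝ × F) →L[ℝ] E) 0 := by
    rw [hL]
    exact (hΨ.self_of_nhds.differentiableAt (by simp)).hasFDerivAt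
  obtain ⟨e, he, hsrc, hes, hesymm⟩ := exists_smooth_openPartialHomeomorph hΨ hΨL
  have heΨ : (e : ℝ × F → E) = Ψ := funext he
  have hx₀ : x₀ ∈ e.target := by
    have := e.map_source hsrc
    rwa [he, hΨ0] at this
  have hsymm0 : e.symm x₀ = 0 := by
    have := e.left_inv hsrc
    rwa [he, hΨ0] at this
  have htgt : ∀ᶠ x in 𝓝 x₀, x ∈ e.target := e.open_target.mem_nhds hx₀
  have hfst : ∀ x ∈ e.target, ∀ v, fderiv ℝ (fun y => (e.symm y).1) x v =
      (fderiv ℝ e.symm x v).1 := fun x hx v => by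
    rw [(((hesymm x hx).differentiableAt (by simp)).hasFDerivAt.fst).fderiv]
    rfl
  have hsnd : ∀ x ∈ e.target, ∀ v, fderiv ℝ (fun y => (e.symm y).2) x v =
      (fderiv ℝ e.symm x v).2 := fun x hx v => by
    rw [(((hesymm x hx).differentiableAt (by simp)).hasFDerivAt.snd).fderiv]
    rfl
  have hdir : ∀ᶠ x in 𝓝 x₀, fderiv ℝ e.symm x (X x) = (1, 0) := by
    have ht : Tendsto e.symm (𝓝 x₀) (𝓝 0) := by
      rw [← hsymm0]
      exact e.continuousAt_symm hx₀
    filter_upwards [ht.eventually hΨd, htgt] with x hx hxt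
    have hex : Ψ (e.symm x) = x := by rw [← he, e.right_inv hxt]
    have hxs := e.map_target hxt
    have h := fderiv_leftInverse_apply (f := Ψ) (g := e.symm) (x := e.symm x)
      (by
        filter_upwards [e.open_source.mem_nhds hxs] with z hz
        rw [← he, e.left_inv hz])
      ((hes _ hxs).differentiableAt (by simp))
      (by rw [hex]; exact (hesymm x hxt).differentiableAt (by simp)) (1, 0)
    rwa [hx, hex] at h
  refine ⟨F, inferInstance, inferInstance, inferInstance, fun x => (e.symm x).1,
    fun x => (e.symm x).2, hdim, ?_, ?_, ?_, ?_, ?_⟩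
  · filter_upwards [htgt] with x hx
    exact contDiffAt_fst.comp x (hesymm x hx)
  · filter_upwards [htgt] with x hx
    exact contDiffAt_snd.comp x (hesymm x hx)
  · filter_upwards [htgt, hdir] with x hx hd
    rw [hfst x hx, hd]
  · filter_upwards [htgt, hdir] with x hx hd
    rw [hsnd x hx, hd]
  · intro v h1 h2
    rw [hfst x₀ hx₀] at h1
    rw [hsnd x₀ hx₀] at h2
    have hv : fderiv ℝ e.symm x₀ v = 0 := Prod.ext h1 h2
    have h := fderiv_leftInverse_apply (f := e.symm) (g := Ψ) (x := x₀)
      (by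
        filter_upwards [htgt] with z hz
        rw [← he, e.right_inv hz])
      ((hesymm x₀ hx₀).differentiableAt (by simp))
      (by rw [hsymm0]; exact hΨL.differentiableAt) v
    rw [← h, hv, map_zero]

/-- A function whose derivative vanishes along the first factor only depends on the second
factor. -/
lemma eventually_eq_of_fderiv_fst_eq_zero {k : A × G → H} {z₀ : A × G}
    (hk : ∀ᶠ z in 𝓝 z₀, DifferentiableAt ℝ k z)
    (hk0 : ∀ᶠ z in 𝓝 z₀, ∀ v, fderiv ℝ k z (v, 0) = 0) :
    ∀ᶠ z in 𝓝 z₀, k z = k (z₀.1, z.2) := by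
  obtain ⟨r, hr, hball⟩ := Metric.eventually_nhds_iff_ball.1 (hk.and hk0)
  filter_upwards [Metric.ball_mem_nhds z₀ hr] with z hz
  rw [← ball_prod_same, mem_prod] at hz
  have hmem : ∀ a ∈ Metric.ball z₀.1 r, (a, z.2) ∈ Metric.ball z₀ r := fun a ha => by
    rw [← ball_prod_same]
    exact ⟨ha, hz.2⟩
  have hd : ∀ a ∈ Metric.ball z₀.1 r, HasFDerivAt (fun a => k (a, z.2)) (0 : A →L[ℝ] H) a := by
    intro a ha
    obtain ⟨h1, h2⟩ := hball _ (hmem a ha)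
    have h3 : HasFDerivAt (fun a : A => (a, z.2))
        ((ContinuousLinearMap.id ℝ A).prod (0 : A →L[ℝ] G)) a :=
      (hasFDerivAt_id a).prodMk (hasFDerivAt_const _ _)
    refine (h1.hasFDerivAt.comp a h3).congr_fderiv ?_
    ext v
    exact h2 v
  exact Metric.isOpen_ball.is_const_of_fderiv_eq_zero (convex_ball z₀.1 r).isPreconnected
    (fun a ha => (hd a ha).differentiableAt.differentiableWithinAt)
    (fun a ha => (hd a ha).fderiv) hz.1 (Metric.mem_ball_self hr)

/-- If `(φ, π)` is a local coordinate system, then `π` has a smooth local section `σ`, and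
functions whose derivative vanishes on `ker dπ` factor through `π`. -/
theorem exists_section_of_submersion [FiniteDimensional ℝ E] [FiniteDimensional ℝ A]
    [FiniteDimensional ℝ G] {φ : E → A} {π : E → G} {x₀ : E}
    (hφ : ∀ᶠ x in 𝓝 x₀, ContDiffAt ℝ ∞ φ x) (hπ : ∀ᶠ x in 𝓝 x₀, ContDiffAt ℝ ∞ π x)
    (hinj : ∀ v, fderiv ℝ φ x₀ v = 0 → fderiv ℝ π x₀ v = 0 → v = 0)
    (hdim : Module.finrank ℝ A + Module.finrank ℝ G = Module.finrank ℝ E) :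
    ∃ σ : G → E, (∀ᶠ y in 𝓝 (π x₀), ContDiffAt ℝ ∞ σ y) ∧ σ (π x₀) = x₀ ∧
      (∀ᶠ y in 𝓝 (π x₀), π (σ y) = y) ∧
      ∀ (H : Type) [NormedAddCommGroup H] [NormedSpace ℝ H] (h : E → H),
        (∀ᶠ x in 𝓝 x₀, DifferentiableAt ℝ h x) →
        (∀ᶠ x in 𝓝 x₀, ∀ w, fderiv ℝ π x w = 0 → fderiv ℝ h x w = 0) →
        ∀ᶠ x in 𝓝 x₀, h x = h (σ (π x)) := by
  have : CompleteSpace E := FiniteDimensional.complete ℝ E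
  have hφπ : ∀ᶠ x in 𝓝 x₀, ContDiffAt ℝ ∞ (fun x => (φ x, π x)) x := by
    filter_upwards [hφ, hπ] with x h1 h2 using h1.prodMk h2
  have hd : HasFDerivAt (fun x => (φ x, π x)) ((fderiv ℝ φ x₀).prod (fderiv ℝ π x₀)) x₀ :=
    (hφ.self_of_nhds.differentiableAt (by simp)).hasFDerivAt.prodMk
      (hπ.self_of_nhds.differentiableAt (by simp)).hasFDerivAt
  obtain ⟨L, hL⟩ := exists_continuousLinearEquiv_eq
    ((fderiv ℝ φ x₀).prod (fderiv ℝ π x₀))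
    (fun v hv => hinj v (congrArg Prod.fst hv) (congrArg Prod.snd hv))
    (by rw [Module.finrank_prod, hdim])
  rw [← hL] at hd
  obtain ⟨e, he, hsrc, hes, hesymm⟩ := exists_smooth_openPartialHomeomorph hφπ hd
  have htgt : (φ x₀, π x₀) ∈ e.target := by
    have := e.map_source hsrc
    rwa [he] at this
  have hslice : Tendsto (fun y : G => (φ x₀, y)) (𝓝 (π x₀)) (𝓝 (φ x₀, π x₀)) :=
    (Continuous.prodMk_right (φ x₀)).tendsto _
  have hslice' := hslice.eventually (e.open_target.mem_nhds htgt)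
  have hsymm0 : e.symm (φ x₀, π x₀) = x₀ := by
    have := e.left_inv hsrc
    rwa [he] at this
  have het : Tendsto e.symm (𝓝 (φ x₀, π x₀)) (𝓝 x₀) := by
    have := (e.continuousAt_symm htgt).tendsto
    rwa [hsymm0] at this
  refine ⟨fun y => e.symm (φ x₀, y), ?_, hsymm0, ?_, ?_⟩
  · filter_upwards [hslice'] with y hy
    exact (hesymm _ hy).comp y (contDiffAt_const.prodMk contDiffAt_id)
  · filter_upwards [hslice'] with y hy
    have := e.right_inv hy
    rw [he] at this
    exact congrArg Prod.snd this
  · intro H _ _ h hh hh0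
    have hk : ∀ᶠ z in 𝓝 (φ x₀, π x₀), DifferentiableAt ℝ (fun z => h (e.symm z)) z := by
      filter_upwards [het.eventually hh, e.open_target.mem_nhds htgt] with z h1 h2
      exact h1.comp z ((hesymm z h2).differentiableAt (by simp))
    have hk0 : ∀ᶠ z in 𝓝 (φ x₀, π x₀), ∀ v,
        fderiv ℝ (fun z => h (e.symm z)) z (v, 0) = 0 := by
      filter_upwards [het.eventually hh, het.eventually hh0, het.eventually hφ,
        het.eventually hπ, e.open_target.mem_nhds htgt] with z h1 h2 h3 h4 hz v
      have hez := (hesymm z hz).differentiableAt (by simp)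
      have hcomp : HasFDerivAt (fun z => h (e.symm z)) _ z :=
        h1.hasFDerivAt.comp z hez.hasFDerivAt
      rw [hcomp.fderiv]
      apply h2
      have hd3 := (h3.differentiableAt (by simp)).hasFDerivAt.prodMk
        (h4.differentiableAt (by simp)).hasFDerivAt
      have hinv := fderiv_leftInverse_apply (f := e.symm) (g := fun x => (φ x, π x)) (x := z)
        (by
          filter_upwards [e.open_target.mem_nhds hz] with w hw
          rw [← he, e.right_inv hw])
        hez hd3.differentiableAt (v, 0)
      rw [hd3.fderiv] at hinv
      exact congrArg Prod.snd hinv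
    have hx : Tendsto (fun x => (φ x, π x)) (𝓝 x₀) (𝓝 (φ x₀, π x₀)) := hd.continuousAt
    filter_upwards [hx.eventually (eventually_eq_of_fderiv_fst_eq_zero hk hk0),
      e.open_source.mem_nhds hsrc] with x h1 h2
    have := e.left_inv h2
    rw [he] at this
    rwa [this] at h1

end LocalStructure

section Poisson

variable {E F G : Type} [NormedAddCommGroup E] [NormedSpace ℝ E]
  [NormedAddCommGroup F] [NormedSpace ℝ F] [NormedAddCommGroup G] [NormedSpace ℝ G]

/-- The bracket `{f, g} = dg (P df)` defined by a field of operators `P x : E* → E`. -/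
noncomputable def bracket (P : E → (E →L[ℝ] ℝ) →L[ℝ] E) (f g : E → ℝ) (x : E) : ℝ :=
  fderiv ℝ g x (P x (fderiv ℝ f x))

/-- `P` is a smooth Poisson structure near `x₀`. -/
structure IsPoissonAt (P : E → (E →L[ℝ] ℝ) →L[ℝ] E) (x₀ : E) : Prop where
  smooth : ∀ᶠ x in 𝓝 x₀, ContDiffAt ℝ ∞ P x
  skew : ∀ᶠ x in 𝓝 x₀, ∀ α β : E →L[ℝ] ℝ, β (P x α) = -α (P x β)
  jacobi : ∀ᶠ x in 𝓝 x₀, ∀ f g h : E → ℝ, (∀ᶠ y in 𝓝 x, ContDiffAt ℝ ∞ f y) →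
    (∀ᶠ y in 𝓝 x, ContDiffAt ℝ ∞ g y) → (∀ᶠ y in 𝓝 x, ContDiffAt ℝ ∞ h y) →
    bracket P f (bracket P g h) x + bracket P g (bracket P h f) x
      + bracket P h (bracket P f g) x = 0

variable {P : E → (E →L[ℝ] ℝ) →L[ℝ] E} {x₀ : E}

lemma ContDiffAt.fderiv_top {f : E → F} {x : E} (hf : ContDiffAt ℝ ∞ f x) :
    ContDiffAt ℝ ∞ (fderiv ℝ f) x := hf.fderiv_right (by simp)

/-- The vector field `x ↦ dρ (P df)` is smooth. -/
lemma ContDiffAt.fderiv_hamiltonian {ρ : E → F} {f : E → ℝ} {x : E} (hP : ContDiffAt ℝ ∞ P x)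
    (hρ : ContDiffAt ℝ ∞ ρ x) (hf : ContDiffAt ℝ ∞ f x) :
    ContDiffAt ℝ ∞ (fun y => fderiv ℝ ρ y (P y (fderiv ℝ f y))) x :=
  hρ.fderiv_top.clm_apply (hP.clm_apply hf.fderiv_top)

lemma bracket_congr_right {f g g' : E → ℝ} {x : E} (h : ∀ᶠ y in 𝓝 x, g y = g' y) :
    bracket P f g x = bracket P f g' x := by
  unfold bracket
  rw [Filter.EventuallyEq.fderiv_eq h]

lemma bracket_eq_zero_of_eventually_const {f g : E → ℝ} {x : E} {c : ℝ}
    (h : ∀ᶠ y in 𝓝 x, g y = c) : bracket P f g x = 0 := by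
  rw [bracket_congr_right h, bracket, fderiv_fun_const]
  rfl

lemma fderiv_clm_map_comp {ρ : E → F} {x : E} (ℓ : F →L[ℝ] G) (hρ : DifferentiableAt ℝ ρ x) :
    fderiv ℝ (fun y => ℓ (ρ y)) x = ℓ.comp (fderiv ℝ ρ x) :=
  (ℓ.hasFDerivAt.comp x hρ.hasFDerivAt).fderiv

/-- If `ρ` is invariant under the Hamiltonian flow of `r` and `{r, f}` is constant, then the
projection by `dρ` of the Hamiltonian field of `f` is invariant under the flow of `r`. -/
lemma IsPoissonAt.fderiv_projected_hamiltonian (hP : IsPoissonAt P x₀) {r f : E → ℝ} {ρ : E → F}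
    {c : ℝ} (hr : ∀ᶠ x in 𝓝 x₀, ContDiffAt ℝ ∞ r x) (hf : ∀ᶠ x in 𝓝 x₀, ContDiffAt ℝ ∞ f x)
    (hρ : ∀ᶠ x in 𝓝 x₀, ContDiffAt ℝ ∞ ρ x) (hrf : ∀ᶠ x in 𝓝 x₀, bracket P r f x = c)
    (hrρ : ∀ᶠ x in 𝓝 x₀, fderiv ℝ ρ x (P x (fderiv ℝ r x)) = 0) :
    ∀ᶠ x in 𝓝 x₀, fderiv ℝ (fun y => fderiv ℝ ρ y (P y (fderiv ℝ f y))) x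
      (P x (fderiv ℝ r x)) = 0 := by
  filter_upwards [hP.jacobi, hr.eventually_nhds, hf.eventually_nhds, hρ.eventually_nhds,
    hrf.eventually_nhds, hrρ.eventually_nhds, hP.smooth, hP.skew.eventually_nhds]
    with x hjac hr hf hρ hrf hrρ hsm hskew
  refine SeparatingDual.eq_zero_of_forall_dual_eq_zero (R := ℝ) fun ℓ => ?_
  have hℓ : ∀ᶠ y in 𝓝 x, ContDiffAt ℝ ∞ (fun z => ℓ (ρ z)) y := by
    filter_upwards [hρ] with y hy using ℓ.contDiff.contDiffAt.comp y hy
  have hj := hjac r f (fun z => ℓ (ρ z)) hr hf hℓ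
  rw [bracket_eq_zero_of_eventually_const hrf, add_zero] at hj
  have h0 : ∀ᶠ y in 𝓝 x, bracket P (fun z => ℓ (ρ z)) r y = 0 := by
    filter_upwards [hρ, hrρ, hskew] with y h1 h2 h3
    rw [bracket, h3, fderiv_clm_map_comp ℓ (h1.differentiableAt (by simp)),
      ContinuousLinearMap.comp_apply, h2, map_zero, neg_zero]
  rw [bracket_eq_zero_of_eventually_const h0, add_zero] at hj
  have hd : DifferentiableAt ℝ (fun y => fderiv ℝ ρ y (P y (fderiv ℝ f y))) x :=
    (hsm.fderiv_hamiltonian hρ.self_of_nhds hf.self_of_nhds).differentiableAt (by simp)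
  have hcongr : ∀ᶠ y in 𝓝 x, bracket P f (fun z => ℓ (ρ z)) y =
      ℓ (fderiv ℝ ρ y (P y (fderiv ℝ f y))) := by
    filter_upwards [hρ] with y h1
    rw [bracket, fderiv_clm_map_comp ℓ (h1.differentiableAt (by simp))]
    rfl
  rw [bracket_congr_right hcongr, bracket, fderiv_clm_map_comp ℓ hd] at hj
  exact hj

/-- Brackets of pulled back functions when `P'` is the push-forward of `P`. -/
lemma bracket_pullback {π : E → G} {P' : G → (G →L[ℝ] ℝ) →L[ℝ] G} {x : E} {f g : G → ℝ}
    (hPP' : ∀ α : G →L[ℝ] ℝ, fderiv ℝ π x (P x (α.comp (fderiv ℝ π x))) = P' (π x) α)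
    (hπ : DifferentiableAt ℝ π x) (hf : DifferentiableAt ℝ f (π x))
    (hg : DifferentiableAt ℝ g (π x)) :
    bracket P (fun z => f (π z)) (fun z => g (π z)) x = bracket P' f g (π x) := by
  have h1 : fderiv ℝ (fun z => f (π z)) x = (fderiv ℝ f (π x)).comp (fderiv ℝ π x) :=
    (hf.hasFDerivAt.comp x hπ.hasFDerivAt).fderiv
  have h2 : fderiv ℝ (fun z => g (π z)) x = (fderiv ℝ g (π x)).comp (fderiv ℝ π x) :=
    (hg.hasFDerivAt.comp x hπ.hasFDerivAt).fderiv
  rw [bracket, bracket, h1, h2, ContinuousLinearMap.comp_apply, hPP']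

/-- The push-forward of a Poisson structure along a locally open map is Poisson. -/
lemma IsPoissonAt.pushforward (hP : IsPoissonAt P x₀) {π : E → G}
    {P' : G → (G →L[ℝ] ℝ) →L[ℝ] G} (hπ : ∀ᶠ x in 𝓝 x₀, ContDiffAt ℝ ∞ π x)
    (hopen : 𝓝 (π x₀) ≤ map π (𝓝 x₀)) (hP' : ∀ᶠ y in 𝓝 (π x₀), ContDiffAt ℝ ∞ P' y)
    (hPP' : ∀ᶠ x in 𝓝 x₀, ∀ α : G →L[ℝ] ℝ,
      fderiv ℝ π x (P x (α.comp (fderiv ℝ π x))) = P' (π x) α) :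
    IsPoissonAt P' (π x₀) where
  smooth := hP'
  skew := Eventually.filter_mono hopen <| eventually_map.2 <| by
    filter_upwards [hPP', hP.skew] with x h1 h2 α β
    rw [← h1, ← h1]
    exact h2 (α.comp (fderiv ℝ π x)) (β.comp (fderiv ℝ π x))
  jacobi := Eventually.filter_mono hopen <| eventually_map.2 <| by
    have hπc : Tendsto π (𝓝 x₀) (𝓝 (π x₀)) := hπ.self_of_nhds.continuousAt
    filter_upwards [hPP'.eventually_nhds, hP.jacobi, hπ.eventually_nhds,
      (hπc.eventually hP').eventually_nhds] with x h1 hjac hπx hP'x f g h hf hg hh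
    have hπcx : Tendsto π (𝓝 x) (𝓝 (π x)) := hπx.self_of_nhds.continuousAt
    have hpull : ∀ f : G → ℝ, (∀ᶠ y in 𝓝 (π x), ContDiffAt ℝ ∞ f y) →
        ∀ᶠ z in 𝓝 x, ContDiffAt ℝ ∞ (fun z => f (π z)) z := by
      intro f hf
      filter_upwards [hπcx.eventually hf, hπx] with z hz hz' using hz.comp z hz'
    have key : ∀ f g h : G → ℝ, (∀ᶠ y in 𝓝 (π x), ContDiffAt ℝ ∞ f y) →
        (∀ᶠ y in 𝓝 (π x), ContDiffAt ℝ ∞ g y) → (∀ᶠ y in 𝓝 (π x), ContDiffAt ℝ ∞ h y) →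
        bracket P (fun z => f (π z)) (bracket P (fun z => g (π z)) (fun z => h (π z))) x =
          bracket P' f (bracket P' g h) (π x) := by
      intro f g h hf hg hh
      have hgh : DifferentiableAt ℝ (bracket P' g h) (π x) :=
        (hP'x.self_of_nhds.fderiv_hamiltonian hh.self_of_nhds
          hg.self_of_nhds).differentiableAt (by simp)
      rw [← bracket_pullback h1.self_of_nhds (hπx.self_of_nhds.differentiableAt (by simp))
        (hf.self_of_nhds.differentiableAt (by simp)) hgh]
      apply bracket_congr_right
      filter_upwards [h1, hπx, hπcx.eventually hg, hπcx.eventually hh] with z h1 h2 h3 h4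
      exact bracket_pullback h1 (h2.differentiableAt (by simp)) (h3.differentiableAt (by simp))
        (h4.differentiableAt (by simp))
    rw [← key f g h hf hg hh, ← key g h f hg hh hf, ← key h f g hh hf hg]
    exact hjac _ _ _ (hpull f hf) (hpull g hg) (hpull h hh)

/-- Joint injectivity of the differentials of two maps is an open condition. -/
lemma eventually_fderiv_injective [FiniteDimensional ℝ E] {φ : E → F} {π : E → G}
    (hφ : ∀ᶠ x in 𝓝 x₀, ContDiffAt ℝ ∞ φ x) (hπ : ∀ᶠ x in 𝓝 x₀, ContDiffAt ℝ ∞ π x)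
    (hinj : ∀ v, fderiv ℝ φ x₀ v = 0 → fderiv ℝ π x₀ v = 0 → v = 0) :
    ∀ᶠ x in 𝓝 x₀, ∀ v, fderiv ℝ φ x v = 0 → fderiv ℝ π x v = 0 → v = 0 := by
  have hc : ContinuousAt (fderiv ℝ fun x => (φ x, π x)) x₀ :=
    (hφ.self_of_nhds.prodMk hπ.self_of_nhds).fderiv_top.continuousAt
  have hfd : ∀ x, ContDiffAt ℝ ∞ φ x → ContDiffAt ℝ ∞ π x → ∀ v,
      fderiv ℝ (fun x => (φ x, π x)) x v = (fderiv ℝ φ x v, fderiv ℝ π x v) := by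
    intro x h1 h2 v
    rw [((h1.differentiableAt (by simp)).hasFDerivAt.prodMk
      (h2.differentiableAt (by simp)).hasFDerivAt).fderiv]
    rfl
  have hop := ContinuousLinearMap.isOpen_injective (𝕜 := ℝ) (E := E) (F := F × G)
  filter_upwards [hφ, hπ, hc.eventually_mem (hop.mem_nhds ((injective_iff_map_eq_zero _).2
    fun v hv => by
      rw [hfd x₀ hφ.self_of_nhds hπ.self_of_nhds] at hv
      exact hinj v (congrArg Prod.fst hv) (congrArg Prod.snd hv)))] with x h1 h2 hx v h3 h4
  refine (injective_iff_map_eq_zero _).1 hx v ?_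
  rw [hfd x h1 h2, h3, h4]
  rfl

end Poisson

section Splitting

variable {E : Type} [NormedAddCommGroup E] [NormedSpace ℝ E]
  {P : E → (E →L[ℝ] ℝ) →L[ℝ] E} {x₀ : E}

lemma IsPoissonAt.bracket_skew (hP : IsPoissonAt P x₀) :
    ∀ᶠ x in 𝓝 x₀, ∀ f g : E → ℝ, bracket P f g x = -bracket P g f x := by
  filter_upwards [hP.skew] with x hx f g using hx _ _

lemma IsPoissonAt.bracket_self (hP : IsPoissonAt P x₀) :
    ∀ᶠ x in 𝓝 x₀, ∀ f : E → ℝ, bracket P f f x = 0 := by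
  filter_upwards [hP.bracket_skew] with x hx f
  linarith [hx f f]

/-- A non-vanishing Poisson structure admits a canonical pair `q, p`, together with a submersion
whose fibres are tangent to both Hamiltonian fields. -/
theorem IsPoissonAt.exists_canonical_pair [FiniteDimensional ℝ E] (hP : IsPoissonAt P x₀)
    (h0 : P x₀ ≠ 0) :
    ∃ (G : Type) (_ : NormedAddCommGroup G) (_ : NormedSpace ℝ G) (_ : FiniteDimensional ℝ G)
      (p q : E → ℝ) (π : E → G), Module.finrank ℝ G + 2 = Module.finrank ℝ E ∧
      (∀ᶠ x in 𝓝 x₀, ContDiffAt ℝ ∞ p x) ∧ (∀ᶠ x in 𝓝 x₀, ContDiffAt ℝ ∞ q x) ∧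
      (∀ᶠ x in 𝓝 x₀, ContDiffAt ℝ ∞ π x) ∧ (∀ᶠ x in 𝓝 x₀, bracket P q p x = 1) ∧
      (∀ᶠ x in 𝓝 x₀, fderiv ℝ π x (P x (fderiv ℝ p x)) = 0) ∧
      (∀ᶠ x in 𝓝 x₀, fderiv ℝ π x (P x (fderiv ℝ q x)) = 0) ∧
      ∀ v, fderiv ℝ p x₀ v = 0 → fderiv ℝ q x₀ v = 0 → fderiv ℝ π x₀ v = 0 → v = 0 := by
  obtain ⟨α, hα⟩ : ∃ α, P x₀ α ≠ 0 := by
    by_contra! h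
    exact h0 (ContinuousLinearMap.ext h)
  have hdα : ∀ x, fderiv ℝ (fun y => α y) x = α := fun x => α.fderiv
  have hq : ∀ᶠ x in 𝓝 x₀, ContDiffAt ℝ ∞ (fun y => α y) x :=
    .of_forall fun x => α.contDiff.contDiffAt
  obtain ⟨F, _, _, _, p, ρ, hdimF, hp, hρ, hqp, hqρ, hinj⟩ :=
    exists_flowBox (X := fun x => P x α) (x₀ := x₀)
      (by filter_upwards [hP.smooth] with x hx using hx.clm_apply contDiffAt_const) hα
  have hbr : ∀ᶠ x in 𝓝 x₀, bracket P (fun y => α y) p x = 1 := by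
    filter_upwards [hqp] with x hx
    rw [bracket, hdα, hx]
  have hpq : ∀ᶠ x in 𝓝 x₀, α (P x (fderiv ℝ p x)) = -1 := by
    filter_upwards [hqp, hP.skew] with x h1 h2
    rw [h2, h1]
  set Z' : E → F := fun x => fderiv ℝ ρ x (P x (fderiv ℝ p x)) with hZ'
  have hZ's : ∀ᶠ x in 𝓝 x₀, ContDiffAt ℝ ∞ Z' x := by
    filter_upwards [hP.smooth, hρ, hp] with x h1 h2 h3 using h1.fderiv_hamiltonian h2 h3
  have hZ'q := hP.fderiv_projected_hamiltonian hq hp hρ hbr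
    (by filter_upwards [hqρ] with x hx; rw [hdα, hx])
  obtain ⟨σ, hσ, hσ0, -, hσf⟩ := exists_section_of_submersion hp hρ hinj
    (by rw [Module.finrank_self, add_comm, hdimF])
  have hZ := hσf F Z' (hZ's.mono fun x hx => hx.differentiableAt (by simp)) (by
    filter_upwards [hZ'q, hqp, hqρ, eventually_fderiv_injective hp hρ hinj] with x h1 h2 h3 h4 w hw
    have : w - fderiv ℝ p x w • P x α = 0 := h4 _ (by simp [h2]) (by simp [h3, hw])
    rw [sub_eq_zero.1 this, map_smul]
    rw [hdα] at h1
    rw [h1, smul_zero])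
  have hZs : ∀ᶠ y in 𝓝 (ρ x₀), ContDiffAt ℝ ∞ (fun y => Z' (σ y)) y := by
    have : Tendsto σ (𝓝 (ρ x₀)) (𝓝 x₀) := by
      simpa only [hσ0] using hσ.self_of_nhds.continuousAt.tendsto
    filter_upwards [hσ, this.eventually hZ's] with y h1 h2 using h2.comp y h1
  have hZ0 : Z' (σ (ρ x₀)) ≠ 0 := by
    rw [hσ0]
    intro h
    have h1 : P x₀ (fderiv ℝ p x₀) = 0 := hinj _ (hP.bracket_self.self_of_nhds p) h
    have h2 := hpq.self_of_nhds
    rw [h1, map_zero] at h2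
    norm_num at h2
  obtain ⟨G, _, _, _, τ, κ, hdimG, hτ, hκ, hZτ, hZκ, hinj'⟩ := exists_flowBox hZs hZ0
  have hρc : Tendsto ρ (𝓝 x₀) (𝓝 (ρ x₀)) := hρ.self_of_nhds.continuousAt
  have hd : ∀ᶠ x in 𝓝 x₀, ∀ v, fderiv ℝ (fun y => κ (ρ y)) x v =
      fderiv ℝ κ (ρ x) (fderiv ℝ ρ x v) := by
    filter_upwards [hρ, hρc.eventually hκ] with x h1 h2 v
    have h : HasFDerivAt (fun y => κ (ρ y)) ((fderiv ℝ κ (ρ x)).comp (fderiv ℝ ρ x)) x :=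
      (h2.differentiableAt (by simp)).hasFDerivAt.comp x
        (h1.differentiableAt (by simp)).hasFDerivAt
    rw [h.fderiv]
    rfl
  refine ⟨G, _, _, inferInstance, p, fun y => α y, fun x => κ (ρ x), by omega, hp, hq, ?_, hbr,
    ?_, ?_, ?_⟩
  · filter_upwards [hρ, hρc.eventually hκ] with x h1 h2 using h2.comp x h1
  · filter_upwards [hd, hZ, hρc.eventually hZκ] with x h1 h2 h3
    rw [h1]
    change fderiv ℝ κ (ρ x) (Z' x) = 0
    rw [h2, h3]
  · filter_upwards [hd, hqρ] with x h1 h2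
    rw [h1, hdα, h2, map_zero]
  · intro v h1 h2 h3
    rw [hdα] at h2
    rw [hd.self_of_nhds] at h3
    have e1 : fderiv ℝ ρ x₀ v - fderiv ℝ τ (ρ x₀) (fderiv ℝ ρ x₀ v) • Z' (σ (ρ x₀)) = 0 :=
      hinj' _ (by simp [hZτ.self_of_nhds]) (by simp [hZκ.self_of_nhds, h3])
    rw [hσ0] at e1
    have e2 : v - fderiv ℝ τ (ρ x₀) (fderiv ℝ ρ x₀ v) • P x₀ (fderiv ℝ p x₀) = 0 := by
      refine hinj _ ?_ ?_
      · have := hP.bracket_self.self_of_nhds p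
        rw [bracket] at this
        simp [h1, this]
      · rw [map_sub, map_smul]
        exact e1
    have e3 := congrArg α e2
    rw [map_sub, map_smul, h2, hpq.self_of_nhds, map_zero] at e3
    have e4 : fderiv ℝ τ (ρ x₀) (fderiv ℝ ρ x₀ v) = 0 := by simpa using e3
    rw [e4, zero_smul, sub_zero] at e2
    exact e2

/-- A non-vanishing Poisson structure splits off a canonical pair. -/
theorem IsPoissonAt.exists_splitting [FiniteDimensional ℝ E] (hP : IsPoissonAt P x₀)
    (h0 : P x₀ ≠ 0) :
    ∃ (G : Type) (_ : NormedAddCommGroup G) (_ : NormedSpace ℝ G) (_ : FiniteDimensional ℝ G)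
      (p q : E → ℝ) (π : E → G) (P' : G → (G →L[ℝ] ℝ) →L[ℝ] G),
      Module.finrank ℝ G + 2 = Module.finrank ℝ E ∧
      (∀ᶠ x in 𝓝 x₀, ContDiffAt ℝ ∞ p x) ∧ (∀ᶠ x in 𝓝 x₀, ContDiffAt ℝ ∞ q x) ∧
      (∀ᶠ x in 𝓝 x₀, ContDiffAt ℝ ∞ π x) ∧ (∀ᶠ x in 𝓝 x₀, bracket P q p x = 1) ∧
      (∀ᶠ x in 𝓝 x₀, fderiv ℝ π x (P x (fderiv ℝ p x)) = 0) ∧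
      (∀ᶠ x in 𝓝 x₀, fderiv ℝ π x (P x (fderiv ℝ q x)) = 0) ∧
      (∀ v, fderiv ℝ p x₀ v = 0 → fderiv ℝ q x₀ v = 0 → fderiv ℝ π x₀ v = 0 → v = 0) ∧
      IsPoissonAt P' (π x₀) ∧ 𝓝 (π x₀) ≤ map π (𝓝 x₀) ∧
      ∀ᶠ x in 𝓝 x₀, ∀ α : G →L[ℝ] ℝ,
        fderiv ℝ π x (P x (α.comp (fderiv ℝ π x))) = P' (π x) α := by
  obtain ⟨G, _, _, _, p, q, π, hdim, hp, hq, hπ, hqp, hpπ, hqπ, hinj⟩ :=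
    hP.exists_canonical_pair h0
  have hpairs : ∀ᶠ x in 𝓝 x₀, ContDiffAt ℝ ∞ (fun y => (p y, q y)) x := by
    filter_upwards [hp, hq] with x h1 h2 using h1.prodMk h2
  have hpaird : ∀ᶠ x in 𝓝 x₀, ∀ v, fderiv ℝ (fun y => (p y, q y)) x v =
      (fderiv ℝ p x v, fderiv ℝ q x v) := by
    filter_upwards [hp, hq] with x h1 h2 v
    rw [((h1.differentiableAt (by simp)).hasFDerivAt.prodMk
      (h2.differentiableAt (by simp)).hasFDerivAt).fderiv]
    rfl
  have hinj' : ∀ v, fderiv ℝ (fun y => (p y, q y)) x₀ v = 0 → fderiv ℝ π x₀ v = 0 → v = 0 := by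
    intro v h1 h2
    rw [hpaird.self_of_nhds] at h1
    exact hinj v (congrArg Prod.fst h1) (congrArg Prod.snd h1) h2
  obtain ⟨σ, hσ, hσ0, hπσ, hσf⟩ := exists_section_of_submersion hpairs hπ hinj'
    (by rw [Module.finrank_prod, Module.finrank_self]; omega)
  have hσt : Tendsto σ (𝓝 (π x₀)) (𝓝 x₀) := by
    simpa only [hσ0] using hσ.self_of_nhds.continuousAt.tendsto
  let D : E → (G →L[ℝ] ℝ) →L[ℝ] (E →L[ℝ] ℝ) := fun x =>
    (ContinuousLinearMap.compL ℝ E G ℝ).flip (fderiv ℝ π x)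
  let Q : E → (G →L[ℝ] ℝ) →L[ℝ] G := fun x => (fderiv ℝ π x).comp ((P x).comp (D x))
  have hQ : ∀ᶠ x in 𝓝 x₀, ContDiffAt ℝ ∞ Q x := by
    filter_upwards [hπ, hP.smooth] with x h1 h2
    exact h1.fderiv_top.clm_comp (h2.clm_comp (contDiffAt_const.clm_apply h1.fderiv_top))
  have hQd : ∀ r : E → ℝ, (∀ᶠ x in 𝓝 x₀, ContDiffAt ℝ ∞ r x) →
      (∀ᶠ x in 𝓝 x₀, fderiv ℝ π x (P x (fderiv ℝ r x)) = 0) →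
      ∀ᶠ x in 𝓝 x₀, fderiv ℝ Q x (P x (fderiv ℝ r x)) = 0 := by
    intro r hr hrπ
    have key : ∀ α : G →L[ℝ] ℝ, ∀ᶠ x in 𝓝 x₀,
        fderiv ℝ Q x (P x (fderiv ℝ r x)) α = 0 := by
      intro α
      have hα : ∀ᶠ x in 𝓝 x₀, fderiv ℝ (fun y => α (π y)) x = α.comp (fderiv ℝ π x) :=
        hπ.mono fun x hx => fderiv_clm_map_comp α (hx.differentiableAt (by simp))
      have hrα : ∀ᶠ x in 𝓝 x₀, bracket P r (fun y => α (π y)) x = 0 := by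
        filter_upwards [hα, hrπ] with x h1 h2
        rw [bracket, h1, ContinuousLinearMap.comp_apply, h2, map_zero]
      filter_upwards [hP.fderiv_projected_hamiltonian (f := fun y => α (π y)) hr
        (hπ.mono fun x hx => α.contDiff.contDiffAt.comp x hx) hπ hrα hrπ, hα.eventually_nhds, hQ]
        with x h1 h2 h3
      have h4 : ∀ᶠ y in 𝓝 x, fderiv ℝ π y (P y (fderiv ℝ (fun z => α (π z)) y)) = Q y α := by
        filter_upwards [h2] with y hy
        rw [hy]
        rfl
      rw [Filter.EventuallyEq.fderiv_eq h4] at h1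
      rw [fderiv_clm_apply (h3.differentiableAt (by simp)) (differentiableAt_const α)] at h1
      simpa using h1
    let b := Module.finBasis ℝ (G →L[ℝ] ℝ)
    filter_upwards [eventually_all.2 fun i => key (b i)] with x hx
    exact ContinuousLinearMap.coe_injective (b.ext fun i => by simpa using hx i)
  have hQker := hσf _ Q (hQ.mono fun x hx => hx.differentiableAt (by simp)) (by
    filter_upwards [hQd p hp hpπ, hQd q hq hqπ, hqp, hpπ, hqπ, hpaird, hP.bracket_self,
      hP.bracket_skew, eventually_fderiv_injective hpairs hπ hinj']
      with x h1 h2 h3 h4 h5 h6 h7 h8 h9 w hw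
    have hpq := h8 p q
    have hpp := h7 p
    have hqq := h7 q
    rw [h3] at hpq
    rw [bracket] at h3 hpp hqq hpq
    have : w - (fderiv ℝ p x w • P x (fderiv ℝ q x) - fderiv ℝ q x w • P x (fderiv ℝ p x)) = 0 := by
      refine h9 _ ?_ ?_
      · rw [h6]
        simp [h3, hpp, hqq, hpq]
      · simp [hw, h4, h5]
    rw [sub_eq_zero.1 this, map_sub, map_smul, map_smul, h1, h2]
    simp)
  have hopen : 𝓝 (π x₀) ≤ map π (𝓝 x₀) := by
    have h1 : map (fun y => π (σ y)) (𝓝 (π x₀)) = 𝓝 (π x₀) := by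
      rw [Filter.map_congr hπσ]
      exact Filter.map_id
    calc 𝓝 (π x₀) = map π (map σ (𝓝 (π x₀))) := by rw [Filter.map_map]; exact h1.symm
      _ ≤ map π (𝓝 x₀) := map_mono hσt
  have hPP' : ∀ᶠ x in 𝓝 x₀, ∀ α : G →L[ℝ] ℝ,
      fderiv ℝ π x (P x (α.comp (fderiv ℝ π x))) = Q (σ (π x)) α := by
    filter_upwards [hQker] with x hx α
    rw [← hx]
    rfl
  refine ⟨G, _, _, inferInstance, p, q, π, fun y => Q (σ y), hdim, hp, hq, hπ, hqp, hpπ, hqπ,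
    hinj, hP.pushforward hπ hopen ?_ hPP', hopen, hPP'⟩
  filter_upwards [hσ, hσt.eventually hQ] with y h1 h2 using h2.comp y h1

end Splitting

section CanonicalCoordinates

lemma finrank_strongDual (E : Type) [NormedAddCommGroup E] [NormedSpace ℝ E]
    [FiniteDimensional ℝ E] : Module.finrank ℝ (E →L[ℝ] ℝ) = Module.finrank ℝ E :=
  (LinearMap.toContinuousLinearMap (𝕜 := ℝ) (E := E) (F' := ℝ)).finrank_eq.symm.trans
    Subspace.dual_finrank_eq

/-- Splitting off a canonical pair does not change the corank. -/
lemma finrank_ker_of_splitting {E G : Type} [NormedAddCommGroup E] [NormedSpace ℝ E]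
    [FiniteDimensional ℝ E] [NormedAddCommGroup G] [NormedSpace ℝ G] [FiniteDimensional ℝ G]
    {A : (E →L[ℝ] ℝ) →L[ℝ] E} {B : (G →L[ℝ] ℝ) →L[ℝ] G} {a b : E →L[ℝ] ℝ} {T : E →L[ℝ] G}
    (hdim : Module.finrank ℝ G + 2 = Module.finrank ℝ E)
    (hskew : ∀ α β : E →L[ℝ] ℝ, β (A α) = -α (A β)) (hab : a (A b) = 1)
    (ha : T (A a) = 0) (hb : T (A b) = 0)
    (hinj : ∀ v, a v = 0 → b v = 0 → T v = 0 → v = 0)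
    (hB : ∀ α : G →L[ℝ] ℝ, T (A (α.comp T)) = B α) :
    Module.finrank ℝ (LinearMap.ker (A : (E →L[ℝ] ℝ) →ₗ[ℝ] E)) =
      Module.finrank ℝ (LinearMap.ker (B : (G →L[ℝ] ℝ) →ₗ[ℝ] G)) := by
  have hself : ∀ α : E →L[ℝ] ℝ, α (A α) = 0 := fun α => by linarith [hskew α α]
  have hba : b (A a) = -1 := by rw [hskew, hab]
  have hker : ∀ w, T w = 0 → w = a w • A b - b w • A a := by
    intro w hw
    rw [← sub_eq_zero]
    apply hinj
    · simp [hab, hself]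
    · simp [hba, hself]
    · simp [hw, ha, hb]
  have hsurj : Function.Surjective T := by
    let L : E →ₗ[ℝ] (ℝ × ℝ) × G := ((a.prod b).prod T : E →L[ℝ] (ℝ × ℝ) × G)
    have hL : Function.Injective L := (injective_iff_map_eq_zero _).2 fun v hv =>
      hinj v (congrArg (fun z => z.1.1) hv) (congrArg (fun z => z.1.2) hv)
        (congrArg (fun z => z.2) hv)
    have hdim' : Module.finrank ℝ E = Module.finrank ℝ ((ℝ × ℝ) × G) := by
      rw [Module.finrank_prod, Module.finrank_prod, Module.finrank_self]
      omega
    intro y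
    obtain ⟨x, hx⟩ := (LinearMap.injective_iff_surjective_of_finrank_eq_finrank hdim').1 hL (0, y)
    exact ⟨x, congrArg Prod.snd hx⟩
  let C : (G →L[ℝ] ℝ) →ₗ[ℝ] (E →L[ℝ] ℝ) :=
    { toFun := fun α => α.comp T
      map_add' := fun _ _ => rfl
      map_smul' := fun _ _ => rfl }
  have hC : Function.Injective C := by
    intro α β h
    ext y
    obtain ⟨x, rfl⟩ := hsurj y
    exact congrArg (fun L : E →L[ℝ] ℝ => L x) h
  have hmap : LinearMap.ker (A : (E →L[ℝ] ℝ) →ₗ[ℝ] E) =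
      (LinearMap.ker (B : (G →L[ℝ] ℝ) →ₗ[ℝ] G)).map C := by
    ext β
    simp only [LinearMap.mem_ker, Submodule.mem_map, ContinuousLinearMap.coe_coe]
    constructor
    · intro hβ
      obtain ⟨S, hS⟩ := LinearMap.exists_rightInverse_of_surjective (T : E →ₗ[ℝ] G)
        (LinearMap.range_eq_top.2 hsurj)
      have hS' : ∀ y, T (S y) = y := fun y => congrArg (fun L : G →ₗ[ℝ] G => L y) hS
      have hβa : β (A a) = 0 := by rw [hskew, hβ, map_zero, neg_zero]
      have hβb : β (A b) = 0 := by rw [hskew, hβ, map_zero, neg_zero]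
      have hβT : (β.comp S.toContinuousLinearMap).comp T = β := by
        ext w
        have h1 : β (w - S (T w)) = 0 := by
          rw [hker (w - S (T w)) (by rw [map_sub, hS', sub_self])]
          simp only [map_sub, map_smul, hβa, hβb, smul_zero, sub_zero]
        rw [map_sub, sub_eq_zero] at h1
        exact h1.symm
      exact ⟨β.comp S.toContinuousLinearMap, by rw [← hB, hβT, hβ, map_zero], hβT⟩
    · rintro ⟨α, hα, rfl⟩
      have hT : ∀ v, T v = 0 → (α.comp T) v = 0 := fun v hv => by simp [hv]
      refine hinj _ ?_ ?_ ?_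
      · rw [hskew, show (C α) (A a) = 0 from hT _ ha, neg_zero]
      · rw [hskew, show (C α) (A b) = 0 from hT _ hb, neg_zero]
      · exact (hB α).trans hα
  rw [hmap]
  exact (Submodule.equivMapOfInjective C hC _).finrank_eq.symm

/-- Weinstein's splitting theorem for Poisson structures of constant corank `s`: canonical
coordinates `p, q` and Casimir functions `c`. -/
theorem IsPoissonAt.exists_canonical_coordinates (m s : ℕ) : ∀ (E : Type) [NormedAddCommGroup E]
    [NormedSpace ℝ E] [FiniteDimensional ℝ E] (P : E → (E →L[ℝ] ℝ) →L[ℝ] E) (x₀ : E),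
    IsPoissonAt P x₀ → Module.finrank ℝ E = 2 * m + s →
    (∀ᶠ x in 𝓝 x₀, Module.finrank ℝ (LinearMap.ker (P x : (E →L[ℝ] ℝ) →ₗ[ℝ] E)) = s) →
    ∃ (p q : Fin m → E → ℝ) (c : Fin s → E → ℝ),
      (∀ i, ∀ᶠ x in 𝓝 x₀, ContDiffAt ℝ ∞ (p i) x) ∧
      (∀ i, ∀ᶠ x in 𝓝 x₀, ContDiffAt ℝ ∞ (q i) x) ∧
      (∀ k, ∀ᶠ x in 𝓝 x₀, ContDiffAt ℝ ∞ (c k) x) ∧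
      (∀ i j, ∀ᶠ x in 𝓝 x₀, bracket P (q i) (p j) x = if i = j then 1 else 0) ∧
      (∀ i j, ∀ᶠ x in 𝓝 x₀, bracket P (p i) (p j) x = 0) ∧
      (∀ i j, ∀ᶠ x in 𝓝 x₀, bracket P (q i) (q j) x = 0) ∧
      (∀ i k, ∀ᶠ x in 𝓝 x₀, bracket P (p i) (c k) x = 0) ∧
      (∀ i k, ∀ᶠ x in 𝓝 x₀, bracket P (q i) (c k) x = 0) ∧
      (∀ k l, ∀ᶠ x in 𝓝 x₀, bracket P (c k) (c l) x = 0) ∧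
      ∀ v, (∀ i, fderiv ℝ (p i) x₀ v = 0) → (∀ i, fderiv ℝ (q i) x₀ v = 0) →
        (∀ k, fderiv ℝ (c k) x₀ v = 0) → v = 0 := by
  induction m with
  | zero =>
    intro E _ _ _ P x₀ hP hdim hker
    let b : Module.Basis (Fin s) ℝ E := Module.finBasisOfFinrankEq ℝ E (hdim.trans (by simp))
    have hP0 : ∀ᶠ x in 𝓝 x₀, P x = 0 := by
      filter_upwards [hker] with x hx
      have : LinearMap.ker (P x : (E →L[ℝ] ℝ) →ₗ[ℝ] E) = ⊤ :=
        Submodule.eq_top_of_finrank_eq (by rw [hx, finrank_strongDual, hdim]; simp)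
      ext1 α
      have hα : α ∈ LinearMap.ker (P x : (E →L[ℝ] ℝ) →ₗ[ℝ] E) := this ▸ Submodule.mem_top
      exact hα
    refine ⟨fun i => i.elim0, fun i => i.elim0, fun k x => (b.coord k).toContinuousLinearMap x,
      fun i => i.elim0, fun i => i.elim0,
      fun k => .of_forall fun x => (b.coord k).toContinuousLinearMap.contDiff.contDiffAt,
      fun i => i.elim0, fun i => i.elim0, fun i => i.elim0, fun i => i.elim0, fun i => i.elim0,
      fun k l => ?_, fun v _ _ hv => ?_⟩
    · filter_upwards [hP0] with x hx
      rw [bracket, hx]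
      simp
    · refine b.ext_elem fun k => ?_
      have := hv k
      rw [ContinuousLinearMap.fderiv] at this
      simpa using this
  | succ m ih =>
    intro E _ _ _ P x₀ hP hdim hker
    have h0 : P x₀ ≠ 0 := by
      intro h
      have h1 := hker.self_of_nhds
      rw [h, ContinuousLinearMap.toLinearMap_zero, LinearMap.ker_zero, finrank_top,
        finrank_strongDual, hdim] at h1
      omega
    obtain ⟨G, _, _, _, p₀, q₀, π, P', hdimG, hp₀, hq₀, hπ, hqp₀, hpπ, hqπ, hinj, hP', hopen,
      hPP'⟩ := hP.exists_splitting h0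
    have hπc : Tendsto π (𝓝 x₀) (𝓝 (π x₀)) := hπ.self_of_nhds.continuousAt
    have hpq₀ : ∀ᶠ x in 𝓝 x₀, ContDiffAt ℝ ∞ (fun y => (p₀ y, q₀ y)) x := by
      filter_upwards [hp₀, hq₀] with x h1 h2 using h1.prodMk h2
    have hpqd : ∀ᶠ x in 𝓝 x₀, ∀ v, fderiv ℝ (fun y => (p₀ y, q₀ y)) x v =
        (fderiv ℝ p₀ x v, fderiv ℝ q₀ x v) := by
      filter_upwards [hp₀, hq₀] with x h1 h2 v
      rw [((h1.differentiableAt (by simp)).hasFDerivAt.prodMk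
        (h2.differentiableAt (by simp)).hasFDerivAt).fderiv]
      rfl
    have hker' : ∀ᶠ y in 𝓝 (π x₀),
        Module.finrank ℝ (LinearMap.ker (P' y : (G →L[ℝ] ℝ) →ₗ[ℝ] G)) = s := by
      refine Eventually.filter_mono hopen (eventually_map.2 ?_)
      filter_upwards [hker, hP.skew, hqp₀, hpπ, hqπ, hPP', hpqd,
        eventually_fderiv_injective hpq₀ hπ fun v h1 h2 => by
          rw [hpqd.self_of_nhds] at h1
          exact hinj v (congrArg Prod.fst h1) (congrArg Prod.snd h1) h2]
        with x h1 h2 h3 h4 h5 h6 h7 h8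
      rw [← finrank_ker_of_splitting hdimG h2 h3 h4 h5
        (fun v ha hb hv => h8 v (by rw [h7, ha, hb]; rfl) hv) h6, h1]
    obtain ⟨p, q, c, hp, hq, hc, hqp, hpp, hqq, hpc, hqc, hcc, hinj'⟩ :=
      ih G P' (π x₀) hP' (by omega) hker'
    have hsm : ∀ f : G → ℝ, (∀ᶠ y in 𝓝 (π x₀), ContDiffAt ℝ ∞ f y) →
        ∀ᶠ x in 𝓝 x₀, ContDiffAt ℝ ∞ (fun x => f (π x)) x := by
      intro f hf
      filter_upwards [hπ, hπc.eventually hf] with x h1 h2 using h2.comp x h1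
    have hpull : ∀ (f g : G → ℝ) (r : ℝ), (∀ᶠ y in 𝓝 (π x₀), ContDiffAt ℝ ∞ f y) →
        (∀ᶠ y in 𝓝 (π x₀), ContDiffAt ℝ ∞ g y) → (∀ᶠ y in 𝓝 (π x₀), bracket P' f g y = r) →
        ∀ᶠ x in 𝓝 x₀, bracket P (fun x => f (π x)) (fun x => g (π x)) x = r := by
      intro f g r hf hg hr
      filter_upwards [hπ, hPP', hπc.eventually hf, hπc.eventually hg, hπc.eventually hr]
        with x h1 h2 h3 h4 h5
      rw [bracket_pullback h2 (h1.differentiableAt (by simp)) (h3.differentiableAt (by simp))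
        (h4.differentiableAt (by simp)), h5]
    have hfd : ∀ f : G → ℝ, (∀ᶠ y in 𝓝 (π x₀), ContDiffAt ℝ ∞ f y) →
        ∀ᶠ x in 𝓝 x₀, ∀ v, fderiv ℝ (fun x => f (π x)) x v = fderiv ℝ f (π x) (fderiv ℝ π x v) := by
      intro f hf
      filter_upwards [hπ, hπc.eventually hf] with x h1 h2 v
      have h : HasFDerivAt (fun y => f (π y)) ((fderiv ℝ f (π x)).comp (fderiv ℝ π x)) x :=
        (h2.differentiableAt (by simp)).hasFDerivAt.comp x
          (h1.differentiableAt (by simp)).hasFDerivAt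
      rw [h.fderiv]
      rfl
    have hmix : ∀ (r : E → ℝ), (∀ᶠ x in 𝓝 x₀, fderiv ℝ π x (P x (fderiv ℝ r x)) = 0) →
        ∀ f : G → ℝ, (∀ᶠ y in 𝓝 (π x₀), ContDiffAt ℝ ∞ f y) →
        ∀ᶠ x in 𝓝 x₀, bracket P r (fun x => f (π x)) x = 0 := by
      intro r hr f hf
      filter_upwards [hr, hfd f hf] with x h1 h2
      rw [bracket, h2, h1, map_zero]
    have hmix' : ∀ (r : E → ℝ), (∀ᶠ x in 𝓝 x₀, fderiv ℝ π x (P x (fderiv ℝ r x)) = 0) →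
        ∀ f : G → ℝ, (∀ᶠ y in 𝓝 (π x₀), ContDiffAt ℝ ∞ f y) →
        ∀ᶠ x in 𝓝 x₀, bracket P (fun x => f (π x)) r x = 0 := by
      intro r hr f hf
      filter_upwards [hmix r hr f hf, hP.bracket_skew] with x h1 h2
      rw [h2, h1, neg_zero]
    refine ⟨Fin.cons p₀ fun i x => p i (π x), Fin.cons q₀ fun i x => q i (π x),
      fun k x => c k (π x), Fin.cases hp₀ fun i => hsm _ (hp i), Fin.cases hq₀ fun i => hsm _ (hq i),
      fun k => hsm _ (hc k), ?_, ?_, ?_, ?_, ?_, fun k l => hpull _ _ _ (hc k) (hc l) (hcc k l), ?_⟩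
    · refine Fin.cases (Fin.cases ?_ fun j => ?_) fun i => Fin.cases ?_ fun j => ?_
      · simpa using hqp₀
      · simpa [(Fin.succ_ne_zero j).symm] using hmix q₀ hqπ _ (hp j)
      · simpa using hmix' p₀ hpπ _ (hq i)
      · simpa using hpull _ _ _ (hq i) (hp j) (hqp i j)
    · refine Fin.cases (Fin.cases ?_ fun j => ?_) fun i => Fin.cases ?_ fun j => ?_
      · exact hP.bracket_self.mono fun x hx => hx p₀
      · exact hmix p₀ hpπ _ (hp j)
      · exact hmix' p₀ hpπ _ (hp i)
      · exact hpull _ _ _ (hp i) (hp j) (hpp i j)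
    · refine Fin.cases (Fin.cases ?_ fun j => ?_) fun i => Fin.cases ?_ fun j => ?_
      · exact hP.bracket_self.mono fun x hx => hx q₀
      · exact hmix q₀ hqπ _ (hq j)
      · exact hmix' q₀ hqπ _ (hq i)
      · exact hpull _ _ _ (hq i) (hq j) (hqq i j)
    · refine Fin.cases (fun k => ?_) fun i k => ?_
      · exact hmix p₀ hpπ _ (hc k)
      · exact hpull _ _ _ (hp i) (hc k) (hpc i k)
    · refine Fin.cases (fun k => ?_) fun i k => ?_
      · exact hmix q₀ hqπ _ (hc k)
      · exact hpull _ _ _ (hq i) (hc k) (hqc i k)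
    · intro v h1 h2 h3
      refine hinj v (h1 0) (h2 0) (hinj' _ (fun i => ?_) (fun i => ?_) fun k => ?_)
      · rw [← (hfd _ (hp i)).self_of_nhds]
        exact h1 i.succ
      · rw [← (hfd _ (hq i)).self_of_nhds]
        exact h2 i.succ
      · rw [← (hfd _ (hc k)).self_of_nhds]
        exact h3 k

end CanonicalCoordinates

section Components

variable {n : ℕ}

lemma ContDiffAt.smul_constant {E F : Type*} [NormedAddCommGroup E] [NormedSpace ℝ E]
    [NormedAddCommGroup F] [NormedSpace ℝ F] {x : E} {f : E → ℝ} (hf : ContDiffAt ℝ ∞ f x)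
    (v : F) : ContDiffAt ℝ ∞ (fun y => f y • v) x := hf.smul contDiffAt_const

/-- The operator `α ↦ ∑ α_c J^{cd} e_d` with components `J`. -/
noncomputable def poissonOp (J : (Fin n → ℝ) → Fin n → Fin n → ℝ) (x : Fin n → ℝ) :
    ((Fin n → ℝ) →L[ℝ] ℝ) →L[ℝ] (Fin n → ℝ) :=
  ∑ c, ∑ d, J x c d • (ContinuousLinearMap.apply ℝ ℝ (Pi.single c (1 : ℝ))).smulRight
    (Pi.single d (1 : ℝ))

lemma apply_poissonOp (J : (Fin n → ℝ) → Fin n → Fin n → ℝ) (x : Fin n → ℝ)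
    (α β : (Fin n → ℝ) →L[ℝ] ℝ) :
    β (poissonOp J x α) =
      ∑ c, ∑ d, α (Pi.single c 1) * β (Pi.single d 1) * J x c d := by
  simp only [poissonOp, sum_apply, map_sum, smul_apply,
    map_smul, ContinuousLinearMap.smulRight_apply, ContinuousLinearMap.apply_apply, smul_eq_mul]
  exact Finset.sum_congr rfl fun c _ => Finset.sum_congr rfl fun d _ => by ring

lemma bracket_poissonOp (J : (Fin n → ℝ) → Fin n → Fin n → ℝ) (x : Fin n → ℝ)
    (f g : (Fin n → ℝ) → ℝ) :
    bracket (poissonOp J) f g x = ∑ c, ∑ d, pd c f x * pd d g x * J x c d :=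
  apply_poissonOp J x _ _

lemma apply_fderiv_poissonOp {J : (Fin n → ℝ) → Fin n → Fin n → ℝ} {x : Fin n → ℝ}
    (hJ : ∀ i j, DifferentiableAt ℝ (fun y => J y i j) x)
    (hP : DifferentiableAt ℝ (poissonOp J) x) (α β γ : (Fin n → ℝ) →L[ℝ] ℝ) :
    γ (fderiv ℝ (poissonOp J) x (poissonOp J x α) β) =
      ∑ i, ∑ j, ∑ k, α (Pi.single i 1) * β (Pi.single j 1) * γ (Pi.single k 1) *
        ∑ μ, J x i μ * pd μ (fun y => J y j k) x := by
  have h1 : HasFDerivAt (fun y => γ (poissonOp J y β))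
      (∑ j, ∑ k, (β (Pi.single j 1) * γ (Pi.single k 1)) • fderiv ℝ (fun y => J y j k) x) x := by
    simp only [apply_poissonOp]
    exact HasFDerivAt.fun_sum fun j _ => HasFDerivAt.fun_sum fun k _ =>
      (hJ j k).hasFDerivAt.const_mul _
  have h2 : fderiv ℝ (fun y => γ (poissonOp J y β)) x (poissonOp J x α) =
      γ (fderiv ℝ (poissonOp J) x (poissonOp J x α) β) := by
    rw [fderiv_clm_map_comp γ (hP.clm_apply (differentiableAt_const β)),
      fderiv_clm_apply hP (differentiableAt_const β)]
    simp
  rw [← h2, h1.fderiv]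
  simp only [sum_apply, smul_apply, smul_eq_mul,
    apply_poissonOp, Finset.mul_sum]
  refine Finset.sum_comm_cycle.trans ?_
  refine Finset.sum_congr rfl fun j _ => Finset.sum_congr rfl fun k _ =>
    Finset.sum_congr rfl fun i _ => Finset.sum_congr rfl fun μ _ => ?_
  simp only [pd]
  ring

/-- The Jacobi identity in components implies the Jacobi identity for operators. -/
lemma cyclic_sum_fderiv_poissonOp {J : (Fin n → ℝ) → Fin n → Fin n → ℝ} {x : Fin n → ℝ}
    (hJ : ∀ i j, DifferentiableAt ℝ (fun y => J y i j) x)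
    (hP : DifferentiableAt ℝ (poissonOp J) x)
    (hJacobi : ∀ i j k,
      ∑ μ, (J x i μ * pd μ (fun y => J y j k) x
          + J x j μ * pd μ (fun y => J y k i) x
          + J x k μ * pd μ (fun y => J y i j) x) = 0) (α β γ : (Fin n → ℝ) →L[ℝ] ℝ) :
    γ (fderiv ℝ (poissonOp J) x (poissonOp J x α) β) +
      α (fderiv ℝ (poissonOp J) x (poissonOp J x β) γ) +
      β (fderiv ℝ (poissonOp J) x (poissonOp J x γ) α) = 0 := by
  simp only [apply_fderiv_poissonOp hJ hP]
  have h1 := Finset.sum_comm_cycle (s := Finset.univ) (t := Finset.univ) (u := Finset.univ)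
    (f := fun j k i => β (Pi.single j 1) * γ (Pi.single k 1) * α (Pi.single i 1) *
        ∑ μ, J x j μ * pd μ (fun y => J y k i) x)
  have h2 := Finset.sum_comm_cycle (s := Finset.univ) (t := Finset.univ) (u := Finset.univ)
    (f := fun i j k => γ (Pi.single k 1) * α (Pi.single i 1) * β (Pi.single j 1) *
        ∑ μ, J x k μ * pd μ (fun y => J y i j) x)
  rw [h1, ← h2]
  simp only [← Finset.sum_add_distrib]
  refine Finset.sum_eq_zero fun i _ => Finset.sum_eq_zero fun j _ => Finset.sum_eq_zero fun k _ => ?_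
  have := hJacobi i j k
  rw [Finset.sum_add_distrib, Finset.sum_add_distrib] at this
  linear_combination (α (Pi.single i 1) * β (Pi.single j 1) * γ (Pi.single k 1)) * this

/-- Derivative of a bracket along a Hamiltonian field. -/
lemma bracket_bracket {E : Type} [NormedAddCommGroup E] [NormedSpace ℝ E]
    {P : E → (E →L[ℝ] ℝ) →L[ℝ] E} {x : E} (hP : DifferentiableAt ℝ P x)
    (hskew : ∀ α β : E →L[ℝ] ℝ, β (P x α) = -α (P x β)) {f g h : E → ℝ}
    (hg : ContDiffAt ℝ ∞ g x) (hh : ContDiffAt ℝ ∞ h x) :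
    bracket P f (bracket P g h) x =
      fderiv ℝ (fderiv ℝ h) x (P x (fderiv ℝ f x)) (P x (fderiv ℝ g x))
      - fderiv ℝ (fderiv ℝ g) x (P x (fderiv ℝ f x)) (P x (fderiv ℝ h x))
      + fderiv ℝ h x (fderiv ℝ P x (P x (fderiv ℝ f x)) (fderiv ℝ g x)) := by
  have hg' : DifferentiableAt ℝ (fderiv ℝ g) x := hg.fderiv_top.differentiableAt (by simp)
  have hh' : DifferentiableAt ℝ (fderiv ℝ h) x := hh.fderiv_top.differentiableAt (by simp)
  have : fderiv ℝ (bracket P g h) x = _ :=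
    fderiv_clm_apply hh' (hP.clm_apply hg')
  rw [bracket, this, fderiv_clm_apply hP hg']
  simp only [add_apply, ContinuousLinearMap.comp_apply,
    ContinuousLinearMap.flip_apply, map_add]
  rw [hskew (fderiv ℝ (fderiv ℝ g) x _)]
  ring

/-- A smooth skew matrix field satisfying the Jacobi identity is a Poisson structure. -/
theorem isPoissonAt_poissonOp {J : (Fin n → ℝ) → Fin n → Fin n → ℝ} {x₀ : Fin n → ℝ}
    (hJ : ∀ᶠ x in 𝓝 x₀, ∀ i j, ContDiffAt ℝ ∞ (fun y => J y i j) x)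
    (hskew : ∀ x, ∀ i j, J x i j = - J x j i)
    (hJacobi : ∀ᶠ x in 𝓝 x₀, ∀ i j k,
      ∑ μ, (J x i μ * pd μ (fun y => J y j k) x
          + J x j μ * pd μ (fun y => J y k i) x
          + J x k μ * pd μ (fun y => J y i j) x) = 0) :
    IsPoissonAt (poissonOp J) x₀ := by
  have hsm : ∀ᶠ x in 𝓝 x₀, ContDiffAt ℝ ∞ (poissonOp J) x := by
    filter_upwards [hJ] with x hx
    exact ContDiffAt.sum fun i _ => ContDiffAt.sum fun j _ => (hx i j).smul_constant _
  have hsk : ∀ x, ∀ α β : (Fin n → ℝ) →L[ℝ] ℝ, β (poissonOp J x α) = -α (poissonOp J x β) := by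
    intro x α β
    rw [apply_poissonOp, apply_poissonOp, Finset.sum_comm, ← Finset.sum_neg_distrib]
    refine Finset.sum_congr rfl fun i _ => ?_
    rw [← Finset.sum_neg_distrib]
    refine Finset.sum_congr rfl fun j _ => ?_
    rw [hskew x j i]
    ring
  refine ⟨hsm, .of_forall hsk, ?_⟩
  filter_upwards [hsm, hJ, hJacobi] with x h1 h2 h3 f g h hf hg hh
  have hPd : DifferentiableAt ℝ (poissonOp J) x := h1.differentiableAt (by simp)
  have hcyc := cyclic_sum_fderiv_poissonOp (fun i j => (h2 i j).differentiableAt (by simp)) hPd h3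
    (fderiv ℝ f x) (fderiv ℝ g x) (fderiv ℝ h x)
  have hsymm : ∀ r : (Fin n → ℝ) → ℝ, ContDiffAt ℝ ∞ r x → ∀ v w,
      fderiv ℝ (fderiv ℝ r) x v w = fderiv ℝ (fderiv ℝ r) x w v := fun r hr v w =>
    (hr.isSymmSndFDerivAt (by
      rw [minSmoothness_of_isRCLikeNormedField]
      exact WithTop.coe_le_coe.2 le_top)).eq v w
  rw [bracket_bracket hPd (hsk x) hg.self_of_nhds hh.self_of_nhds,
    bracket_bracket hPd (hsk x) hh.self_of_nhds hf.self_of_nhds,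
    bracket_bracket hPd (hsk x) hf.self_of_nhds hg.self_of_nhds]
  linear_combination hcyc
    + hsymm h hh.self_of_nhds (poissonOp J x (fderiv ℝ f x)) (poissonOp J x (fderiv ℝ g x))
    + hsymm f hf.self_of_nhds (poissonOp J x (fderiv ℝ g x)) (poissonOp J x (fderiv ℝ h x))
    + hsymm g hg.self_of_nhds (poissonOp J x (fderiv ℝ h x)) (poissonOp J x (fderiv ℝ f x))

lemma finrank_ker_poissonOp (J : (Fin n → ℝ) → Fin n → Fin n → ℝ) (x : Fin n → ℝ) :
    (Matrix.of fun i j => J x i j).rank + Module.finrank ℝ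
      (LinearMap.ker (poissonOp J x : ((Fin n → ℝ) →L[ℝ] ℝ) →ₗ[ℝ] (Fin n → ℝ))) = n := by
  let D : ((Fin n → ℝ) →L[ℝ] ℝ) →ₗ[ℝ] (Fin n → ℝ) :=
    { toFun := fun α c => α (Pi.single c 1)
      map_add' := fun _ _ => rfl
      map_smul' := fun _ _ => rfl }
  have hD : LinearMap.range D = ⊤ := by
    refine LinearMap.range_eq_top.2 fun v =>
      ⟨∑ c, v c • ContinuousLinearMap.proj (R := ℝ) (φ := fun _ : Fin n => ℝ) c, ?_⟩
    ext i
    simp [D, Pi.single_apply]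
  have hP : (poissonOp J x : ((Fin n → ℝ) →L[ℝ] ℝ) →ₗ[ℝ] (Fin n → ℝ)) =
      (Matrix.of fun i j => J x i j).transpose.mulVecLin ∘ₗ D := by
    ext α k
    have h := apply_poissonOp J x α (ContinuousLinearMap.proj (R := ℝ) (φ := fun _ : Fin n => ℝ) k)
    simp only [ContinuousLinearMap.proj_apply] at h
    simp only [ContinuousLinearMap.coe_coe, LinearMap.comp_apply, Matrix.mulVecLin_apply]
    rw [h]
    simp [Matrix.mulVec, dotProduct, D, Pi.single_apply, mul_comm]
  have h := LinearMap.finrank_range_add_finrank_ker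
    (poissonOp J x : ((Fin n → ℝ) →L[ℝ] ℝ) →ₗ[ℝ] (Fin n → ℝ))
  rw [finrank_strongDual, Module.finrank_fin_fun] at h
  rw [hP, LinearMap.range_comp_of_range_eq_top _ hD, ← hP] at h
  rw [← Matrix.rank_transpose]
  exact h

end Components

section Assembly

/-- Case distinction on `Fin (2 * m + s)` into three blocks of lengths `m`, `m` and `s`. -/
lemma forall_fin_two_mul_add {m s : ℕ} {Q : Fin (2 * m + s) → Prop}
    (h1 : ∀ i : Fin m, Q ⟨i, by omega⟩) (h2 : ∀ i : Fin m, Q ⟨m + i, by omega⟩)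
    (h3 : ∀ k : Fin s, Q ⟨2 * m + k, by omega⟩) (a : Fin (2 * m + s)) : Q a := by
  obtain ⟨a, ha⟩ := a
  rcases lt_or_ge a m with h | h
  · exact h1 ⟨a, h⟩
  rcases lt_or_ge a (2 * m) with h' | h'
  · have := h2 ⟨a - m, by omega⟩
    simpa only [Nat.add_sub_cancel' h] using this
  · have := h3 ⟨a - 2 * m, by omega⟩
    simpa only [Nat.add_sub_cancel' h'] using this

/-- Concatenation of three families into one indexed by `Fin (2 * m + s)`. -/
def concatBlocks {α : Type} {m s : ℕ} (p q : Fin m → α) (c : Fin s → α) (a : Fin (2 * m + s)) :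
    α :=
  if h : a.val < m then p ⟨a, h⟩
  else if h' : a.val < 2 * m then q ⟨a - m, by omega⟩
  else c ⟨a - 2 * m, by omega⟩

section concatBlocks

variable {α : Type} {m s : ℕ} (p q : Fin m → α) (c : Fin s → α)

lemma concatBlocks_fst (i : Fin m) : concatBlocks p q c ⟨i, by omega⟩ = p i := by
  simp [concatBlocks]

lemma concatBlocks_snd (i : Fin m) : concatBlocks p q c ⟨m + i, by omega⟩ = q i := by
  have : m + i.val < 2 * m := by omega
  simp [concatBlocks, this]

lemma concatBlocks_thd (k : Fin s) : concatBlocks p q c ⟨2 * m + k, by omega⟩ = c k := by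
  have : ¬ 2 * m + k.val < m := by omega
  simp [concatBlocks, this]

end concatBlocks

/-- Canonical coordinates for a Poisson structure of corank `s` on `ℝ^(2m+s)`. -/
theorem IsPoissonAt.exists_canonical_chart {m s : ℕ}
    {P : (Fin (2 * m + s) → ℝ) → ((Fin (2 * m + s) → ℝ) →L[ℝ] ℝ) →L[ℝ] (Fin (2 * m + s) → ℝ)}
    {x₀ : Fin (2 * m + s) → ℝ} (hP : IsPoissonAt P x₀)
    (hker : ∀ᶠ x in 𝓝 x₀, Module.finrank ℝ (LinearMap.ker
      (P x : ((Fin (2 * m + s) → ℝ) →L[ℝ] ℝ) →ₗ[ℝ] (Fin (2 * m + s) → ℝ))) = s) :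
    ∃ φ : (Fin (2 * m + s) → ℝ) → (Fin (2 * m + s) → ℝ),
      (∀ᶠ x in 𝓝 x₀, ContDiffAt ℝ ∞ φ x) ∧ (∀ v, fderiv ℝ φ x₀ v = 0 → v = 0) ∧
      ∀ᶠ x in 𝓝 x₀, ∀ a b, bracket P (fun y => φ y a) (fun y => φ y b) x = J₀ m s a b := by
  obtain ⟨p, q, c, hp, hq, hc, hqp, hpp, hqq, hpc, hqc, hcc, hinj⟩ :=
    IsPoissonAt.exists_canonical_coordinates m s _ P x₀ hP (Module.finrank_fin_fun ℝ) hker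
  have hu : ∀ a, ∀ᶠ x in 𝓝 x₀, ContDiffAt ℝ ∞ (concatBlocks p q c a) x := by
    refine forall_fin_two_mul_add (fun i => ?_) (fun i => ?_) (fun k => ?_)
    · rw [concatBlocks_fst]
      exact hp i
    · rw [concatBlocks_snd]
      exact hq i
    · rw [concatBlocks_thd]
      exact hc k
  have hφ : ∀ᶠ x in 𝓝 x₀, ContDiffAt ℝ ∞ (fun y a => concatBlocks p q c a y) x := by
    filter_upwards [eventually_all.2 hu] with x hx using contDiffAt_pi.2 hx
  refine ⟨fun y a => concatBlocks p q c a y, hφ, fun v hv => ?_, eventually_all.2 fun a =>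
    eventually_all.2 fun b => ?_⟩
  · have hd : ∀ a, fderiv ℝ (concatBlocks p q c a) x₀ v = 0 := by
      intro a
      rw [fderiv_pi fun a => (hu a).self_of_nhds.differentiableAt (by simp)] at hv
      exact congrFun hv a
    refine hinj v (fun i => ?_) (fun i => ?_) fun k => ?_
    · rw [← concatBlocks_fst p q c i]
      exact hd _
    · rw [← concatBlocks_snd p q c i]
      exact hd _
    · rw [← concatBlocks_thd p q c k]
      exact hd _
  · have hswap : ∀ (f g : (Fin (2 * m + s) → ℝ) → ℝ) (r : ℝ),
        (∀ᶠ x in 𝓝 x₀, bracket P f g x = r) → ∀ᶠ x in 𝓝 x₀, bracket P g f x = -r := by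
      intro f g r h
      filter_upwards [h, hP.bracket_skew] with x h1 h2
      rw [h2, h1]
    change ∀ᶠ x in 𝓝 x₀, bracket P (concatBlocks p q c a) (concatBlocks p q c b) x = J₀ m s a b
    revert a b
    refine forall_fin_two_mul_add (fun i => ?_) (fun i => ?_) (fun k => ?_) <;>
    refine forall_fin_two_mul_add (fun j => ?_) (fun j => ?_) (fun l => ?_) <;>
    simp only [concatBlocks_fst, concatBlocks_snd, concatBlocks_thd]
    · simp only [J₀]
      rw [if_neg (by omega), if_neg (by omega)]
      exact hpp i j
    · convert hswap _ _ _ (hqp j i) using 3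
      simp only [J₀]
      rw [if_neg (by omega)]
      by_cases h : j = i
      · rw [if_pos h, if_pos ⟨i.2, by simp only [h, add_comm]⟩]
      · rw [if_neg h, if_neg (by omega), neg_zero]
    · simp only [J₀]
      rw [if_neg (by omega), if_neg (by omega)]
      exact hpc i l
    · convert hqp i j using 3
      simp only [J₀]
      by_cases h : i = j
      · rw [if_pos h, if_pos ⟨j.2, by simp only [h, add_comm]⟩]
      · rw [if_neg h, if_neg (by omega), if_neg (by omega)]
    · simp only [J₀]
      rw [if_neg (by omega), if_neg (by omega)]
      exact hqq i j
    · simp only [J₀]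
      rw [if_neg (by omega), if_neg (by omega)]
      exact hqc i l
    · simp only [J₀]
      rw [if_neg (by omega), if_neg (by omega), ← neg_zero]
      exact hswap _ _ _ (hpc j k)
    · simp only [J₀]
      rw [if_neg (by omega), if_neg (by omega), ← neg_zero]
      exact hswap _ _ _ (hqc j k)
    · simp only [J₀]
      rw [if_neg (by omega), if_neg (by omega)]
      exact hcc k l

end Assembly

end LieDarboux

/-- Lie–Darboux theorem for Poisson bivector fields: a smooth skew-symmetric matrix field of
constant rank `2m` on an open set of `ℝ^(2m+s)` satisfying the Jacobi identity can be brought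
locally to the constant canonical form `Σᵢ ∂_{qⁱ} ∧ ∂_{pⁱ}` by a diffeomorphism. -/
theorem lie_darboux_poisson (m s : ℕ)
    (Ω : Set (Fin (2 * m + s) → ℝ)) (hΩ : IsOpen Ω)
    (J : (Fin (2 * m + s) → ℝ) → Fin (2 * m + s) → Fin (2 * m + s) → ℝ)
    (hsmooth : ∀ i j, ContDiffOn ℝ (⊤ : ℕ∞) (fun x => J x i j) Ω)
    (hskew : ∀ x, ∀ i j, J x i j = - J x j i)
    (hrank : ∀ x ∈ Ω, (Matrix.of fun i j => J x i j).rank = 2 * m)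
    (hJacobi : ∀ x ∈ Ω, ∀ i j k,
      ∑ μ, (J x i μ * pd μ (fun y => J y j k) x
          + J x j μ * pd μ (fun y => J y k i) x
          + J x k μ * pd μ (fun y => J y i j) x) = 0)
    (x₀ : Fin (2 * m + s) → ℝ) (hx₀ : x₀ ∈ Ω) :
    ∃ (U : Set (Fin (2 * m + s) → ℝ)) (φ ψ : (Fin (2 * m + s) → ℝ) → (Fin (2 * m + s) → ℝ)),
      IsOpen U ∧ U ⊆ Ω ∧ x₀ ∈ U ∧
      ContDiffOn ℝ (⊤ : ℕ∞) φ U ∧ IsOpen (φ '' U) ∧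
      ContDiffOn ℝ (⊤ : ℕ∞) ψ (φ '' U) ∧ (∀ x ∈ U, ψ (φ x) = x) ∧
      (∀ x ∈ U, ∀ a b,
        ∑ c, ∑ d, pd c (fun y => φ y a) x * pd d (fun y => φ y b) x * J x c d
          = J₀ m s a b) := by
  open Filter Topology ContDiff in
  have hJsm : ∀ᶠ x in 𝓝 x₀, ∀ i j, ContDiffAt ℝ ∞ (fun y => J y i j) x := by
    filter_upwards [hΩ.mem_nhds hx₀] with x hx i j
    exact (hsmooth i j).contDiffAt (hΩ.mem_nhds hx)
  have hP : IsPoissonAt (poissonOp J) x₀ :=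
    isPoissonAt_poissonOp hJsm hskew (Filter.mem_of_superset (hΩ.mem_nhds hx₀) hJacobi)
  obtain ⟨φ, hφ, hinj, hcan⟩ := hP.exists_canonical_chart (by
    filter_upwards [hΩ.mem_nhds hx₀] with x hx
    have h1 := finrank_ker_poissonOp J x
    rw [hrank x hx] at h1
    omega)
  obtain ⟨f', hf'⟩ := exists_continuousLinearEquiv_eq (fderiv ℝ φ x₀) hinj rfl
  obtain ⟨e, he, hx₀e, hesm, hesymm⟩ := exists_smooth_openPartialHomeomorph (f' := f') hφ (by
    rw [hf']
    exact (hφ.self_of_nhds.differentiableAt (by simp)).hasFDerivAt)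
  obtain ⟨W, hW, hWo, hx₀W⟩ := eventually_nhds_iff.1 (hcan.and (hΩ.mem_nhds hx₀))
  have himg : φ '' (e.source ∩ W) = e '' (e.source ∩ W) := Set.image_congr fun x _ => (he x).symm
  refine ⟨e.source ∩ W, φ, e.symm, e.open_source.inter hWo, fun x hx => (hW x hx.2).2,
    ⟨hx₀e, hx₀W⟩, fun x hx => (hesm x hx.1).contDiffWithinAt, ?_, ?_, fun x hx => ?_,
    fun x hx a b => ?_⟩
  · rw [himg]
    exact e.isOpen_image_of_subset_source (e.open_source.inter hWo) Set.inter_subset_left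
  · rw [himg]
    rintro _ ⟨x, hx, rfl⟩
    exact (hesymm _ (e.map_source hx.1)).contDiffWithinAt
  · rw [← he]
    exact e.left_inv hx.1
  · rw [← (hW x hx.2).1 a b, bracket_poissonOp]
end

section
/- Let Ω ⊆ ℝⁿ be an open set with n = 2m + s, s ≥ 0, and let ω be a smooth skew-symmetric covariant matrix field on Ω (components ω_{ij} = −ω_{ji}) such that the matrix ω(x) has rank 2m at every x ∈ Ω and the closure condition ∂ω_{ij}/∂x^k + ∂ω_{jk}/∂x^i + ∂ω_{ki}/∂x^j = 0 holds on Ω for all i,j,k. Then for every point x₀ ∈ Ω there exist an open neighborhood U ⊆ Ω of x₀ and a smooth map φ = (p¹,…,p^m, q¹,…,q^m, C¹,…,C^s) : U → ℝⁿ that is a diffeomorphism onto an open subset of ℝⁿ such that, for all x ∈ U and all c,d ∈ {1,…,n}, ω_{cd}(x) = Σ_{i=1}^m ( ∂_c p^i(x) ∂_d q^i(x) − ∂_d p^i(x) ∂_c q^i(x) ); i.e., locally ω = Σ_{i=1}^m dp^i ∧ dq^i. -/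
section LieDarboux

open Set Filter Topology
open scoped ContDiff

section Analysis

/-- Pointwise application of a continuous family of continuous linear maps to a continuous
function, as a continuous bilinear map. -/
noncomputable def pointwiseApplyL (K E F : Type) [TopologicalSpace K] [CompactSpace K]
    [NormedAddCommGroup E] [NormedSpace ℝ E] [NormedAddCommGroup F] [NormedSpace ℝ F] :
    C(K, E →L[ℝ] F) →L[ℝ] C(K, E) →L[ℝ] C(K, F) :=
  LinearMap.mkContinuous₂
    (LinearMap.mk₂ ℝ (fun (A : C(K, E →L[ℝ] F)) (a : C(K, E)) =>
        (⟨fun t => A t (a t), by fun_prop⟩ : C(K, F)))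
      (fun _ _ _ => by ext; simp) (fun _ _ _ => by ext; simp)
      (fun _ _ _ => by ext; simp) (fun _ _ _ => by ext; simp)) 1
    (fun (A : C(K, E →L[ℝ] F)) (a : C(K, E)) => by
      rw [ContinuousMap.norm_le _ (by positivity)]
      intro t
      calc ‖A t (a t)‖ ≤ ‖A t‖ * ‖a t‖ := (A t).le_opNorm _
        _ ≤ ‖A‖ * ‖a‖ := by
          gcongr
          · exact A.norm_coe_le_norm t
          · exact a.norm_coe_le_norm t
        _ = 1 * ‖A‖ * ‖a‖ := by ring)

theorem hasFDerivAt_postcomp {K E F : Type} [TopologicalSpace K] [CompactSpace K]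
    [NormedAddCommGroup E] [NormedSpace ℝ E] [NormedAddCommGroup F] [NormedSpace ℝ F]
    (f : C(E, F)) (f' : C(E, E →L[ℝ] F)) (h : ∀ x, HasFDerivAt f (f' x) x) (a : C(K, E)) :
    HasFDerivAt (fun b : C(K, E) => f.comp b) (pointwiseApplyL K E F (f'.comp a)) a := by
  rw [hasFDerivAt_iff_isLittleO_nhds_zero, Asymptotics.isLittleO_iff]
  intro c hc
  have hcont := (ContinuousMap.continuous_postcomp (X := K) f').continuousAt (x := a)
  obtain ⟨δ, hδ, hball⟩ := Metric.mem_nhds_iff.1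
    (hcont.preimage_mem_nhds (Metric.ball_mem_nhds (f'.comp a) hc))
  filter_upwards [Metric.ball_mem_nhds (0 : C(K, E)) hδ] with b hb
  rw [ContinuousMap.norm_le _ (by positivity)]
  intro t
  have key := Convex.norm_image_sub_le_of_norm_hasFDerivWithin_le' (f := f) (f' := f')
    (φ := f' (a t)) (C := c) (s := Metric.ball (a t) δ) (x := a t) (y := a t + b t)
    (fun x _ => (h x).hasFDerivWithinAt) (fun y hy => ?_) (convex_ball _ _)
    (Metric.mem_ball_self hδ) ?_
  · refine le_trans ?_ (key.trans ?_)
    · simp [pointwiseApplyL]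
    · rw [add_sub_cancel_left]
      gcongr
      exact b.norm_coe_le_norm t
  · have h1 : dist (a + ContinuousMap.const K (y - a t)) a < δ := by
      rw [dist_eq_norm, add_sub_cancel_left]
      refine lt_of_le_of_lt ((ContinuousMap.norm_le _ (norm_nonneg (y - a t))).2 fun _ => ?_)
        (mem_ball_iff_norm.1 hy)
      simp
    have h2 := hball h1
    have h3 := ((ContinuousMap.dist_lt_iff hc).1 h2 t).le
    simpa [dist_eq_norm] using h3
  · rw [mem_ball_iff_norm, add_sub_cancel_left]
    exact lt_of_le_of_lt (b.norm_coe_le_norm t) (by simpa using hb)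

theorem contDiff_postcomp_nat {K E : Type} [TopologicalSpace K] [CompactSpace K]
    [NormedAddCommGroup E] [NormedSpace ℝ E] (n : ℕ) :
    ∀ (F : Type) [NormedAddCommGroup F] [NormedSpace ℝ F] (f : C(E, F)), ContDiff ℝ n f →
      ContDiff ℝ n (fun b : C(K, E) => f.comp b) := by
  induction n with
  | zero =>
    intro F _ _ f _
    exact contDiff_zero.2 (ContinuousMap.continuous_postcomp f)
  | succ n ih =>
    intro F _ _ f hf
    obtain ⟨f', hf', hder⟩ := contDiff_succ_iff_hasFDerivAt.1 hf
    refine contDiff_succ_iff_hasFDerivAt.2 ⟨fun a => pointwiseApplyL K E F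
      ((⟨f', hf'.continuous⟩ : C(E, E →L[ℝ] F)).comp a), ?_, fun a => ?_⟩
    · exact (pointwiseApplyL K E F).contDiff.comp (ih _ ⟨f', hf'.continuous⟩ hf')
    · exact hasFDerivAt_postcomp f ⟨f', hf'.continuous⟩ hder a

theorem contDiff_postcomp {K E F : Type} [TopologicalSpace K] [CompactSpace K]
    [NormedAddCommGroup E] [NormedSpace ℝ E] [NormedAddCommGroup F] [NormedSpace ℝ F]
    (f : C(E, F)) (hf : ContDiff ℝ ∞ f) : ContDiff ℝ ∞ (fun b : C(K, E) => f.comp b) :=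
  contDiff_infty.2 fun n => contDiff_postcomp_nat n F f (contDiff_infty.1 hf n)

/-- The primitive vanishing at `0` of a continuous function on `[-1, 1]`. -/
noncomputable def primitiveL (E : Type) [NormedAddCommGroup E] [NormedSpace ℝ E] :
    C(Icc (-1 : ℝ) 1, E) →L[ℝ] C(Icc (-1 : ℝ) 1, E) :=
  LinearMap.mkContinuous
    { toFun := fun b => ⟨fun t => ∫ s in (0 : ℝ)..t, IccExtend (by norm_num) b s,
        (intervalIntegral.continuous_primitive
          (fun _ _ => (b.continuous.Icc_extend').intervalIntegrable _ _) 0).comp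
          continuous_subtype_val⟩
      map_add' := fun a b => by
        ext t
        exact intervalIntegral.integral_add (a.continuous.Icc_extend'.intervalIntegrable _ _)
          (b.continuous.Icc_extend'.intervalIntegrable _ _)
      map_smul' := fun c b => by
        ext t
        exact intervalIntegral.integral_smul c _ } 1
    (fun b => by
      rw [one_mul, ContinuousMap.norm_le _ (norm_nonneg _)]
      intro t
      refine (intervalIntegral.norm_integral_le_of_norm_le_const (C := ‖b‖)
        (fun s _ => b.norm_coe_le_norm _)).trans ?_
      have : |(t : ℝ) - 0| ≤ 1 := by rw [sub_zero]; exact abs_le.2 t.2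
      nlinarith [norm_nonneg b])

theorem primitiveL_apply {E : Type} [NormedAddCommGroup E] [NormedSpace ℝ E]
    (b : C(Icc (-1 : ℝ) 1, E)) (t : Icc (-1 : ℝ) 1) :
    primitiveL E b t = ∫ s in (0 : ℝ)..t, IccExtend (by norm_num) b s := rfl

theorem exists_openPartialHomeomorph_contDiffOn {E F : Type*} [NormedAddCommGroup E]
    [NormedSpace ℝ E] [CompleteSpace E] [NormedAddCommGroup F] [NormedSpace ℝ F]
    {f : E → F} {f' : E ≃L[ℝ] F} {a : E} {s : Set E} (hs : IsOpen s) (ha : a ∈ s)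
    (hf : ContDiffOn ℝ ∞ f s) (hf' : HasFDerivAt f (f' : E →L[ℝ] F) a) :
    ∃ e : OpenPartialHomeomorph E F, ⇑e = f ∧ a ∈ e.source ∧ e.source ⊆ s ∧
      ContDiffOn ℝ ∞ e.symm e.target := by
  have hat : ∀ x ∈ s, ContDiffAt ℝ ∞ f x := fun x hx => hf.contDiffAt (hs.mem_nhds hx)
  let e₀ := (hat a ha).toOpenPartialHomeomorph f hf' (by simp)
  have hcont : ContinuousAt (fderiv ℝ f) a :=
    ((hat a ha).fderiv_right (m := 0) (by simp)).continuousAt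
  have hmem : fderiv ℝ f ⁻¹' range ((↑) : (E ≃L[ℝ] F) → E →L[ℝ] F) ∈ 𝓝 a :=
    hcont.preimage_mem_nhds (ContinuousLinearEquiv.isOpen.mem_nhds ⟨f', hf'.fderiv.symm⟩)
  obtain ⟨t, hts, hto, hat'⟩ := mem_nhds_iff.1 (inter_mem hmem (hs.mem_nhds ha))
  refine ⟨e₀.restrOpen t hto, rfl,
    ⟨(hat a ha).mem_toOpenPartialHomeomorph_source hf' (by simp), hat'⟩,
    fun x hx => (hts hx.2).2, fun y hy => ?_⟩
  have hx := (e₀.restrOpen t hto).map_target hy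
  obtain ⟨g, hg⟩ := (hts hx.2).1
  have hd := ((hat _ (hts hx.2).2).differentiableAt (by simp)).hasFDerivAt
  rw [← hg] at hd
  exact ((e₀.restrOpen t hto).contDiffAt_symm (f₀' := g) hy hd
    (hat _ (hts hx.2).2)).contDiffWithinAt

end Analysis

section Flow

variable {E : Type} [NormedAddCommGroup E] [NormedSpace ℝ E]

/-- The integral equation of the flow of `f` on `[-1, 1]`, with time rescaled by a parameter:
the last component vanishes iff the curve solves it. -/
noncomputable def flowEquation (f : C(E, E)) (z : (ℝ × E) × C(Icc (-1 : ℝ) 1, E)) :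
    (ℝ × E) × C(Icc (-1 : ℝ) 1, E) :=
  (z.1, z.2 - ContinuousLinearMap.const ℝ _ z.1.2 - z.1.1 • primitiveL E (f.comp z.2))

theorem contDiff_flowEquation (f : C(E, E)) (hf : ContDiff ℝ ∞ f) :
    ContDiff ℝ ∞ (flowEquation f) := by
  have h := (contDiff_postcomp (K := Icc (-1 : ℝ) 1) f hf)
  unfold flowEquation
  have h2 : ContDiff ℝ ∞ (fun z : (ℝ × E) × C(Icc (-1 : ℝ) 1, E) =>
    primitiveL E (f.comp z.2)) := (primitiveL E).contDiff.comp (h.comp contDiff_snd)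
  fun_prop

theorem hasFDerivAt_flowEquation (f : C(E, E)) (hf : ContDiff ℝ ∞ f) (x₀ : E) :
    ∃ L : ((ℝ × E) × C(Icc (-1 : ℝ) 1, E)) ≃L[ℝ] ((ℝ × E) × C(Icc (-1 : ℝ) 1, E)),
      HasFDerivAt (flowEquation f) (L : _ →L[ℝ] _) ((0, x₀), ContinuousMap.const _ x₀) := by
  set z₀ : (ℝ × E) × C(Icc (-1 : ℝ) 1, E) := ((0, x₀), ContinuousMap.const _ x₀)
  have h2 : ContDiff ℝ ∞ (fun z : (ℝ × E) × C(Icc (-1 : ℝ) 1, E) =>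
    primitiveL E (f.comp z.2)) :=
    (primitiveL E).contDiff.comp ((contDiff_postcomp f hf).comp contDiff_snd)
  have h3 := (h2.differentiable (by simp) z₀).hasFDerivAt
  have h1 : HasFDerivAt (fun z : (ℝ × E) × C(Icc (-1 : ℝ) 1, E) => z.1.1)
    ((ContinuousLinearMap.fst ℝ ℝ E).comp (ContinuousLinearMap.fst ℝ (ℝ × E) _)) z₀ :=
    hasFDerivAt_fst.comp z₀ hasFDerivAt_fst
  have h4 : HasFDerivAt (fun z : (ℝ × E) × C(Icc (-1 : ℝ) 1, E) =>
      ContinuousLinearMap.const ℝ (Icc (-1 : ℝ) 1) z.1.2)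
    ((ContinuousLinearMap.const ℝ (Icc (-1 : ℝ) 1)).comp
      ((ContinuousLinearMap.snd ℝ ℝ E).comp (ContinuousLinearMap.fst ℝ (ℝ × E) _))) z₀ :=
    (ContinuousLinearMap.hasFDerivAt _).comp z₀ (hasFDerivAt_snd.comp z₀ hasFDerivAt_fst)
  have h5 := hasFDerivAt_fst (𝕜 := ℝ) (p := z₀) |>.prodMk
    ((hasFDerivAt_snd (𝕜 := ℝ) (p := z₀) |>.sub h4).sub (h1.smul h3))
  refine ⟨ContinuousLinearEquiv.skewProd (ContinuousLinearEquiv.refl ℝ (ℝ × E))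
    (ContinuousLinearEquiv.refl ℝ C(Icc (-1 : ℝ) 1, E))
    (-((ContinuousLinearMap.const ℝ (Icc (-1 : ℝ) 1)).comp (ContinuousLinearMap.snd ℝ ℝ E))
      - (ContinuousLinearMap.fst ℝ ℝ E).smulRight (primitiveL E (f.comp z₀.2))), ?_⟩
  refine h5.congr_fderiv ?_
  ext z <;> simp [z₀]

theorem exists_local_flow [CompleteSpace E] (f : C(E, E)) (hf : ContDiff ℝ ∞ f) (x₀ : E) :
    ∃ U : Set (ℝ × E), IsOpen U ∧ (0, x₀) ∈ U ∧ ∃ Φ : ℝ × E → E, ContDiffOn ℝ ∞ Φ U ∧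
      (∀ x, (0, x) ∈ U → Φ (0, x) = x) ∧
      ∀ z ∈ U, HasDerivAt (fun t => Φ (t, z.2)) (f (Φ z)) z.1 := by
  obtain ⟨L, hL⟩ := hasFDerivAt_flowEquation f hf x₀
  obtain ⟨e, he, hmem, -, hsymm⟩ := exists_openPartialHomeomorph_contDiffOn isOpen_univ
    (mem_univ _) (contDiff_flowEquation f hf).contDiffOn hL
  set c₀ : C(Icc (-1 : ℝ) 1, E) := ContinuousMap.const _ x₀
  have hbase : e ((0, x₀), c₀) = ((0, x₀), 0) := by
    rw [he]
    ext t <;> simp [flowEquation, c₀]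
  obtain ⟨δ, hδ, hball⟩ := Metric.mem_nhds_iff.1 (e.open_source.mem_nhds hmem)
  let ι : ℝ × E → (ℝ × E) × C(Icc (-1 : ℝ) 1, E) := fun w => (w, 0)
  have hι : Continuous ι := by fun_prop
  let S : ℝ × E → C(Icc (-1 : ℝ) 1, E) := fun w => (e.symm (ι w)).2
  have htgt : ι (0, x₀) ∈ e.target := by
    have := e.map_source hmem
    rwa [hbase] at this
  have hsy0 : e.symm (ι (0, x₀)) = ((0, x₀), c₀) := by
    have := e.left_inv hmem
    rwa [hbase] at this
  have hcont : ContinuousAt (fun w => e.symm (ι w)) (0, x₀) :=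
    (e.continuousAt_symm htgt).comp hι.continuousAt
  have hnhds : ι ⁻¹' e.target ∩ (fun w => e.symm (ι w)) ⁻¹' Metric.ball ((0, x₀), c₀) δ
      ∈ 𝓝 ((0 : ℝ), x₀) := by
    refine inter_mem (hι.continuousAt.preimage_mem_nhds (e.open_target.mem_nhds htgt))
      (hcont.preimage_mem_nhds ?_)
    rw [hsy0]
    exact Metric.ball_mem_nhds _ hδ
  obtain ⟨η, hη, hηb⟩ := Metric.mem_nhds_iff.1 hnhds
  have hS : ∀ w ∈ Metric.ball ((0 : ℝ), x₀) η, e.symm (ι w) = (w, S w) ∧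
      dist (w, S w) ((0, x₀), c₀) < δ ∧ ∀ t, S w t = w.2 + w.1 • ∫ s in (0 : ℝ)..t,
        f (IccExtend (by norm_num) (S w) s) := by
    intro w hw
    have h1 := e.right_inv (hηb hw).1
    rw [he] at h1
    have h2 : (e.symm (ι w)).1 = w := congrArg Prod.fst h1
    have h3 : e.symm (ι w) = (w, S w) := Prod.ext h2 rfl
    refine ⟨h3, ?_, fun t => ?_⟩
    · have := (hηb hw).2
      rw [mem_preimage, h3] at this
      exact this
    · rw [h3] at h1
      have h4 := DFunLike.congr_fun (congrArg Prod.snd h1) t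
      simp only [flowEquation, ContinuousMap.sub_apply, ContinuousMap.smul_apply,
        primitiveL_apply, ι, ContinuousMap.zero_apply] at h4
      have h5 := sub_eq_zero.1 h4
      exact (sub_eq_iff_eq_add'.1 h5)
  have one_mem : (1 : ℝ) ∈ Icc (-1 : ℝ) 1 := by norm_num
  have hscale : ∀ w ∈ Metric.ball ((0 : ℝ), x₀) η, ∀ s : Icc (-1 : ℝ) 1,
      ((s : ℝ) * w.1, w.2) ∈ Metric.ball ((0 : ℝ), x₀) η →
      S ((s : ℝ) * w.1, w.2) ⟨1, one_mem⟩ = S w s := by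
    intro w hw s hsw
    have hmul : ∀ t : Icc (-1 : ℝ) 1, (s : ℝ) * t ∈ Icc (-1 : ℝ) 1 := fun t => by
      rw [mem_Icc, ← abs_le, abs_mul]
      exact mul_le_one₀ (abs_le.2 s.2) (abs_nonneg _) (abs_le.2 t.2)
    let b : C(Icc (-1 : ℝ) 1, E) := (S w).comp ⟨fun t => ⟨s * t, hmul t⟩, by fun_prop⟩
    obtain ⟨-, hd, hint⟩ := hS w hw
    obtain ⟨hsy, -, -⟩ := hS _ hsw
    have hbd : dist b c₀ ≤ dist (S w) c₀ := by
      rw [ContinuousMap.dist_le dist_nonneg]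
      exact fun t => ContinuousMap.dist_apply_le_dist (f := S w) (g := c₀) ⟨s * t, hmul t⟩
    have hbsrc : (((s : ℝ) * w.1, w.2), b) ∈ e.source := by
      apply hball
      rw [Metric.mem_ball, Prod.dist_eq, max_lt_iff]
      rw [Prod.dist_eq, max_lt_iff] at hd
      refine ⟨?_, hbd.trans_lt hd.2⟩
      rw [Prod.dist_eq, max_lt_iff] at hd ⊢
      refine ⟨lt_of_le_of_lt ?_ hd.1.1, hd.1.2⟩
      simp only [dist_zero_right, norm_mul, Real.norm_eq_abs]
      exact mul_le_of_le_one_left (abs_nonneg _) (abs_le.2 s.2)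
    have hbeq : e (((s : ℝ) * w.1, w.2), b) = ι ((s : ℝ) * w.1, w.2) := by
      rw [he]
      refine Prod.ext rfl ?_
      ext t
      simp only [flowEquation, ContinuousMap.sub_apply, ContinuousMap.smul_apply,
        primitiveL_apply, ι, ContinuousMap.zero_apply]
      rw [sub_eq_zero, sub_eq_iff_eq_add']
      refine (hint ⟨s * t, hmul t⟩).trans ?_
      change w.2 + _ = w.2 + _
      have hcongr : ∫ r in (0 : ℝ)..t, IccExtend (by norm_num) (f.comp b) r =
          ∫ r in (0 : ℝ)..t, f (IccExtend (by norm_num) (S w) (s * r)) := by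
        refine intervalIntegral.integral_congr fun r hr => ?_
        have hr' : r ∈ Icc (-1 : ℝ) 1 := uIcc_subset_Icc (by norm_num) t.2 hr
        rw [IccExtend_of_mem _ _ hr', IccExtend_of_mem _ _ (hmul ⟨r, hr'⟩)]
        rfl
      rw [hcongr, mul_comm (s : ℝ) w.1, mul_smul, intervalIntegral.smul_integral_comp_mul_left
        (fun r => f (IccExtend (by norm_num) (S w) r)), mul_zero]
    have := e.left_inv hbsrc
    rw [hbeq, hsy] at this
    have h6 : S ((s : ℝ) * w.1, w.2) = b := congrArg Prod.snd this
    rw [h6]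
    simp [b]
  refine ⟨Metric.ball (0, x₀) η, Metric.isOpen_ball, Metric.mem_ball_self hη,
    fun w => S w ⟨1, one_mem⟩, ?_, ?_, ?_⟩
  · have h1 : ContDiffOn ℝ ∞ (fun w => e.symm (ι w)) (Metric.ball (0, x₀) η) :=
      hsymm.comp (by fun_prop) fun w hw => (hηb hw).1
    exact (ContinuousMap.evalCLM ℝ (⟨1, one_mem⟩ : Icc (-1 : ℝ) 1)).contDiff.comp_contDiffOn
      (contDiff_snd.comp_contDiffOn h1)
  · intro x hx
    simpa using (hS _ hx).2.2 ⟨1, one_mem⟩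
  · rintro ⟨t, x⟩ hz
    have hz' := hz
    rw [Metric.mem_ball, Prod.dist_eq, max_lt_iff, dist_zero_right, Real.norm_eq_abs] at hz'
    obtain ⟨ht, hx⟩ := hz'
    obtain ⟨ε, htε, hεη⟩ := exists_between ht
    have hε : 0 < ε := (abs_nonneg _).trans_lt htε
    have hmem : ∀ r, |r| < η → (r, x) ∈ Metric.ball ((0 : ℝ), x₀) η := fun r hr => by
      rw [Metric.mem_ball, Prod.dist_eq, max_lt_iff, dist_zero_right, Real.norm_eq_abs]
      exact ⟨hr, hx⟩
    have hw := hmem ε (by rwa [abs_of_pos hε])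
    have hdiv : ∀ r, |r| < ε → r / ε ∈ Icc (-1 : ℝ) 1 := fun r hr => by
      rw [mem_Icc, ← abs_le, abs_div, abs_of_pos hε]
      exact ((div_lt_one hε).2 hr).le
    have hval : ∀ r (hr : |r| < ε), S (r, x) ⟨1, one_mem⟩ = S (ε, x) ⟨r / ε, hdiv r hr⟩ := by
      intro r hr
      have h1 : r / ε * ε = r := div_mul_cancel₀ r hε.ne'
      have := hscale (ε, x) hw ⟨r / ε, hdiv r hr⟩ (by simpa [h1] using hmem r (hr.trans hεη))
      simpa [h1] using this
    have hev : (fun r => S (r, x) ⟨1, one_mem⟩) =ᶠ[𝓝 t] fun r => x + ε • ∫ s in (0 : ℝ)..(r / ε),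
        f (IccExtend (by norm_num) (S (ε, x)) s) := by
      filter_upwards [(continuous_abs.isOpen_preimage _ isOpen_Iio).mem_nhds htε] with r hr
      rw [hval r hr, (hS _ hw).2.2]
    refine HasDerivAt.congr_of_eventuallyEq ?_ hev
    have hc : Continuous fun s => f (IccExtend (by norm_num) (S (ε, x)) s) :=
      f.continuous.comp (S (ε, x)).continuous.Icc_extend'
    have h1 := (hc.integral_hasStrictDerivAt 0 (t / ε)).hasDerivAt
    have h2 := ((h1.scomp t ((hasDerivAt_id t).div_const ε)).const_smul ε).const_add x
    refine h2.congr_deriv ?_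
    rw [smul_smul, mul_one_div_cancel hε.ne', one_smul, IccExtend_of_mem _ _ (hdiv t htε)]
    simp only [hval t htε]

end Flow

section FlowBox

open Module

theorem exists_contDiff_eqOn_nhds {E F : Type*} [NormedAddCommGroup E] [NormedSpace ℝ E]
    [FiniteDimensional ℝ E] [NormedAddCommGroup F] [NormedSpace ℝ F] {f : E → F} {s : Set E}
    {x₀ : E} (hs : IsOpen s) (hx₀ : x₀ ∈ s) (hf : ContDiffOn ℝ ∞ f s) :
    ∃ g : E → F, ContDiff ℝ ∞ g ∧ ∃ t ⊆ s, IsOpen t ∧ x₀ ∈ t ∧ EqOn g f t := by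
  obtain ⟨r, hr, hrs⟩ := Metric.nhds_basis_closedBall.mem_iff.1 (hs.mem_nhds hx₀)
  let χ : ContDiffBump x₀ := ⟨r / 2, r, by linarith, by linarith⟩
  refine ⟨fun x => χ x • f x, contDiff_iff_contDiffAt.2 fun x => ?_, Metric.ball x₀ (r / 2),
    fun x hx => hrs (Metric.ball_subset_closedBall (Metric.ball_subset_ball (by linarith) hx)),
    Metric.isOpen_ball, Metric.mem_ball_self (by linarith), fun x hx => ?_⟩
  · by_cases hx : x ∈ s
    · exact χ.contDiff.contDiffAt.smul (hf.contDiffAt (hs.mem_nhds hx))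
    · have hx' : x ∉ tsupport χ := by
        rw [χ.tsupport_eq]
        exact fun h => hx (hrs h)
      refine (contDiffAt_const (c := (0 : F))).congr_of_eventuallyEq ?_
      filter_upwards [notMem_tsupport_iff_eventuallyEq.1 hx'] with y hy
      simp [hy]
  · have : χ x = 1 := χ.one_of_mem_closedBall (Metric.ball_subset_closedBall hx)
    simp [this]

/-- Flow box theorem: a smooth vector field is a coordinate vector field near any point where it
does not vanish. -/
theorem exists_flowBox_s2 {E : Type} [NormedAddCommGroup E] [NormedSpace ℝ E]
    [FiniteDimensional ℝ E] {X : E → E} {s : Set E} {x₀ : E} (hs : IsOpen s) (hx₀ : x₀ ∈ s)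
    (hX : ContDiffOn ℝ ∞ X s) (hne : X x₀ ≠ 0) :
    ∃ H : Submodule ℝ E, finrank ℝ H + 1 = finrank ℝ E ∧ ∃ e : OpenPartialHomeomorph (ℝ × H) E,
      0 ∈ e.source ∧ e 0 = x₀ ∧ e.target ⊆ s ∧ ContDiffOn ℝ ∞ e e.source ∧
      ContDiffOn ℝ ∞ e.symm e.target ∧ ∀ z ∈ e.source, fderiv ℝ e z (1, 0) = X (e z) := by
  have := FiniteDimensional.complete ℝ E
  obtain ⟨g, hg, t, hts, hto, hxt, hgX⟩ := exists_contDiff_eqOn_nhds hs hx₀ hX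
  obtain ⟨U, hU, hxU, Φ, hΦ, hΦ0, hΦt⟩ := exists_local_flow ⟨g, hg.continuous⟩ hg x₀
  obtain ⟨H, hH⟩ := Submodule.exists_isCompl (Submodule.span ℝ {X x₀})
  have hfin : finrank ℝ H + 1 = finrank ℝ E := by
    rw [← Submodule.finrank_add_eq_of_isCompl hH, finrank_span_singleton hne, add_comm]
  refine ⟨H, hfin, ?_⟩
  let ι : ℝ × H → ℝ × E := fun z => (z.1, x₀ + z.2)
  have hι : ContDiff ℝ ∞ ι :=
    contDiff_fst.prodMk (contDiff_const.add (H.subtypeL.contDiff.comp contDiff_snd))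
  let Ψ : ℝ × H → E := fun z => Φ (ι z)
  have hΨU : ContDiffOn ℝ ∞ Ψ (ι ⁻¹' U) := hΦ.comp hι.contDiffOn fun _ h => h
  have hV : IsOpen (ι ⁻¹' U) := hU.preimage hι.continuous
  have hι0 : ι 0 = (0, x₀) := by simp [ι]
  have h0V : (0 : ℝ × H) ∈ ι ⁻¹' U := by rw [mem_preimage, hι0]; exact hxU
  have hΨ0 : Ψ 0 = x₀ := by simp only [Ψ, hι0]; exact hΦ0 _ hxU
  have hV' : IsOpen (ι ⁻¹' U ∩ Ψ ⁻¹' t) := hΨU.continuousOn.isOpen_inter_preimage hV hto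
  have hdiff : ∀ z ∈ ι ⁻¹' U, HasFDerivAt Ψ (fderiv ℝ Ψ z) z := fun z hz =>
    ((hΨU.contDiffAt (hV.mem_nhds hz)).differentiableAt (by simp)).hasFDerivAt
  have hdt : ∀ z ∈ ι ⁻¹' U, fderiv ℝ Ψ z (1, 0) = g (Ψ z) := by
    intro z hz
    have h1 : HasDerivAt (fun r : ℝ => (r, z.2)) ((1 : ℝ), (0 : H)) z.1 :=
      (hasDerivAt_id z.1).prodMk (hasDerivAt_const z.1 z.2)
    have h2 : HasDerivAt (fun r : ℝ => Ψ (r, z.2)) (fderiv ℝ Ψ z (1, 0)) z.1 :=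
      HasFDerivAt.comp_hasDerivAt (f := fun r : ℝ => (r, z.2)) z.1 (hdiff z hz) h1
    exact h2.unique (hΦt _ hz)
  have hdh : ∀ h : H, fderiv ℝ Ψ 0 (0, h) = h := by
    intro h
    have h1 : HasFDerivAt (fun y : H => Ψ (0, y))
        ((fderiv ℝ Ψ 0).comp (ContinuousLinearMap.inr ℝ ℝ H)) 0 :=
      HasFDerivAt.comp (f := fun y : H => ((0 : ℝ), y)) (0 : H) (hdiff 0 h0V)
        (ContinuousLinearMap.inr ℝ ℝ H).hasFDerivAt
    have hmem : ∀ᶠ y : H in 𝓝 0, ((0 : ℝ), y) ∈ ι ⁻¹' U :=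
      (ContinuousLinearMap.inr ℝ ℝ H).continuous.continuousAt.eventually_mem (hV.mem_nhds h0V)
    have h2 : HasFDerivAt (fun y : H => Ψ (0, y)) H.subtypeL 0 := by
      refine (H.subtypeL.hasFDerivAt.const_add x₀).congr_of_eventuallyEq ?_
      filter_upwards [hmem] with y hy
      exact hΦ0 _ hy
    simpa using DFunLike.congr_fun (h1.unique h2) h
  have hD : ∀ z : ℝ × H, fderiv ℝ Ψ 0 z = z.1 • X x₀ + z.2 := by
    intro z
    have : z = z.1 • (1, 0) + (0, z.2) := by ext <;> simp
    rw [this, map_add, map_smul, hdt 0 h0V, hdh, hΨ0, hgX hxt]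
    simp
  have hinj : Function.Injective (fderiv ℝ Ψ 0 : ℝ × H →ₗ[ℝ] E) := by
    rw [injective_iff_map_eq_zero]
    intro z hz
    have hz' : z.1 • X x₀ + z.2 = 0 := by rw [← hD]; exact hz
    have h1 : z.1 • X x₀ ∈ H := by
      rw [eq_neg_of_add_eq_zero_left hz']
      exact H.neg_mem z.2.2
    have h2 : z.1 • X x₀ = 0 := (Submodule.disjoint_def.1 hH.disjoint) _
      (Submodule.smul_mem _ _ (Submodule.mem_span_singleton_self _)) h1
    rw [h2, zero_add] at hz'
    exact Prod.ext ((smul_eq_zero.1 h2).resolve_right hne) (Subtype.ext hz')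
  have hrank : finrank ℝ (ℝ × H) = finrank ℝ E := by
    rw [finrank_prod, finrank_self, ← hfin, add_comm]
  let D := (LinearMap.linearEquivOfInjective _ hinj hrank).toContinuousLinearEquiv
  have hDd : HasFDerivAt Ψ (D : ℝ × H →L[ℝ] E) 0 := by
    refine (hdiff 0 h0V).congr_fderiv ?_
    ext z <;> rfl
  obtain ⟨e, he, h0, hsub, hsymm⟩ := exists_openPartialHomeomorph_contDiffOn hV'
    ⟨h0V, by rw [mem_preimage, hΨ0]; exact hxt⟩ (hΨU.mono inter_subset_left) hDd
  refine ⟨e, h0, by rw [he, hΨ0], fun y hy => hts ?_, ?_, hsymm, fun z hz => ?_⟩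
  · have := (hsub (e.map_target hy)).2
    rwa [mem_preimage, ← he, e.right_inv hy] at this
  · rw [he]
    exact hΨU.mono fun z hz => (hsub hz).1
  · rw [he, hdt z (hsub hz).1, hgX (hsub hz).2]

theorem OpenPartialHomeomorph.exists_fderiv_eq_equiv {E F : Type*} [NormedAddCommGroup E]
    [NormedSpace ℝ E] [NormedAddCommGroup F] [NormedSpace ℝ F] (e : OpenPartialHomeomorph E F)
    (h : ContDiffOn ℝ ∞ e e.source) (h' : ContDiffOn ℝ ∞ e.symm e.target) {z : E}
    (hz : z ∈ e.source) : ∃ D : E ≃L[ℝ] F, fderiv ℝ e z = D ∧ fderiv ℝ e.symm (e z) = D.symm := by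
  have h1 := ((h.contDiffAt (e.open_source.mem_nhds hz)).differentiableAt (by simp)).hasFDerivAt
  have h2 := ((h'.contDiffAt (e.open_target.mem_nhds (e.map_source hz))).differentiableAt
    (by simp)).hasFDerivAt
  have h3 : (fderiv ℝ e.symm (e z)).comp (fderiv ℝ e z) = ContinuousLinearMap.id ℝ E :=
    (h2.comp z h1).unique ((hasFDerivAt_id z).congr_of_eventuallyEq
      (e.eventually_left_inverse hz))
  rw [← e.left_inv hz] at h1
  have h4 : (fderiv ℝ e z).comp (fderiv ℝ e.symm (e z)) = ContinuousLinearMap.id ℝ F := by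
    have := (h1.comp (e z) h2).unique ((hasFDerivAt_id (e z)).congr_of_eventuallyEq
      (e.eventually_right_inverse (e.map_source hz)))
    rwa [e.left_inv hz] at this
  exact ⟨ContinuousLinearEquiv.equivOfInverse _ _ (fun x => DFunLike.congr_fun h3 x)
    (fun x => DFunLike.congr_fun h4 x), rfl, rfl⟩

theorem LinearMap.exists_finrank_range_eq_injective_add {E F : Type*} [AddCommGroup E]
    [Module ℝ E] [FiniteDimensional ℝ E] [AddCommGroup F] [Module ℝ F] [FiniteDimensional ℝ F]
    (hEF : finrank ℝ E = finrank ℝ F) (T : E →ₗ[ℝ] F) :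
    ∃ g : E →ₗ[ℝ] F, finrank ℝ (LinearMap.range g) = finrank ℝ (LinearMap.ker T) ∧
      Function.Injective (T + g) := by
  obtain ⟨R, hR⟩ := Submodule.exists_isCompl (LinearMap.range T)
  obtain ⟨P, hP⟩ := (LinearMap.ker T).subtype.exists_leftInverse_of_injective
    (LinearMap.ker T).ker_subtype
  have hdim : finrank ℝ (LinearMap.ker T) = finrank ℝ R := by
    have h1 := Submodule.finrank_add_eq_of_isCompl hR
    have h2 := T.finrank_range_add_finrank_ker
    omega
  let e := LinearEquiv.ofFinrankEq _ _ hdim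
  have hPs : Function.Surjective P := fun y => ⟨y, DFunLike.congr_fun hP y⟩
  have heP : LinearMap.range (e.toLinearMap ∘ₗ P) = ⊤ :=
    LinearMap.range_eq_top.2 (Function.Surjective.comp (g := e) (f := P) e.surjective hPs)
  refine ⟨R.subtype ∘ₗ e.toLinearMap ∘ₗ P, ?_, ?_⟩
  · rw [LinearMap.range_comp_of_range_eq_top _ heP, Submodule.range_subtype, hdim]
  · rw [injective_iff_map_eq_zero]
    intro x hx
    have hx' : T x + (e (P x) : F) = 0 := hx
    have h1 : T x = 0 := by
      refine Submodule.disjoint_def.1 hR.disjoint _ (LinearMap.mem_range_self T x) ?_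
      rw [eq_neg_of_add_eq_zero_left hx']
      exact R.neg_mem (e (P x)).2
    rw [h1, zero_add] at hx'
    have h2 : P x = 0 := e.map_eq_zero_iff.1 (Subtype.ext hx')
    have h3 := DFunLike.congr_fun hP ⟨x, h1⟩
    exact congrArg Subtype.val (h3.symm.trans h2)

end FlowBox

section Forms

open Module

/-- `σ` is a smooth closed 2-form on `s`, given as a field of continuous bilinear forms. -/
structure IsClosedTwoFormOn {E : Type*} [NormedAddCommGroup E] [NormedSpace ℝ E]
    (σ : E → E →L[ℝ] E →L[ℝ] ℝ) (s : Set E) : Prop where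
  contDiffOn : ContDiffOn ℝ ∞ σ s
  skew : ∀ x ∈ s, ∀ u v, σ x u v = -σ x v u
  closed : ∀ x ∈ s, ∀ u v w,
    fderiv ℝ σ x u v w + fderiv ℝ σ x v w u + fderiv ℝ σ x w u v = 0

/-- `σ` is a sum of `N` products `dp ∧ dq` near `x₀`. -/
def HasDarbouxForm {E : Type*} [NormedAddCommGroup E] [NormedSpace ℝ E] (N : ℕ)
    (σ : E → E →L[ℝ] E →L[ℝ] ℝ) (x₀ : E) : Prop :=
  ∃ U : Set E, IsOpen U ∧ x₀ ∈ U ∧ ∃ p q : Fin N → E → ℝ, (∀ i, ContDiffOn ℝ ∞ (p i) U) ∧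
    (∀ i, ContDiffOn ℝ ∞ (q i) U) ∧ ∀ x ∈ U, ∀ u v, σ x u v =
      ∑ i, (fderiv ℝ (p i) x u * fderiv ℝ (q i) x v - fderiv ℝ (p i) x v * fderiv ℝ (q i) x u)

/-- The pullback of a 2-form. -/
noncomputable def pullbackForm {E F : Type*} [NormedAddCommGroup E] [NormedSpace ℝ E]
    [NormedAddCommGroup F] [NormedSpace ℝ F] (σ : E → E →L[ℝ] E →L[ℝ] ℝ) (Ψ : F → E) (z : F) :
    F →L[ℝ] F →L[ℝ] ℝ :=
  (σ (Ψ z)).bilinearComp (fderiv ℝ Ψ z) (fderiv ℝ Ψ z)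

theorem fderiv_apply_apply_apply {E F : Type*} [NormedAddCommGroup E] [NormedSpace ℝ E]
    [NormedAddCommGroup F] [NormedSpace ℝ F] {σ : E → F →L[ℝ] F →L[ℝ] ℝ} {x : E}
    (h : DifferentiableAt ℝ σ x) (w : E) (u v : F) :
    fderiv ℝ σ x w u v = fderiv ℝ (fun y => σ y u v) x w := by
  have h1 := (h.hasFDerivAt.clm_apply (hasFDerivAt_const u x)).clm_apply (hasFDerivAt_const v x)
  rw [h1.fderiv]
  simp

variable {E F : Type*} [NormedAddCommGroup E] [NormedSpace ℝ E] [NormedAddCommGroup F]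
  [NormedSpace ℝ F]

theorem ContinuousLinearMap.contDiff_flip {G : Type*} [NormedAddCommGroup G] [NormedSpace ℝ G] :
    ContDiff ℝ ∞ (fun T : E →L[ℝ] F →L[ℝ] G => T.flip) :=
  IsBoundedLinearMap.contDiff ⟨⟨fun _ _ => rfl, fun _ _ => rfl⟩, 1, one_pos,
    fun T => by rw [T.opNorm_flip, one_mul]⟩

theorem IsClosedTwoFormOn.mono {σ : E → E →L[ℝ] E →L[ℝ] ℝ} {s t : Set E}
    (h : IsClosedTwoFormOn σ s) (hts : t ⊆ s) : IsClosedTwoFormOn σ t :=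
  ⟨h.contDiffOn.mono hts, fun x hx => h.skew x (hts hx), fun x hx => h.closed x (hts hx)⟩

theorem IsClosedTwoFormOn.pullbackForm {σ : E → E →L[ℝ] E →L[ℝ] ℝ} {s : Set E} {t : Set F}
    {Ψ : F → E} (hσ : IsClosedTwoFormOn σ s) (hs : IsOpen s) (ht : IsOpen t)
    (hΨ : ContDiffOn ℝ ∞ Ψ t) (hts : MapsTo Ψ t s) :
    IsClosedTwoFormOn (pullbackForm σ Ψ) t := by
  have hD : ContDiffOn ℝ ∞ (fderiv ℝ Ψ) t := hΨ.fderiv_of_isOpen ht (by simp)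
  have hσΨ : ContDiffOn ℝ ∞ (fun z => σ (Ψ z)) t := hσ.contDiffOn.comp hΨ hts
  have hsmooth : ContDiffOn ℝ ∞ (_root_.pullbackForm σ Ψ) t := by
    exact ContinuousLinearMap.contDiff_flip.comp_contDiffOn
      ((ContinuousLinearMap.contDiff_flip.comp_contDiffOn (hσΨ.clm_comp hD)).clm_comp hD)
  refine ⟨hsmooth, fun z hz u v => hσ.skew _ (hts hz) _ _, fun z hz u v w => ?_⟩
  have htn := ht.mem_nhds hz
  have hdΨ := ((hΨ.contDiffAt htn).differentiableAt (by simp)).hasFDerivAt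
  have hdD := ((hD.contDiffAt htn).differentiableAt (by simp)).hasFDerivAt
  have hdσ := ((hσ.contDiffOn.contDiffAt (hs.mem_nhds (hts hz))).differentiableAt
    (by simp)).hasFDerivAt
  have key : ∀ a b c : F, fderiv ℝ (_root_.pullbackForm σ Ψ) z a b c =
      fderiv ℝ σ (Ψ z) (fderiv ℝ Ψ z a) (fderiv ℝ Ψ z b) (fderiv ℝ Ψ z c)
      + σ (Ψ z) (fderiv ℝ (fderiv ℝ Ψ) z a b) (fderiv ℝ Ψ z c)
      + σ (Ψ z) (fderiv ℝ Ψ z b) (fderiv ℝ (fderiv ℝ Ψ) z a c) := by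
    intro a b c
    rw [fderiv_apply_apply_apply ((hsmooth.contDiffAt htn).differentiableAt (by simp))]
    have h1 := hdD.clm_apply (hasFDerivAt_const b z)
    have h2 := hdD.clm_apply (hasFDerivAt_const c z)
    have h3 := ((hdσ.comp z hdΨ).clm_apply h1).clm_apply h2
    refine (DFunLike.congr_fun h3.fderiv a).trans ?_
    simp
    ring
  have hsymm : ∀ a b, fderiv ℝ (fderiv ℝ Ψ) z a b = fderiv ℝ (fderiv ℝ Ψ) z b a :=
    (hΨ.contDiffAt htn).isSymmSndFDerivAt
      (by simpa using (WithTop.coe_le_coe.2 le_top : (2 : WithTop ℕ∞) ≤ ∞))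
  rw [key, key, key]
  have h1 := hσ.closed (Ψ z) (hts hz) (fderiv ℝ Ψ z u) (fderiv ℝ Ψ z v) (fderiv ℝ Ψ z w)
  have h2 := hσ.skew (Ψ z) (hts hz)
  rw [h2 _ (fderiv ℝ (fderiv ℝ Ψ) z u w), h2 _ (fderiv ℝ (fderiv ℝ Ψ) z v u),
    h2 _ (fderiv ℝ (fderiv ℝ Ψ) z w v), hsymm u w, hsymm v u, hsymm w v]
  linarith

theorem HasDarbouxForm.of_pullback {N : ℕ} {η : F → F →L[ℝ] F →L[ℝ] ℝ}
    {σ : E → E →L[ℝ] E →L[ℝ] ℝ} {π : E → F} {x₀ : E} {V : Set E}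
    (h : HasDarbouxForm N η (π x₀)) (hV : IsOpen V) (hx₀ : x₀ ∈ V) (hπ : ContDiffOn ℝ ∞ π V)
    (hσ : ∀ x ∈ V, ∀ u v, σ x u v = η (π x) (fderiv ℝ π x u) (fderiv ℝ π x v)) :
    HasDarbouxForm N σ x₀ := by
  obtain ⟨U, hU, hxU, p, q, hp, hq, hη⟩ := h
  have hsub : V ∩ π ⁻¹' U ⊆ V := inter_subset_left
  have hmaps : MapsTo π (V ∩ π ⁻¹' U) U := fun _ h => h.2
  refine ⟨V ∩ π ⁻¹' U, hπ.continuousOn.isOpen_inter_preimage hV hU, ⟨hx₀, hxU⟩,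
    fun i => p i ∘ π, fun i => q i ∘ π, fun i => (hp i).comp (hπ.mono hsub) hmaps,
    fun i => (hq i).comp (hπ.mono hsub) hmaps, fun x hx u v => ?_⟩
  have hd : ∀ f : F → ℝ, ContDiffOn ℝ ∞ f U → ∀ w,
      fderiv ℝ (f ∘ π) x w = fderiv ℝ f (π x) (fderiv ℝ π x w) := fun f hf w => by
    rw [fderiv_comp x ((hf.contDiffAt (hU.mem_nhds hx.2)).differentiableAt (by simp))
      ((hπ.contDiffAt (hV.mem_nhds hx.1)).differentiableAt (by simp))]
    rfl
  rw [hσ x hx.1, hη _ hx.2]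
  exact Finset.sum_congr rfl fun i _ => by
    rw [hd _ (hp i), hd _ (hp i), hd _ (hq i), hd _ (hq i)]

theorem IsClosedTwoFormOn.exists_kernel_field [FiniteDimensional ℝ E]
    {σ : E → E →L[ℝ] E →L[ℝ] ℝ} {s : Set E} {k : ℕ} {x₀ : E} (hσ : IsClosedTwoFormOn σ s)
    (hs : IsOpen s) (hx₀ : x₀ ∈ s)
    (hk : ∀ x ∈ s, finrank ℝ (LinearMap.ker (σ x : E →ₗ[ℝ] E →L[ℝ] ℝ)) = k) (hk0 : k ≠ 0) :
    ∃ t ⊆ s, IsOpen t ∧ x₀ ∈ t ∧ ∃ X : E → E, ContDiffOn ℝ ∞ X t ∧ X x₀ ≠ 0 ∧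
      ∀ x ∈ t, σ x (X x) = 0 := by
  have := FiniteDimensional.complete ℝ E
  have hdim : finrank ℝ E = finrank ℝ (E →L[ℝ] ℝ) := by
    rw [← (LinearMap.toContinuousLinearMap (𝕜 := ℝ) (E := E) (F' := ℝ)).finrank_eq]
    exact (Subspace.dual_finrank_eq).symm
  obtain ⟨g, hg, hinj⟩ := LinearMap.exists_finrank_range_eq_injective_add hdim
    (σ x₀ : E →ₗ[ℝ] E →L[ℝ] ℝ)
  rw [hk x₀ hx₀] at hg
  let G : E →L[ℝ] E →L[ℝ] ℝ := LinearMap.toContinuousLinearMap g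
  let M₀ := (LinearMap.linearEquivOfInjective _ hinj hdim).toContinuousLinearEquiv
  have hM₀ : (M₀ : E →L[ℝ] E →L[ℝ] ℝ) = σ x₀ + G := by ext; rfl
  obtain ⟨v₀, hv₀⟩ : ∃ v₀ : LinearMap.ker (σ x₀ : E →ₗ[ℝ] E →L[ℝ] ℝ), v₀ ≠ 0 := by
    have : Nontrivial (LinearMap.ker (σ x₀ : E →ₗ[ℝ] E →L[ℝ] ℝ)) :=
      Module.nontrivial_of_finrank_pos (R := ℝ) (by rw [hk x₀ hx₀]; omega)
    exact exists_ne 0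
  have hv₀k : σ x₀ v₀ = 0 := v₀.2
  have hMs : ContDiffOn ℝ ∞ (fun x => σ x + G) s := hσ.contDiffOn.add contDiffOn_const
  let t := s ∩ (fun x => σ x + G) ⁻¹' range ((↑) : (E ≃L[ℝ] (E →L[ℝ] ℝ)) → E →L[ℝ] E →L[ℝ] ℝ)
  refine ⟨t, inter_subset_left,
    hMs.continuousOn.isOpen_inter_preimage hs ContinuousLinearEquiv.isOpen,
    ⟨hx₀, M₀, hM₀⟩, fun x => (σ x + G).inverse (G v₀), ?_, ?_, ?_⟩
  · rintro x ⟨hx, M, hM⟩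
    have h1 : ContDiffAt ℝ ∞ (fun x => σ x + G) x := hMs.contDiffAt (hs.mem_nhds hx)
    have h2 : ContDiffAt ℝ ∞ ContinuousLinearMap.inverse (σ x + G) := by
      rw [show σ x + G = M from hM.symm]
      exact contDiffAt_map_inverse M
    exact ((h2.comp x h1).clm_apply contDiffAt_const).contDiffWithinAt
  · have h1 : G v₀ = M₀ v₀ := by
      have := DFunLike.congr_fun hM₀ (v₀ : E)
      simpa [hv₀k] using this.symm
    simp only [← hM₀, ContinuousLinearMap.inverse_equiv, h1]
    simpa using hv₀
  · rintro x ⟨hx, M, hM⟩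
    have hMy : ∀ y, M y = σ x y + G y := fun y => DFunLike.congr_fun hM y
    set K := LinearMap.ker (σ x : E →ₗ[ℝ] E →L[ℝ] ℝ)
    have hKinj : Function.Injective (g.domRestrict K) := by
      rw [injective_iff_map_eq_zero]
      intro y hy
      have h1 : σ x y = 0 := y.2
      have h2 : M y = 0 := by rw [hMy, h1, zero_add]; exact hy
      exact Subtype.ext (M.map_eq_zero_iff.1 h2)
    have hrange : LinearMap.range (g.domRestrict K) = LinearMap.range g := by
      refine Submodule.eq_of_le_of_finrank_eq ?_ ?_
      · rintro _ ⟨y, rfl⟩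
        exact ⟨y, rfl⟩
      · rw [LinearMap.finrank_range_of_inj hKinj, hg, hk x hx]
    obtain ⟨y, hy⟩ : g v₀ ∈ LinearMap.range (g.domRestrict K) := hrange ▸ ⟨_, rfl⟩
    have hy0 : σ x y = 0 := y.2
    have hyM : G v₀ = M y := by rw [hMy, hy0, zero_add]; exact hy.symm
    simp only [← hM, ContinuousLinearMap.inverse_equiv, hyM]
    simp [hy0]

end Forms

section Degenerate

open Module

theorem IsClosedTwoFormOn.fderiv_eq_zero {E : Type*} [NormedAddCommGroup E] [NormedSpace ℝ E]
    {σ : E → E →L[ℝ] E →L[ℝ] ℝ} {s : Set E} (hσ : IsClosedTwoFormOn σ s) (hs : IsOpen s) {c : E}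
    (hc : ∀ x ∈ s, σ x c = 0) {x : E} (hx : x ∈ s) : fderiv ℝ σ x c = 0 := by
  have hd := (hσ.contDiffOn.contDiffAt (hs.mem_nhds hx)).differentiableAt (by simp)
  ext u v
  have h := hσ.closed x hx c u v
  have h1 : (fun y => σ y c u) =ᶠ[𝓝 x] fun _ => 0 := by
    filter_upwards [hs.mem_nhds hx] with y hy
    rw [hc y hy]
    rfl
  have h2 : (fun y => σ y v c) =ᶠ[𝓝 x] fun _ => 0 := by
    filter_upwards [hs.mem_nhds hx] with y hy
    rw [hσ.skew y hy, hc y hy]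
    exact neg_zero
  rw [fderiv_apply_apply_apply hd u, fderiv_apply_apply_apply hd v, h1.fderiv_eq, h2.fderiv_eq]
    at h
  simpa using h

/-- The Darboux theorem for closed 2-forms on `n`-dimensional spaces whose kernels have constant
dimension `k`. -/
def DarbouxStatement (n k : ℕ) : Prop :=
  ∀ (E : Type) [NormedAddCommGroup E] [NormedSpace ℝ E] [FiniteDimensional ℝ E]
    (σ : E → E →L[ℝ] E →L[ℝ] ℝ) (s : Set E) (x₀ : E), finrank ℝ E = n → IsOpen s → x₀ ∈ s →
    IsClosedTwoFormOn σ s →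
    (∀ x ∈ s, finrank ℝ (LinearMap.ker (σ x : E →ₗ[ℝ] E →L[ℝ] ℝ)) = k) →
    ∃ N, 2 * N + k = n ∧ HasDarbouxForm N σ x₀

theorem finrank_ker_bilinearComp_equiv {E F : Type*} [NormedAddCommGroup E] [NormedSpace ℝ E]
    [NormedAddCommGroup F] [NormedSpace ℝ F] (β : E →L[ℝ] E →L[ℝ] ℝ) (D : F ≃L[ℝ] E) :
    finrank ℝ (LinearMap.ker
      (β.bilinearComp (D : F →L[ℝ] E) (D : F →L[ℝ] E) : F →ₗ[ℝ] F →L[ℝ] ℝ)) =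
      finrank ℝ (LinearMap.ker (β : E →ₗ[ℝ] E →L[ℝ] ℝ)) := by
  have h : (LinearMap.ker (β.bilinearComp (D : F →L[ℝ] E) (D : F →L[ℝ] E) :
      F →ₗ[ℝ] F →L[ℝ] ℝ)).map D.toLinearEquiv.toLinearMap =
      LinearMap.ker (β : E →ₗ[ℝ] E →L[ℝ] ℝ) := by
    ext u
    rw [Submodule.mem_map_equiv, LinearMap.mem_ker, LinearMap.mem_ker]
    constructor
    · intro hu
      ext v
      simpa using DFunLike.congr_fun hu (D.symm v)
    · intro hu
      have hu' : β u = 0 := hu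
      ext v
      simp [hu']
  rw [← h, LinearEquiv.finrank_map_eq]

theorem finrank_ker_of_apply_eq_snd {H : Type*} [NormedAddCommGroup H] [NormedSpace ℝ H]
    [FiniteDimensional ℝ H] {β : ℝ × H →L[ℝ] ℝ × H →L[ℝ] ℝ} {γ : H →L[ℝ] H →L[ℝ] ℝ}
    (h : ∀ u v, β u v = γ u.2 v.2) :
    finrank ℝ (LinearMap.ker (β : ℝ × H →ₗ[ℝ] ℝ × H →L[ℝ] ℝ)) =
      finrank ℝ (LinearMap.ker (γ : H →ₗ[ℝ] H →L[ℝ] ℝ)) + 1 := by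
  have hker : ∀ u, β u = 0 ↔ γ u.2 = 0 := fun u => by
    refine ⟨fun hu => ContinuousLinearMap.ext fun v => ?_,
      fun hu => ContinuousLinearMap.ext fun v => ?_⟩
    · have := h u (0, v)
      rw [hu] at this
      exact this.symm
    · rw [h, hu]
      rfl
  let L : LinearMap.ker (β : ℝ × H →ₗ[ℝ] ℝ × H →L[ℝ] ℝ) ≃ₗ[ℝ]
      ℝ × LinearMap.ker (γ : H →ₗ[ℝ] H →L[ℝ] ℝ) :=
    { toFun := fun u => (u.1.1, ⟨u.1.2, (hker u.1).1 u.2⟩)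
      invFun := fun u => ⟨(u.1, u.2.1), (hker _).2 u.2.2⟩
      map_add' := fun _ _ => rfl
      map_smul' := fun _ _ => rfl
      left_inv := fun _ => rfl
      right_inv := fun _ => rfl }
  rw [L.finrank_eq, finrank_prod, finrank_self, add_comm]

/-- A closed form on a cylinder which is annihilated by the axis direction is pulled back from the
base. -/
theorem IsClosedTwoFormOn.eq_pullback_snd {H : Type*} [NormedAddCommGroup H] [NormedSpace ℝ H]
    {τ : ℝ × H → ℝ × H →L[ℝ] ℝ × H →L[ℝ] ℝ} {r : ℝ} (hr : 0 < r)
    (hτ : IsClosedTwoFormOn τ (Metric.ball 0 r))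
    (hτ0 : ∀ z ∈ Metric.ball 0 r, τ z (1, 0) = 0) :
    ∃ η : H → H →L[ℝ] H →L[ℝ] ℝ, IsClosedTwoFormOn η (Metric.ball 0 r) ∧
      ∀ z ∈ Metric.ball 0 r, ∀ u v, τ z u v = η z.2 u.2 v.2 := by
  have hball : ∀ z : ℝ × H,
      z ∈ Metric.ball 0 r ↔ z.1 ∈ Metric.ball 0 r ∧ z.2 ∈ Metric.ball 0 r := fun z => by
    rw [show (0 : ℝ × H) = (0, 0) from rfl, ← ball_prod_same]
    rfl
  have h0r : (0 : ℝ) ∈ Metric.ball 0 r := Metric.mem_ball_self hr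
  have hconst : ∀ z ∈ Metric.ball 0 r, τ z = τ (0, z.2) := by
    intro z hz
    obtain ⟨hz1, hz2⟩ := (hball z).1 hz
    have hd : ∀ a ∈ Metric.ball (0 : ℝ) r, HasDerivAt (fun a => τ (a, z.2)) 0 a := by
      intro a ha
      have haz : (a, z.2) ∈ Metric.ball 0 r := (hball _).2 ⟨ha, hz2⟩
      have h1 : HasDerivAt (fun a : ℝ => (a, z.2)) ((1 : ℝ), (0 : H)) a :=
        (hasDerivAt_id a).prodMk (hasDerivAt_const a z.2)
      have h2 := ((hτ.contDiffOn.contDiffAt (Metric.isOpen_ball.mem_nhds haz)).differentiableAt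
        (by simp)).hasFDerivAt
      have h3 := HasFDerivAt.comp_hasDerivAt (f := fun a : ℝ => (a, z.2)) a h2 h1
      rwa [hτ.fderiv_eq_zero Metric.isOpen_ball hτ0 haz] at h3
    exact Metric.isOpen_ball.is_const_of_deriv_eq_zero (f := fun a => τ (a, z.2))
      (convex_ball (0 : ℝ) r).isPreconnected
      (fun a ha => (hd a ha).differentiableAt.differentiableWithinAt)
      (fun a ha => (hd a ha).deriv) hz1 h0r
  refine ⟨_root_.pullbackForm τ (ContinuousLinearMap.inr ℝ ℝ H),
    hτ.pullbackForm Metric.isOpen_ball Metric.isOpen_ball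
      (ContinuousLinearMap.inr ℝ ℝ H).contDiff.contDiffOn fun h hh => (hball _).2 ⟨h0r, hh⟩,
    fun z hz u v => ?_⟩
  have hz' : ((0 : ℝ), z.2) ∈ Metric.ball 0 r := (hball _).2 ⟨h0r, ((hball z).1 hz).2⟩
  have h1 : _root_.pullbackForm τ (ContinuousLinearMap.inr ℝ ℝ H) z.2 u.2 v.2 =
      τ (0, z.2) (0, u.2) (0, v.2) := by
    simp [_root_.pullbackForm]
  have h2 : ∀ w : ℝ × H, w = w.1 • (1, 0) + (0, w.2) := fun w => by ext <;> simp
  have h3 : ∀ w, τ (0, z.2) w = τ (0, z.2) (0, w.2) := fun w => by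
    conv_lhs => rw [h2 w]
    rw [map_add, map_smul, hτ0 _ hz', smul_zero, zero_add]
  rw [h1, hconst z hz, h3 u, hτ.skew _ hz', h3 v, ← hτ.skew _ hz']

theorem DarbouxStatement.of_kernel {n k : ℕ} (ih : DarbouxStatement n k) :
    DarbouxStatement (n + 1) (k + 1) := by
  intro E _ _ _ σ s x₀ hn hs hx₀ hσ hk
  obtain ⟨t, hts, hto, hxt, X, hX, hX0, hσX⟩ := hσ.exists_kernel_field hs hx₀ hk (by omega)
  obtain ⟨H, hH, e, h0, he0, het, he, hes, heX⟩ := exists_flowBox_s2 hto hxt hX hX0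
  obtain ⟨r, hr, hrB⟩ := Metric.isOpen_iff.1 e.open_source 0 h0
  have hes' : ∀ z ∈ e.source, e z ∈ s := fun z hz => hts (het (e.map_source hz))
  obtain ⟨η, hη, hτη⟩ := ((hσ.pullbackForm hs e.open_source he hes').mono hrB).eq_pullback_snd hr
    fun z hz => by
      refine ContinuousLinearMap.ext fun v => ?_
      change σ (e z) (fderiv ℝ e z (1, 0)) (fderiv ℝ e z v) = 0
      rw [heX z (hrB hz), hσX _ (het (e.map_source (hrB hz)))]
      rfl
  have hker : ∀ h ∈ Metric.ball 0 r,
      finrank ℝ (LinearMap.ker (η h : H →ₗ[ℝ] H →L[ℝ] ℝ)) = k := by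
    intro h hh
    have hz : ((0 : ℝ), h) ∈ Metric.ball 0 r := by
      rw [show (0 : ℝ × H) = (0, 0) from rfl, ← ball_prod_same]
      exact ⟨Metric.mem_ball_self hr, hh⟩
    obtain ⟨D, hD, -⟩ := e.exists_fderiv_eq_equiv he hes (hrB hz)
    have h1 := finrank_ker_of_apply_eq_snd (hτη _ hz)
    rw [pullbackForm, hD, finrank_ker_bilinearComp_equiv, hk _ (hes' _ (hrB hz))] at h1
    exact (Nat.succ_injective h1).symm
  obtain ⟨N, hN, hdar⟩ := ih H η (Metric.ball 0 r) 0 (by omega) Metric.isOpen_ball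
    (Metric.mem_ball_self hr) hη hker
  have hes0 : e.symm x₀ = 0 := by rw [← he0, e.left_inv h0]
  have hx₀e : x₀ ∈ e.target := he0 ▸ e.map_source h0
  refine ⟨N, by omega, HasDarbouxForm.of_pullback (π := fun x => (e.symm x).2)
    (V := e.target ∩ e.symm ⁻¹' Metric.ball 0 r) (by simpa [hes0] using hdar)
    (e.symm.isOpen_inter_preimage Metric.isOpen_ball)
    ⟨hx₀e, by rw [mem_preimage, hes0]; exact Metric.mem_ball_self hr⟩
    (contDiff_snd.comp_contDiffOn (hes.mono inter_subset_left)) ?_⟩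
  rintro x ⟨hx, hxr⟩ u v
  have hxs := e.map_target hx
  obtain ⟨D, hD, hDs⟩ := e.exists_fderiv_eq_equiv he hes hxs
  rw [e.right_inv hx] at hDs
  have hπ : ∀ w, fderiv ℝ (fun x => (e.symm x).2) x w = (D.symm w).2 := by
    intro w
    have h1 := ((hes.contDiffAt (e.open_target.mem_nhds hx)).differentiableAt
      (by simp)).hasFDerivAt.snd
    rw [h1.fderiv, hDs]
    rfl
  rw [hπ, hπ, ← hτη _ hxr]
  simp [pullbackForm, hD, e.right_inv hx]

end Degenerate

section Symplectic

open Module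

theorem finrank_ker_add_smulRight_sub_smulRight {E : Type*} [NormedAddCommGroup E]
    [NormedSpace ℝ E] {β : E →L[ℝ] E →L[ℝ] ℝ} (hinj : ∀ u, β u = 0 → u = 0)
    (hskew : ∀ u v, β u v = -β v u) {X Y : E} {ℓ d : E →L[ℝ] ℝ} (hX : β X = ℓ) (hY : β Y = d)
    (hdX : d X = 1) :
    finrank ℝ (LinearMap.ker
      (β + ℓ.smulRight d - d.smulRight ℓ : E →ₗ[ℝ] E →L[ℝ] ℝ)) = 2 := by
  have hself : ∀ u, β u u = 0 := fun u => by linarith [hskew u u]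
  have hℓX : ℓ X = 0 := hX ▸ hself X
  have hdY : d Y = 0 := hY ▸ hself Y
  have hℓY : ℓ Y = -1 := by rw [← hX, hskew, hY, hdX]
  have happ : ∀ u, (β + ℓ.smulRight d - d.smulRight ℓ) u = β (u + ℓ u • Y - d u • X) := fun u => by
    simp [hX, hY]
  let L : LinearMap.ker (β + ℓ.smulRight d - d.smulRight ℓ : E →ₗ[ℝ] E →L[ℝ] ℝ) ≃ₗ[ℝ] ℝ × ℝ :=
    { toFun := fun u => (d u, ℓ u)
      invFun := fun c => ⟨c.1 • X - c.2 • Y, by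
        refine (happ _).trans ?_
        rw [show c.1 • X - c.2 • Y + ℓ (c.1 • X - c.2 • Y) • Y - d (c.1 • X - c.2 • Y) • X = 0 by
          simp [hℓX, hdY, hℓY, hdX], map_zero]⟩
      map_add' := fun _ _ => by simp
      map_smul' := fun _ _ => by simp
      left_inv := fun u => by
        have h := hinj _ ((happ u).symm.trans u.2)
        refine Subtype.ext ?_
        change d u • X - ℓ u • Y = u
        rw [← sub_eq_zero, ← neg_eq_zero, ← h]
        abel
      right_inv := fun c => by simp [hℓX, hdY, hℓY, hdX] }
  rw [L.finrank_eq, finrank_prod, finrank_self]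

theorem IsClosedTwoFormOn.add_smulRight_sub_smulRight {E : Type*} [NormedAddCommGroup E]
    [NormedSpace ℝ E] {σ : E → E →L[ℝ] E →L[ℝ] ℝ} {t : Set E} (hσ : IsClosedTwoFormOn σ t)
    (ht : IsOpen t) {q : E → ℝ} (hq : ContDiffOn ℝ ∞ q t) (ℓ : E →L[ℝ] ℝ) :
    IsClosedTwoFormOn
      (fun x => σ x + ℓ.smulRight (fderiv ℝ q x) - (fderiv ℝ q x).smulRight ℓ) t := by
  have hdq : ContDiffOn ℝ ∞ (fderiv ℝ q) t := hq.fderiv_of_isOpen ht (by simp)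
  have hsmooth : ContDiffOn ℝ ∞
      (fun x => σ x + ℓ.smulRight (fderiv ℝ q x) - (fderiv ℝ q x).smulRight ℓ) t :=
    (hσ.contDiffOn.add (contDiffOn_const.smulRight hdq)).sub (hdq.smulRight contDiffOn_const)
  refine ⟨hsmooth, fun x hx u v => ?_, fun x hx u v w => ?_⟩
  · simp [hσ.skew x hx u v]
    ring
  have htn := ht.mem_nhds hx
  have hddq := ((hdq.contDiffAt htn).differentiableAt (by simp)).hasFDerivAt
  have hdσ := ((hσ.contDiffOn.contDiffAt htn).differentiableAt (by simp))
  have key : ∀ a b c : E, fderiv ℝ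
      (fun x => σ x + ℓ.smulRight (fderiv ℝ q x) - (fderiv ℝ q x).smulRight ℓ) x a b c =
      fderiv ℝ σ x a b c + ℓ b * fderiv ℝ (fderiv ℝ q) x a c
        - fderiv ℝ (fderiv ℝ q) x a b * ℓ c := by
    intro a b c
    rw [fderiv_apply_apply_apply ((hsmooth.contDiffAt htn).differentiableAt (by simp))]
    have h1 := (hdσ.hasFDerivAt.clm_apply (hasFDerivAt_const b x)).clm_apply (hasFDerivAt_const c x)
    have h2 := (hddq.clm_apply (hasFDerivAt_const c x)).const_mul (ℓ b)
    have h3 := (hddq.clm_apply (hasFDerivAt_const b x)).mul_const (ℓ c)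
    refine (DFunLike.congr_fun ((h1.add h2).sub h3).fderiv a).trans ?_
    simp
    ring
  have hsymm : ∀ a b, fderiv ℝ (fderiv ℝ q) x a b = fderiv ℝ (fderiv ℝ q) x b a :=
    (hq.contDiffAt htn).isSymmSndFDerivAt
      (by simpa using (WithTop.coe_le_coe.2 le_top : (2 : WithTop ℕ∞) ≤ ∞))
  rw [key, key, key, hsymm u w, hsymm v u, hsymm w v]
  linarith [hσ.closed x hx u v w]

theorem HasDarbouxForm.of_add_smulRight_sub_smulRight {E : Type*} [NormedAddCommGroup E]
    [NormedSpace ℝ E] {σ : E → E →L[ℝ] E →L[ℝ] ℝ} {t : Set E} (ht : IsOpen t) {x₀ : E}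
    (hx₀ : x₀ ∈ t) {q : E → ℝ} (hq : ContDiffOn ℝ ∞ q t) (ℓ : E →L[ℝ] ℝ) {N : ℕ}
    (h : HasDarbouxForm N
      (fun x => σ x + ℓ.smulRight (fderiv ℝ q x) - (fderiv ℝ q x).smulRight ℓ) x₀) :
    HasDarbouxForm (N + 1) σ x₀ := by
  obtain ⟨U, hU, hxU, P, Q, hP, hQ, hPQ⟩ := h
  refine ⟨U ∩ t, hU.inter ht, ⟨hxU, hx₀⟩, Fin.cons q P, Fin.cons ℓ Q, ?_, ?_, fun x hx u v => ?_⟩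
  · refine Fin.cases ?_ fun i => ?_
    · exact hq.mono inter_subset_right
    · exact (hP i).mono inter_subset_left
  · refine Fin.cases ?_ fun i => ?_
    · exact ℓ.contDiff.contDiffOn
    · exact (hQ i).mono inter_subset_left
  · rw [Fin.sum_univ_succ]
    simp only [Fin.cons_zero, Fin.cons_succ]
    rw [← hPQ x hx.1 u v]
    simp
    ring

theorem DarbouxStatement.of_nondegenerate {n : ℕ} (ih : DarbouxStatement (n + 1) 2) :
    DarbouxStatement (n + 1) 0 := by
  intro E _ _ _ σ s x₀ hn hs hx₀ hσ hk
  have := FiniteDimensional.complete ℝ E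
  have hdim : finrank ℝ E = finrank ℝ (E →L[ℝ] ℝ) := by
    rw [← (LinearMap.toContinuousLinearMap (𝕜 := ℝ) (E := E) (F' := ℝ)).finrank_eq]
    exact (Subspace.dual_finrank_eq).symm
  have hinj : ∀ x ∈ s, ∀ u, σ x u = 0 → u = 0 := fun x hx u hu => by
    have h : u ∈ LinearMap.ker (σ x : E →ₗ[ℝ] E →L[ℝ] ℝ) := hu
    rwa [Submodule.finrank_eq_zero.1 (hk x hx), Submodule.mem_bot] at h
  have hequiv : ∀ x ∈ s, ∃ M : E ≃L[ℝ] E →L[ℝ] ℝ, (M : E →L[ℝ] E →L[ℝ] ℝ) = σ x := fun x hx =>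
    ⟨(LinearMap.linearEquivOfInjective (σ x : E →ₗ[ℝ] E →L[ℝ] ℝ)
      ((injective_iff_map_eq_zero _).2 (hinj x hx)) hdim).toContinuousLinearEquiv,
      by ext; rfl⟩
  have : Nontrivial E := Module.nontrivial_of_finrank_pos (R := ℝ) (by omega)
  obtain ⟨v, hv⟩ := exists_ne (0 : E)
  set ℓ := σ x₀ v with hℓ
  have hsolve : ∀ x ∈ s, ∀ f, σ x ((σ x).inverse f) = f := fun x hx f => by
    obtain ⟨M, hM⟩ := hequiv x hx
    simp [← hM]
  have hX : ContDiffOn ℝ ∞ (fun x => (σ x).inverse ℓ) s := fun x hx => by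
    obtain ⟨M, hM⟩ := hequiv x hx
    have h2 : ContDiffAt ℝ ∞ ContinuousLinearMap.inverse (σ x) := by
      rw [← hM]
      exact contDiffAt_map_inverse M
    exact ((h2.comp x (hσ.contDiffOn.contDiffAt (hs.mem_nhds hx))).clm_apply
      contDiffAt_const).contDiffWithinAt
  have hX0 : (σ x₀).inverse ℓ ≠ 0 := fun h => by
    have := hsolve x₀ hx₀ ℓ
    rw [h, map_zero] at this
    exact hv (hinj x₀ hx₀ v this.symm)
  obtain ⟨H, hH, e, h0, he0, het, he, hes, heX⟩ := exists_flowBox_s2 hs hx₀ hX hX0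
  have hx₀e : x₀ ∈ e.target := he0 ▸ e.map_source h0
  have hq : ContDiffOn ℝ ∞ (fun x => (e.symm x).1) e.target := contDiff_fst.comp_contDiffOn hes
  have hqX : ∀ x ∈ e.target, fderiv ℝ (fun x => (e.symm x).1) x ((σ x).inverse ℓ) = 1 := by
    intro x hx
    have hxs := e.map_target hx
    obtain ⟨D, hD, hDs⟩ := e.exists_fderiv_eq_equiv he hes hxs
    have hD1 := heX _ hxs
    rw [e.right_inv hx] at hDs hD1
    have h1 := ((hes.contDiffAt (e.open_target.mem_nhds hx)).differentiableAt
      (by simp)).hasFDerivAt.fst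
    rw [h1.fderiv, hDs, ← hD1, hD]
    simp
  obtain ⟨N, hN, hdar⟩ := ih E _ e.target x₀ hn e.open_target hx₀e
    ((hσ.mono het).add_smulRight_sub_smulRight e.open_target hq ℓ) fun x hx =>
      finrank_ker_add_smulRight_sub_smulRight (hinj x (het hx)) (hσ.skew x (het hx))
        (hsolve x (het hx) ℓ) (hsolve x (het hx) _) (hqX x hx)
  exact ⟨N + 1, by omega, hdar.of_add_smulRight_sub_smulRight e.open_target hx₀e hq ℓ⟩

theorem darbouxStatement (n k : ℕ) : DarbouxStatement n k := by
  induction n generalizing k with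
  | zero =>
    intro E _ _ _ σ s x₀ hn hs hx₀ hσ hk
    have h1 := Submodule.finrank_le (LinearMap.ker (σ x₀ : E →ₗ[ℝ] E →L[ℝ] ℝ))
    rw [hk x₀ hx₀, hn] at h1
    have := finrank_zero_iff.1 hn
    exact ⟨0, by omega, univ, isOpen_univ, mem_univ _, Fin.elim0, Fin.elim0, fun i => i.elim0,
      fun i => i.elim0, fun x _ u v => by simp [Subsingleton.elim u 0]⟩
  | succ n ih =>
    cases k with
    | zero => exact (ih 1).of_kernel.of_nondegenerate
    | succ k => exact (ih k).of_kernel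

end Symplectic

section Coordinates

open Module

/-- The bilinear form with coefficient matrix `A`. -/
noncomputable def coordForm {n : ℕ} (A : Fin n → Fin n → ℝ) :
    (Fin n → ℝ) →L[ℝ] (Fin n → ℝ) →L[ℝ] ℝ :=
  ∑ i, ∑ j, A i j • (ContinuousLinearMap.proj (R := ℝ) (φ := fun _ : Fin n => ℝ) i).smulRight
    (ContinuousLinearMap.proj (R := ℝ) (φ := fun _ : Fin n => ℝ) j)

theorem coordForm_apply {n : ℕ} (A : Fin n → Fin n → ℝ) (u v : Fin n → ℝ) :
    coordForm A u v = ∑ i, ∑ j, A i j * (u i * v j) := by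
  simp [coordForm]

theorem coordForm_single_single {n : ℕ} (A : Fin n → Fin n → ℝ) (c d : Fin n) :
    coordForm A (Pi.single c 1) (Pi.single d 1) = A c d := by
  simp [coordForm_apply, Pi.single_apply]

theorem finrank_ker_coordForm {n : ℕ} (A : Fin n → Fin n → ℝ) :
    (Matrix.of A).rank + finrank ℝ (LinearMap.ker
      (coordForm A : (Fin n → ℝ) →ₗ[ℝ] (Fin n → ℝ) →L[ℝ] ℝ)) = n := by
  have h : LinearMap.ker (coordForm A : (Fin n → ℝ) →ₗ[ℝ] (Fin n → ℝ) →L[ℝ] ℝ) =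
      LinearMap.ker (Matrix.of A).transpose.mulVecLin := by
    have happ : ∀ u v, coordForm A u v = (Matrix.of A).transpose.mulVec u ⬝ᵥ v := fun u v => by
      rw [coordForm_apply, Finset.sum_comm]
      simp only [dotProduct, Matrix.mulVec, Finset.sum_mul, Matrix.transpose_apply,
        Matrix.of_apply, mul_assoc]
    ext u
    rw [LinearMap.mem_ker, LinearMap.mem_ker, Matrix.mulVecLin_apply]
    constructor
    · intro hu
      have hu' : coordForm A u = 0 := hu
      refine dotProduct_eq_zero _ fun v => ?_
      rw [← happ, hu']
      rfl
    · intro hu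
      refine ContinuousLinearMap.ext fun v => (happ u v).trans ?_
      rw [hu, zero_dotProduct]
      rfl
  rw [h, ← Matrix.rank_transpose, Matrix.rank, LinearMap.finrank_range_add_finrank_ker,
    finrank_fin_fun]

theorem fderiv_eq_sum_pd {n : ℕ} (f : (Fin n → ℝ) → ℝ) (x u : Fin n → ℝ) :
    fderiv ℝ f x u = ∑ i, u i * pd i f x := by
  conv_lhs => rw [pi_eq_sum_univ' u]
  simp only [map_sum, map_smul, smul_eq_mul, pd]

theorem Finset.sum_rotate {n : ℕ} (f : Fin n → Fin n → Fin n → ℝ) :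
    ∑ i, ∑ j, ∑ k, f i j k = ∑ k, ∑ i, ∑ j, f i j k := by
  rw [Finset.sum_comm (f := fun k i => ∑ j, f i j k)]
  exact Finset.sum_congr rfl fun i _ => Finset.sum_comm

theorem isClosedTwoFormOn_coordForm {n : ℕ} {om : (Fin n → ℝ) → Fin n → Fin n → ℝ}
    {Ω : Set (Fin n → ℝ)} (hΩ : IsOpen Ω) (hsmooth : ∀ i j, ContDiffOn ℝ ∞ (fun x => om x i j) Ω)
    (hskew : ∀ x, ∀ i j, om x i j = -om x j i)
    (hclosed : ∀ x ∈ Ω, ∀ i j k, pd k (fun y => om y i j) x + pd i (fun y => om y j k) x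
      + pd j (fun y => om y k i) x = 0) :
    IsClosedTwoFormOn (fun x => coordForm (om x)) Ω := by
  have hs : ContDiffOn ℝ ∞ (fun x => coordForm (om x)) Ω := by
    refine contDiffOn_clm_apply.2 fun u => contDiffOn_clm_apply.2 fun v => ?_
    simp only [coordForm_apply]
    exact ContDiffOn.sum fun i _ => ContDiffOn.sum fun j _ => (hsmooth i j).mul contDiffOn_const
  refine ⟨hs, fun x _ u v => ?_, fun x hx u v w => ?_⟩
  · rw [coordForm_apply, coordForm_apply, Finset.sum_comm, ← Finset.sum_neg_distrib]
    refine Finset.sum_congr rfl fun i _ => ?_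
    rw [← Finset.sum_neg_distrib]
    refine Finset.sum_congr rfl fun j _ => ?_
    rw [hskew x j i]
    ring
  have hxn := hΩ.mem_nhds hx
  have key : ∀ a b c : Fin n → ℝ, fderiv ℝ (fun x => coordForm (om x)) x a b c =
      ∑ i, ∑ j, ∑ k, a i * b j * c k * pd i (fun y => om y j k) x := by
    intro a b c
    rw [fderiv_apply_apply_apply ((hs.contDiffAt hxn).differentiableAt (by simp))]
    simp only [coordForm_apply]
    have h1 := HasFDerivAt.fun_sum (u := Finset.univ) fun j _ =>
      HasFDerivAt.fun_sum (u := Finset.univ) fun k _ =>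
      ((((hsmooth j k).contDiffAt hxn).differentiableAt (by simp)).hasFDerivAt.mul_const
        (b j * c k))
    rw [h1.fderiv]
    simp only [sum_apply, smul_apply, fderiv_eq_sum_pd,
      smul_eq_mul, Finset.mul_sum]
    rw [Finset.sum_rotate]
    exact Finset.sum_congr rfl fun i _ => Finset.sum_congr rfl fun j _ =>
      Finset.sum_congr rfl fun k _ => by ring
  rw [key, key, key]
  have h2 : ∑ i, ∑ j, ∑ k, v i * w j * u k * pd i (fun y => om y j k) x =
      ∑ i, ∑ j, ∑ k, u i * v j * w k * pd j (fun y => om y k i) x := by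
    rw [Finset.sum_rotate]
    exact Finset.sum_congr rfl fun i _ => Finset.sum_congr rfl fun j _ =>
      Finset.sum_congr rfl fun k _ => by ring
  have h3 : ∑ i, ∑ j, ∑ k, w i * u j * v k * pd i (fun y => om y j k) x =
      ∑ i, ∑ j, ∑ k, u i * v j * w k * pd k (fun y => om y i j) x := by
    rw [Finset.sum_rotate, Finset.sum_rotate]
    exact Finset.sum_congr rfl fun i _ => Finset.sum_congr rfl fun j _ =>
      Finset.sum_congr rfl fun k _ => by ring
  rw [h2, h3]
  simp only [← Finset.sum_add_distrib, ← mul_add]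
  refine Finset.sum_eq_zero fun i _ => Finset.sum_eq_zero fun j _ =>
    Finset.sum_eq_zero fun k _ => ?_
  rw [hclosed x hx j k i, mul_zero]

theorem Submodule.exists_continuousLinearMap_injOn {E : Type*} [NormedAddCommGroup E]
    [NormedSpace ℝ E] [FiniteDimensional ℝ E] (K : Submodule ℝ E) {s : ℕ}
    (hK : finrank ℝ K = s) :
    ∃ C : E →L[ℝ] (Fin s → ℝ), ∀ v ∈ K, C v = 0 → v = 0 := by
  obtain ⟨P, hP⟩ := K.subtype.exists_leftInverse_of_injective K.ker_subtype
  let L : K ≃ₗ[ℝ] (Fin s → ℝ) := LinearEquiv.ofFinrankEq _ _ (by rw [hK, finrank_fin_fun])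
  refine ⟨LinearMap.toContinuousLinearMap (L.toLinearMap ∘ₗ P), fun v hv h => ?_⟩
  have h1 : P v = 0 := L.map_eq_zero_iff.1 h
  exact congrArg Subtype.val ((DFunLike.congr_fun hP ⟨v, hv⟩).symm.trans h1)

end Coordinates

end LieDarboux

/-- Classical Lie–Darboux theorem for a closed 2-form of constant rank `2m` on an open set of
`ℝ^(2m+s)`: locally there are smooth coordinates `φ = (p,q,C)` in which
`ω = Σ_{i=1}^m dpⁱ ∧ dqⁱ`. Here `pⁱ = φⁱ` and `qⁱ = φ^{m+i}`. -/
theorem lie_darboux_two_form (m s : ℕ)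
    (Ω : Set (Fin (2 * m + s) → ℝ)) (hΩ : IsOpen Ω)
    (om : (Fin (2 * m + s) → ℝ) → Fin (2 * m + s) → Fin (2 * m + s) → ℝ)
    (hsmooth : ∀ i j, ContDiffOn ℝ (⊤ : ℕ∞) (fun x => om x i j) Ω)
    (hskew : ∀ x, ∀ i j, om x i j = - om x j i)
    (hrank : ∀ x ∈ Ω, (Matrix.of fun i j => om x i j).rank = 2 * m)
    (hclosed : ∀ x ∈ Ω, ∀ i j k,
      pd k (fun y => om y i j) x + pd i (fun y => om y j k) x
        + pd j (fun y => om y k i) x = 0)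
    (x₀ : Fin (2 * m + s) → ℝ) (hx₀ : x₀ ∈ Ω) :
    ∃ (U : Set (Fin (2 * m + s) → ℝ)) (φ ψ : (Fin (2 * m + s) → ℝ) → (Fin (2 * m + s) → ℝ)),
      IsOpen U ∧ U ⊆ Ω ∧ x₀ ∈ U ∧
      ContDiffOn ℝ (⊤ : ℕ∞) φ U ∧ IsOpen (φ '' U) ∧
      ContDiffOn ℝ (⊤ : ℕ∞) ψ (φ '' U) ∧ (∀ x ∈ U, ψ (φ x) = x) ∧
      (∀ x ∈ U, ∀ c d,
        om x c d = ∑ i : Fin m,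
          (pd c (fun y => φ y ⟨i.val, by have := i.isLt; omega⟩) x
              * pd d (fun y => φ y ⟨m + i.val, by have := i.isLt; omega⟩) x
            - pd d (fun y => φ y ⟨i.val, by have := i.isLt; omega⟩) x
              * pd c (fun y => φ y ⟨m + i.val, by have := i.isLt; omega⟩) x)) := by
  have hker : ∀ x ∈ Ω, Module.finrank ℝ (LinearMap.ker (coordForm (om x) :
      (Fin (2 * m + s) → ℝ) →ₗ[ℝ] (Fin (2 * m + s) → ℝ) →L[ℝ] ℝ)) = s := fun x hx => by
    have h1 := finrank_ker_coordForm (om x)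
    have h2 : (Matrix.of (om x)).rank = 2 * m := hrank x hx
    omega
  obtain ⟨N, hN, V, hV, hxV, p, q, hp, hq, hpq⟩ := darbouxStatement (2 * m + s) s _ _ Ω x₀
    (Module.finrank_fin_fun ℝ) hΩ hx₀ (isClosedTwoFormOn_coordForm hΩ hsmooth hskew hclosed) hker
  obtain rfl : N = m := by omega
  obtain ⟨C, hC⟩ := Submodule.exists_continuousLinearMap_injOn _ (hker x₀ hx₀)
  let comp : Fin (2 * N + s) → (Fin (2 * N + s) → ℝ) → ℝ := fun j =>
    if h : j.1 < N then p ⟨j, h⟩ else if h2 : j.1 < 2 * N then q ⟨j - N, by omega⟩ else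
      fun y => C y ⟨j - 2 * N, by omega⟩
  have hcp : ∀ i : Fin N, comp ⟨i.1, by omega⟩ = p i := fun i => dif_pos i.2
  have hcq : ∀ i : Fin N, comp ⟨N + i.1, by omega⟩ = q i := fun i => by
    have h1 : ¬ N + i.1 < N := by omega
    have h2 : N + i.1 < 2 * N := by omega
    simp only [comp, dif_neg h1, dif_pos h2, Nat.add_sub_cancel_left]
  have hcC : ∀ i : Fin s, comp ⟨2 * N + i.1, by omega⟩ = fun y => C y i := fun i => by
    have h1 : ¬ 2 * N + i.1 < N := by omega
    have h2 : ¬ 2 * N + i.1 < 2 * N := by omega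
    simp only [comp, dif_neg h1, dif_neg h2, Nat.add_sub_cancel_left]
  have hcs : ∀ j, ContDiffOn ℝ (⊤ : ℕ∞) (comp j) (V ∩ Ω) := by
    intro j
    simp only [comp]
    split_ifs
    · exact (hp _).mono Set.inter_subset_left
    · exact (hq _).mono Set.inter_subset_left
    · exact ((ContinuousLinearMap.proj (R := ℝ) (φ := fun _ : Fin s => ℝ) _).contDiff.comp
        C.contDiff).contDiffOn
  have hVΩ : IsOpen (V ∩ Ω) := hV.inter hΩ
  let Φ : (Fin (2 * N + s) → ℝ) → Fin (2 * N + s) → ℝ := fun y j => comp j y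
  have hΦ : ContDiffOn ℝ (⊤ : ℕ∞) Φ (V ∩ Ω) := contDiffOn_pi.2 hcs
  have hdΦ : HasFDerivAt Φ (fderiv ℝ Φ x₀) x₀ :=
    ((hΦ.contDiffAt (hVΩ.mem_nhds ⟨hxV, hx₀⟩)).differentiableAt (by simp)).hasFDerivAt
  have hdc : ∀ j v, fderiv ℝ (comp j) x₀ v = fderiv ℝ Φ x₀ v j := fun j v => by
    rw [(hasFDerivAt_pi'.1 hdΦ j).fderiv]
    rfl
  have hinj : Function.Injective
      (fderiv ℝ Φ x₀ : (Fin (2 * N + s) → ℝ) →ₗ[ℝ] Fin (2 * N + s) → ℝ) := by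
    refine (injective_iff_map_eq_zero _).2 fun v hv => ?_
    have hv' : ∀ j, fderiv ℝ (comp j) x₀ v = 0 := fun j => by
      rw [hdc]
      exact congrFun hv j
    refine hC v ?_ ?_
    · refine LinearMap.mem_ker.2 (ContinuousLinearMap.ext fun w => (hpq x₀ hxV v w).trans ?_)
      refine Finset.sum_eq_zero fun i _ => ?_
      rw [← hcp i, ← hcq i, hv', hv']
      ring
    · funext i
      have h1 := hv' ⟨2 * N + i.1, by omega⟩
      rw [hcC, (hasFDerivAt_pi'.1 C.hasFDerivAt i).fderiv] at h1
      exact h1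
  let D := (LinearMap.linearEquivOfInjective _ hinj rfl).toContinuousLinearEquiv
  have hD : HasFDerivAt Φ (D : (Fin (2 * N + s) → ℝ) →L[ℝ] Fin (2 * N + s) → ℝ) x₀ :=
    hdΦ.congr_fderiv (ContinuousLinearMap.ext fun _ => rfl)
  obtain ⟨e, he, hxe, hes, hesymm⟩ :=
    exists_openPartialHomeomorph_contDiffOn hVΩ ⟨hxV, hx₀⟩ hΦ hD
  have himage : Φ '' e.source = e.target := he ▸ e.image_source_eq_target
  refine ⟨e.source, Φ, e.symm, e.open_source, fun x hx => (hes hx).2, hxe, hΦ.mono hes,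
    himage ▸ e.open_target, himage ▸ hesymm, fun x hx => he ▸ e.left_inv hx, fun x hx c d => ?_⟩
  rw [← coordForm_single_single (om x) c d, hpq x (hes hx).1]
  refine Finset.sum_congr rfl fun i _ => ?_
  rw [← hcp i, ← hcq i]
  rfl
end
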